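/- Let F : [0,T] × 𝒫₂ → ℝ satisfy (A1), let ψ : 𝒫₂ → ℝ satisfy (A2), and let t₁ ∈ [0,T]. Then the terminal value problem ∂_t φ(t,m) + (1/2) ∫_{ℝ^d} div[D_m φ](t,m,x) dm(x) + F(t,m) = 0 on [0,t₁) × 𝒫₂ with φ(t₁,·) = ψ admits as unique classical solution the map φ(t,m) = ψ(p^{t,m}_{t₁}) + ∫_t^{t₁} F(s, p^{t,m}_s) ds; this φ is continuous and satisfies (A3). -/

import Mathlib

open MeasureTheory Filter Set
open scoped Topology ENNReal NNReal BoundedContinuousFunction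

noncomputable section

/-- Euclidean space `ℝ^d`. -/
abbrev Ed (d : ℕ) : Type := EuclideanSpace ℝ (Fin d)

/-- `m ∈ 𝒫_p` : Borel probability measure on `ℝ^d` with finite `p`-th moment. -/
def MemP (d : ℕ) (p : ℝ) (m : Measure (Ed d)) : Prop :=
  IsProbabilityMeasure m ∧ Integrable (fun x => ‖x‖ ^ p) m

/-- `γ` is a coupling of `m` and `m'`. -/
def IsCoupling (d : ℕ) (γ : Measure (Ed d × Ed d)) (m m' : Measure (Ed d)) : Prop :=
  γ.map Prod.fst = m ∧ γ.map Prod.snd = m'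

/-- The `p`-Wasserstein distance. -/
def wdist (d : ℕ) (p : ℝ) (m m' : Measure (Ed d)) : ℝ :=
  sInf { c : ℝ | ∃ γ : Measure (Ed d × Ed d), IsProbabilityMeasure γ ∧ IsCoupling d γ m m' ∧
      c = (∫ q, ‖q.1 - q.2‖ ^ p ∂γ) ^ (1 / p) }

/-- The Gaussian kernel `ρ_δ`. -/
def gaussDensity (d : ℕ) (δ : ℝ) (x : Ed d) : ℝ :=
  (2 * Real.pi * δ) ^ (-(d : ℝ) / 2) * Real.exp (-‖x‖ ^ 2 / (2 * δ))

/-- The centered Gaussian measure with variance `δ` on `ℝ^d`. -/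
def gaussMeasure (d : ℕ) (δ : ℝ) : Measure (Ed d) :=
  volume.withDensity fun x => ENNReal.ofReal (gaussDensity d δ x)

/-- The heat flow `p^{t,m}_s` : the law at time `s` of a Brownian motion started
at time `t` with initial law `m`. -/
def heatFlow (d : ℕ) (t s : ℝ) (m : Measure (Ed d)) : Measure (Ed d) :=
  if s ≤ t then m
  else Measure.map (fun q : Ed d × Ed d => q.1 + q.2) (m.prod (gaussMeasure d (s - t)))

/-- The Laplacian of a function on `ℝ^d` (the spatial divergence of its gradient),
`div[∇g](x) = Σ_i ∂²g/∂x_i²(x)`. -/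
def lapl (d : ℕ) (g : Ed d → ℝ) (x : Ed d) : ℝ :=
  ∑ i : Fin d, iteratedFDeriv ℝ 2 g x (fun _ => EuclideanSpace.single i (1:ℝ))

/-- A test function satisfying condition (A3): `φ` is lower semicontinuous (for `d₁`) and
`d₂`-continuous, the derivatives `∂φ/∂t`, `δφ/δm`, `∇_x(δφ/δm)`, `∇²_x(δφ/δm)` exist and
are `d₂`-continuous on `[0,T) × 𝒫₂ × ℝ^d`, and `δφ/δm` and its first and second spatial
derivatives have at most quadratic growth in `x`, uniformly in `(t,m)`. -/
structure TestFn (d : ℕ) (T : ℝ) where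
  /-- the test function `φ(t,m)` -/
  φ : ℝ → Measure (Ed d) → ℝ
  /-- the time derivative `∂φ/∂t` -/
  φt : ℝ → Measure (Ed d) → ℝ
  /-- the linear functional derivative `δφ/δm (t,m,x)` -/
  δφ : ℝ → Measure (Ed d) → Ed d → ℝ
  lsc : ∀ t ∈ Set.Icc 0 T, ∀ m : Measure (Ed d), MemP d 2 m → ∀ ε > (0:ℝ), ∃ η > (0:ℝ),
    ∀ t' ∈ Set.Icc 0 T, ∀ m' : Measure (Ed d), MemP d 2 m' →
      |t' - t| < η → wdist d 1 m m' < η → φ t m - ε < φ t' m'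
  d2cont : ∀ t ∈ Set.Icc 0 T, ∀ m : Measure (Ed d), MemP d 2 m → ∀ ε > (0:ℝ), ∃ η > (0:ℝ),
    ∀ t' ∈ Set.Icc 0 T, ∀ m' : Measure (Ed d), MemP d 2 m' →
      |t' - t| < η → wdist d 2 m m' < η → |φ t' m' - φ t m| < ε
  timeDeriv : ∀ m : Measure (Ed d), MemP d 2 m → ∀ t ∈ Set.Ico 0 T,
    HasDerivWithinAt (fun s => φ s m) (φt t m) (Set.Icc 0 T) t
  measDeriv : ∀ t ∈ Set.Ico 0 T, ∀ m : Measure (Ed d), MemP d 2 m →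
    ∀ m' : Measure (Ed d), MemP d 2 m' →
      Tendsto (fun r : ℝ =>
          (φ t ((1 - ENNReal.ofReal r) • m + ENNReal.ofReal r • m') - φ t m) / r)
        (𝓝[>] 0) (𝓝 (∫ x, δφ t m x ∂m'))
  normalized : ∀ t ∈ Set.Ico 0 T, ∀ m : Measure (Ed d), MemP d 2 m →
    ∫ x, δφ t m x ∂m = 0
  smoothX : ∀ t ∈ Set.Ico 0 T, ∀ m : Measure (Ed d), MemP d 2 m → ContDiff ℝ 2 (δφ t m)
  quadGrowth : ∃ c : ℝ, ∀ t ∈ Set.Ico 0 T, ∀ m : Measure (Ed d), MemP d 2 m → ∀ x : Ed d,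
    |δφ t m x| ≤ c * (1 + ‖x‖ ^ 2) ∧ ‖fderiv ℝ (δφ t m) x‖ ≤ c * (1 + ‖x‖ ^ 2) ∧
      ‖iteratedFDeriv ℝ 2 (δφ t m) x‖ ≤ c * (1 + ‖x‖ ^ 2)
  d2contDeriv : ∀ t ∈ Set.Ico 0 T, ∀ m : Measure (Ed d), MemP d 2 m → ∀ x : Ed d,
    ∀ ε > (0:ℝ), ∃ η > (0:ℝ), ∀ t' ∈ Set.Ico 0 T, ∀ m' : Measure (Ed d), MemP d 2 m' →
      ∀ x' : Ed d, |t' - t| < η → wdist d 2 m m' < η → ‖x' - x‖ < η →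
        |φt t' m' - φt t m| < ε ∧ |δφ t' m' x' - δφ t m x| < ε ∧
          ‖fderiv ℝ (δφ t' m') x' - fderiv ℝ (δφ t m) x‖ < ε ∧
          ‖iteratedFDeriv ℝ 2 (δφ t' m') x' - iteratedFDeriv ℝ 2 (δφ t m) x‖ < ε

/-- `φ − u` has a local minimum at `(t,m)` (locality for `|·|` in time and `d₁` in measure). -/
def LocalMinAt (d : ℕ) (T : ℝ) (g : ℝ → Measure (Ed d) → ℝ)
    (t : ℝ) (m : Measure (Ed d)) : Prop :=
  ∃ η > (0:ℝ), ∀ t' ∈ Set.Icc 0 T, ∀ m' : Measure (Ed d), MemP d 2 m' →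
    |t' - t| ≤ η → wdist d 1 m m' ≤ η → g t m ≤ g t' m'

/-- `u` is a (viscosity) subsolution on `[0,T) × 𝒫₂` of the Hamilton-Jacobi equation
`∂_t U(t,m) + ½ ∫ div[D_m U](t,m,x) dm(x) + F(t,m) = 0` : for every `(t,m) ∈ [0,T) × 𝒫₂`
and every test function `φ` satisfying (A3) such that `φ − u` has a local minimum at
`(t,m)`, one has `∂_t φ(t,m) + ½ ∫ div[D_m φ](t,m,x) dm(x) + F(t,m) ≥ 0`. -/
def IsSubsolution (d : ℕ) (T : ℝ) (F : ℝ → Measure (Ed d) → ℝ)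
    (u : ℝ → Measure (Ed d) → ℝ) : Prop :=
  ∀ t ∈ Set.Ico 0 T, ∀ m : Measure (Ed d), MemP d 2 m → ∀ ψ : TestFn d T,
    LocalMinAt d T (fun s μ => ψ.φ s μ - u s μ) t m →
      ψ.φt t m + (1 / 2) * (∫ x, lapl d (ψ.δφ t m) x ∂m) + F t m ≥ 0

/-- `u : [0,T] × 𝒫₂ → ℝ` is (jointly) continuous for the distance `|·| + d₁`. -/
def ContD1 (d : ℕ) (T : ℝ) (u : ℝ → Measure (Ed d) → ℝ) : Prop :=
  ∀ t ∈ Set.Icc 0 T, ∀ m : Measure (Ed d), MemP d 2 m → ∀ ε > (0:ℝ), ∃ η > (0:ℝ),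
    ∀ t' ∈ Set.Icc 0 T, ∀ m' : Measure (Ed d), MemP d 2 m' →
      |t' - t| < η → wdist d 1 m m' < η → |u t' m' - u t m| < ε

/-- `u : [0,T] × 𝒫₂ → ℝ` is bounded. -/
def BddD1 (d : ℕ) (T : ℝ) (u : ℝ → Measure (Ed d) → ℝ) : Prop :=
  ∃ c : ℝ, ∀ t ∈ Set.Icc 0 T, ∀ m : Measure (Ed d), MemP d 2 m → |u t m| ≤ c

/-- The data of condition (A1) for a source term `F` : `F` is bounded and continuous, and
`δF/δm`, `∇_x(δF/δm)`, `∇²_x(δF/δm)` exist and are bounded and continuous. -/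
structure A1Data (d : ℕ) (T : ℝ) where
  /-- the source term `F(t,m)` -/
  F : ℝ → Measure (Ed d) → ℝ
  /-- the linear functional derivative `δF/δm (t,m,x)` -/
  δF : ℝ → Measure (Ed d) → Ed d → ℝ
  bddF : BddD1 d T F
  contF : ContD1 d T F
  measDeriv : ∀ t ∈ Set.Icc 0 T, ∀ m : Measure (Ed d), MemP d 2 m →
    ∀ m' : Measure (Ed d), MemP d 2 m' →
      Tendsto (fun r : ℝ =>
          (F t ((1 - ENNReal.ofReal r) • m + ENNReal.ofReal r • m') - F t m) / r)
        (𝓝[>] 0) (𝓝 (∫ x, δF t m x ∂m'))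
  normalized : ∀ t ∈ Set.Icc 0 T, ∀ m : Measure (Ed d), MemP d 2 m →
    ∫ x, δF t m x ∂m = 0
  smoothX : ∀ t ∈ Set.Icc 0 T, ∀ m : Measure (Ed d), MemP d 2 m → ContDiff ℝ 2 (δF t m)
  bddDeriv : ∃ c : ℝ, ∀ t ∈ Set.Icc 0 T, ∀ m : Measure (Ed d), MemP d 2 m → ∀ x : Ed d,
    |δF t m x| ≤ c ∧ ‖fderiv ℝ (δF t m) x‖ ≤ c ∧ ‖iteratedFDeriv ℝ 2 (δF t m) x‖ ≤ c
  contDeriv : ∀ t ∈ Set.Icc 0 T, ∀ m : Measure (Ed d), MemP d 2 m → ∀ x : Ed d,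
    ∀ ε > (0:ℝ), ∃ η > (0:ℝ), ∀ t' ∈ Set.Icc 0 T, ∀ m' : Measure (Ed d), MemP d 2 m' →
      ∀ x' : Ed d, |t' - t| < η → wdist d 1 m m' < η → ‖x' - x‖ < η →
        |δF t' m' x' - δF t m x| < ε ∧
          ‖fderiv ℝ (δF t' m') x' - fderiv ℝ (δF t m) x‖ < ε ∧
          ‖iteratedFDeriv ℝ 2 (δF t' m') x' - iteratedFDeriv ℝ 2 (δF t m) x‖ < ε

/-- The data of condition (A2) for a terminal condition `ψ` : `ψ` is continuous with at
most linear growth, and `δψ/δm`, `∇_x(δψ/δm)`, `∇²_x(δψ/δm)` exist, are continuous, and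
have linear growth in `x` uniformly in `m`. -/
structure A2Data (d : ℕ) where
  /-- the terminal condition `ψ(m)` -/
  ψ : Measure (Ed d) → ℝ
  /-- the linear functional derivative `δψ/δm (m,x)` -/
  δψ : Measure (Ed d) → Ed d → ℝ
  growth : ∃ c : ℝ, ∀ m : Measure (Ed d), MemP d 2 m → |ψ m| ≤ c * (1 + ∫ x, ‖x‖ ∂m)
  contψ : ∀ m : Measure (Ed d), MemP d 2 m → ∀ ε > (0:ℝ), ∃ η > (0:ℝ),
    ∀ m' : Measure (Ed d), MemP d 2 m' → wdist d 1 m m' < η → |ψ m' - ψ m| < ε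
  measDeriv : ∀ m : Measure (Ed d), MemP d 2 m → ∀ m' : Measure (Ed d), MemP d 2 m' →
    Tendsto (fun r : ℝ =>
        (ψ ((1 - ENNReal.ofReal r) • m + ENNReal.ofReal r • m') - ψ m) / r)
      (𝓝[>] 0) (𝓝 (∫ x, δψ m x ∂m'))
  normalized : ∀ m : Measure (Ed d), MemP d 2 m → ∫ x, δψ m x ∂m = 0
  smoothX : ∀ m : Measure (Ed d), MemP d 2 m → ContDiff ℝ 2 (δψ m)
  derivGrowth : ∃ c : ℝ, ∀ m : Measure (Ed d), MemP d 2 m → ∀ x : Ed d,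
    |δψ m x| ≤ c * (1 + ‖x‖) ∧ ‖fderiv ℝ (δψ m) x‖ ≤ c * (1 + ‖x‖) ∧
      ‖iteratedFDeriv ℝ 2 (δψ m) x‖ ≤ c * (1 + ‖x‖)
  contDeriv : ∀ m : Measure (Ed d), MemP d 2 m → ∀ x : Ed d, ∀ ε > (0:ℝ), ∃ η > (0:ℝ),
    ∀ m' : Measure (Ed d), MemP d 2 m' → ∀ x' : Ed d,
      wdist d 1 m m' < η → ‖x' - x‖ < η →
        |δψ m' x' - δψ m x| < ε ∧ ‖fderiv ℝ (δψ m') x' - fderiv ℝ (δψ m) x‖ < ε ∧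
          ‖iteratedFDeriv ℝ 2 (δψ m') x' - iteratedFDeriv ℝ 2 (δψ m) x‖ < ε

section Gaussian

variable {d : ℕ}

theorem gaussDensity_nonneg {δ : ℝ} (hδ : 0 < δ) (x : Ed d) : 0 ≤ gaussDensity d δ x := by
  unfold gaussDensity; positivity

theorem continuous_gaussDensity (δ : ℝ) : Continuous (gaussDensity d δ) := by
  unfold gaussDensity; fun_prop

theorem integrable_exp_neg_mul_sq_norm {b : ℝ} (hb : 0 < b) :
    Integrable (fun x : Ed d => Real.exp (-b * ‖x‖ ^ 2)) := by
  have h := (GaussianFourier.integrable_cexp_neg_mul_sq_norm_add (V := Ed d) (b := (b : ℂ))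
    (by simpa using hb) 0 0).norm
  refine h.congr (Eventually.of_forall fun x => ?_)
  simp only [Complex.norm_exp]
  congr 1
  simp [← Complex.ofReal_pow]

theorem integral_gaussDensity {δ : ℝ} (hδ : 0 < δ) : ∫ x : Ed d, gaussDensity d δ x = 1 := by
  unfold gaussDensity
  rw [integral_const_mul]
  have h := GaussianFourier.integral_rexp_neg_mul_sq_norm (V := Ed d) (b := 1 / (2 * δ))
    (by positivity)
  have e : ∀ x : Ed d, -‖x‖ ^ 2 / (2 * δ) = -(1 / (2 * δ)) * ‖x‖ ^ 2 := fun x => by ring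
  simp_rw [e]
  rw [h, finrank_euclideanSpace_fin, show Real.pi / (1 / (2 * δ)) = 2 * Real.pi * δ by field_simp,
    ← Real.rpow_add (by positivity)]
  simp [neg_div]

theorem integrable_gaussDensity {δ : ℝ} (hδ : 0 < δ) : Integrable (gaussDensity d δ) := by
  by_contra h
  have := integral_gaussDensity (d := d) hδ
  rw [integral_undef h] at this
  exact zero_ne_one this

theorem isProbabilityMeasure_gaussMeasure {δ : ℝ} (hδ : 0 < δ) :
    IsProbabilityMeasure (gaussMeasure d δ) := by
  constructor
  rw [gaussMeasure, withDensity_apply _ MeasurableSet.univ, Measure.restrict_univ,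
    ← ofReal_integral_eq_lintegral_ofReal (integrable_gaussDensity hδ)
      (Eventually.of_forall (gaussDensity_nonneg hδ)), integral_gaussDensity hδ, ENNReal.ofReal_one]

instance isProbabilityMeasure_gaussMeasure_one : IsProbabilityMeasure (gaussMeasure d 1) :=
  isProbabilityMeasure_gaussMeasure one_pos

theorem gaussMeasure_eq_map {δ : ℝ} (hδ : 0 < δ) :
    gaussMeasure d δ = (gaussMeasure d 1).map (fun z => √δ • z) := by
  have hs : √δ ≠ 0 := (Real.sqrt_pos.2 hδ).ne'
  ext A hA
  have hm : Measurable fun z : Ed d => √δ • z := by fun_prop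
  rw [Measure.map_apply hm hA, gaussMeasure, gaussMeasure, withDensity_apply _ hA,
    withDensity_apply _ (hm hA), ← lintegral_indicator hA, ← lintegral_indicator (hm hA)]
  have hmap := Measure.map_addHaar_smul (volume : Measure (Ed d)) hs
  have h2 : ∫⁻ z : Ed d, A.indicator (fun x => ENNReal.ofReal (gaussDensity d δ x)) (√δ • z)
      = ENNReal.ofReal |((√δ) ^ (Module.finrank ℝ (Ed d)))⁻¹| *
        ∫⁻ z : Ed d, A.indicator (fun x => ENNReal.ofReal (gaussDensity d δ x)) z := by
    rw [← lintegral_map (f := A.indicator (fun x => ENNReal.ofReal (gaussDensity d δ x)))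
      (((continuous_gaussDensity δ).measurable.ennreal_ofReal).indicator hA) hm, hmap,
      lintegral_smul_measure, smul_eq_mul]
  have h3 : ∀ z : Ed d, ((fun z : Ed d => √δ • z) ⁻¹' A).indicator
        (fun x => ENNReal.ofReal (gaussDensity d 1 x)) z
      = ENNReal.ofReal ((√δ) ^ (Module.finrank ℝ (Ed d))) *
        A.indicator (fun x => ENNReal.ofReal (gaussDensity d δ x)) (√δ • z) := by
    intro z
    by_cases hz : √δ • z ∈ A
    · rw [indicator_of_mem hz, indicator_of_mem (by exact hz),
        ← ENNReal.ofReal_mul (by positivity)]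
      congr 1
      unfold gaussDensity
      rw [norm_smul, Real.norm_of_nonneg (Real.sqrt_nonneg _), mul_pow, Real.sq_sqrt hδ.le,
        ← mul_assoc, finrank_euclideanSpace_fin]
      congr 1
      · rw [Real.mul_rpow (by positivity) hδ.le, mul_one, mul_left_comm]
        have : √δ ^ d * δ ^ (-(d : ℝ) / 2) = 1 := by
          rw [← Real.rpow_natCast, Real.sqrt_eq_rpow, ← Real.rpow_mul hδ.le, ← Real.rpow_add hδ]
          rw [show (1 / 2 * (d : ℝ) + -(d : ℝ) / 2) = 0 by ring, Real.rpow_zero]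
        rw [this, mul_one]
      · congr 1
        field_simp
    · rw [indicator_of_notMem hz, indicator_of_notMem (by exact hz), mul_zero]
  simp_rw [h3]
  rw [lintegral_const_mul' _ _ ENNReal.ofReal_ne_top, h2, ← mul_assoc,
    ← ENNReal.ofReal_mul (by positivity), abs_of_nonneg (by positivity),
    mul_inv_cancel₀ (by positivity), ENNReal.ofReal_one, one_mul]

theorem integral_gaussMeasure_one (f : Ed d → ℝ) :
    ∫ z, f z ∂(gaussMeasure d 1) = ∫ z, gaussDensity d 1 z * f z := by
  rw [gaussMeasure, integral_withDensity_eq_integral_toReal_smul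
    (continuous_gaussDensity 1).measurable.ennreal_ofReal (by simp)]
  simp [ENNReal.toReal_ofReal (gaussDensity_nonneg one_pos _)]

theorem integrable_gaussMeasure_one_iff (f : Ed d → ℝ) :
    Integrable f (gaussMeasure d 1) ↔ Integrable (fun z => gaussDensity d 1 z * f z) := by
  rw [gaussMeasure, integrable_withDensity_iff_integrable_smul'
    (continuous_gaussDensity 1).measurable.ennreal_ofReal (by simp)]
  simp [ENNReal.toReal_ofReal (gaussDensity_nonneg one_pos _)]

/-- The standard Gaussian measure has finite moments of every order. -/
theorem integrable_norm_pow_gaussMeasure (k : ℕ) :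
    Integrable (fun z : Ed d => ‖z‖ ^ k) (gaussMeasure d 1) := by
  rw [integrable_gaussMeasure_one_iff]
  have h := (integrable_exp_neg_mul_sq_norm (d := d) (b := 1 / 4) (by norm_num)).const_mul
    ((2 * Real.pi * 1) ^ (-(d : ℝ) / 2) * (k.factorial * Real.exp 1))
  refine h.mono' ((continuous_gaussDensity 1).mul (by fun_prop)).aestronglyMeasurable
    (Eventually.of_forall fun z => ?_)
  rw [Real.norm_of_nonneg (mul_nonneg (gaussDensity_nonneg one_pos z) (by positivity))]
  unfold gaussDensity
  have hκ : (0 : ℝ) ≤ (2 * Real.pi * 1) ^ (-(d : ℝ) / 2) := by positivity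
  rw [mul_assoc (_ ^ _), mul_assoc (_ ^ (-(d : ℝ) / 2))]
  refine mul_le_mul_of_nonneg_left ?_ hκ
  have h1 : ‖z‖ ^ k ≤ k.factorial * Real.exp ‖z‖ := by
    have := Real.pow_div_factorial_le_exp ‖z‖ (norm_nonneg z) k
    rwa [div_le_iff₀ (by positivity), mul_comm] at this
  calc Real.exp (-‖z‖ ^ 2 / (2 * 1)) * ‖z‖ ^ k
      ≤ Real.exp (-‖z‖ ^ 2 / (2 * 1)) * (k.factorial * Real.exp ‖z‖) := by gcongr
    _ = k.factorial * Real.exp (-‖z‖ ^ 2 / (2 * 1) + ‖z‖) := by rw [Real.exp_add]; ring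
    _ ≤ k.factorial * Real.exp (1 + -(1 / 4) * ‖z‖ ^ 2) := by
        refine mul_le_mul_of_nonneg_left (Real.exp_le_exp.2 ?_) (by positivity)
        nlinarith [sq_nonneg (‖z‖ - 2)]
    _ = _ := by rw [Real.exp_add]; ring

theorem hasFDerivAt_gaussDensity_one (z : Ed d) :
    HasFDerivAt (gaussDensity d 1) (-(gaussDensity d 1 z) • innerSL ℝ z) z := by
  unfold gaussDensity
  have h := (hasStrictFDerivAt_norm_sq z).hasFDerivAt
  have h2 := ((h.const_mul (-1 / 2)).exp).const_mul ((2 * Real.pi * 1) ^ (-(d : ℝ) / 2))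
  refine (h2.congr_of_eventuallyEq ?_).congr_fderiv ?_
  · refine Eventually.of_forall fun x => ?_
    simp only
    ring_nf
  · ext v
    simp
    ring_nf

/-- Gaussian integration by parts. -/
theorem integral_inner_mul_gaussMeasure {f : Ed d → ℝ} {c : ℝ} (hf : ContDiff ℝ 1 f)
    (h0 : ∀ z, |f z| ≤ c * (1 + ‖z‖ ^ 2)) (h1 : ∀ z, ‖fderiv ℝ f z‖ ≤ c * (1 + ‖z‖ ^ 2))
    (v : Ed d) :
    ∫ z, inner ℝ z v * f z ∂(gaussMeasure d 1) = ∫ z, fderiv ℝ f z v ∂(gaussMeasure d 1) := by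
  have hdf : Continuous fun z => fderiv ℝ f z v :=
    (hf.continuous_fderiv one_ne_zero).clm_apply continuous_const
  have hmom : Integrable (fun z : Ed d => c * (1 + ‖z‖ ^ 2)) (gaussMeasure d 1) :=
    ((integrable_const _).add (integrable_norm_pow_gaussMeasure 2)).const_mul c
  have i0 : Integrable f (gaussMeasure d 1) :=
    hmom.mono' hf.continuous.aestronglyMeasurable (Eventually.of_forall h0)
  have i1 : Integrable (fun z => fderiv ℝ f z v) (gaussMeasure d 1) := by
    refine (hmom.mul_const ‖v‖).mono' hdf.aestronglyMeasurable (Eventually.of_forall fun z => ?_)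
    exact ((fderiv ℝ f z).le_opNorm v).trans (by gcongr; exact h1 z)
  have i2 : Integrable (fun z => inner ℝ z v * f z) (gaussMeasure d 1) := by
    have hm3 : Integrable (fun z : Ed d => ‖v‖ * (c * (‖z‖ ^ 1 + ‖z‖ ^ 3))) (gaussMeasure d 1) :=
      (((integrable_norm_pow_gaussMeasure 1).add
        (integrable_norm_pow_gaussMeasure 3)).const_mul c).const_mul ‖v‖
    refine hm3.mono' ((by fun_prop : Continuous fun z : Ed d => inner ℝ z v).mul
      hf.continuous).aestronglyMeasurable (Eventually.of_forall fun z => ?_)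
    rw [norm_mul]
    calc ‖inner ℝ z v‖ * ‖f z‖ ≤ (‖z‖ * ‖v‖) * (c * (1 + ‖z‖ ^ 2)) := by
          gcongr
          · exact norm_inner_le_norm z v
          · exact h0 z
      _ = _ := by ring
  rw [integral_gaussMeasure_one, integral_gaussMeasure_one]
  rw [integrable_gaussMeasure_one_iff] at i0 i1 i2
  have hρ : ∀ z : Ed d, fderiv ℝ (gaussDensity d 1) z v = -(gaussDensity d 1 z * inner ℝ z v) := by
    intro z
    rw [(hasFDerivAt_gaussDensity_one z).fderiv]
    simp
  rw [integral_mul_fderiv_eq_neg_fderiv_mul_of_integrable (v := v) ?_ i1 i0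
    (fun z _ => (hasFDerivAt_gaussDensity_one z).differentiableAt)
    (fun z _ => (hf.differentiable one_ne_zero) z)]
  · rw [← integral_neg]
    congr 1; ext z
    rw [hρ]; ring
  · refine i2.neg.congr (Eventually.of_forall fun z => ?_)
    simp only [Pi.neg_apply]
    rw [hρ]; ring

end Gaussian

section Coupling

variable {d : ℕ}

theorem memP_two_iff {m : Measure (Ed d)} :
    MemP d 2 m ↔ IsProbabilityMeasure m ∧ Integrable (fun x => ‖x‖ ^ 2) m := by
  unfold MemP
  simp only [Real.rpow_two]

theorem MemP.integrable_quadratic {m : Measure (Ed d)} (hm : MemP d 2 m) (c : ℝ) :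
    Integrable (fun x => c * (1 + ‖x‖ ^ 2)) m :=
  have := hm.1
  ((integrable_const _).add (memP_two_iff.1 hm).2).const_mul c

theorem MemP.integrable_of_le {m : Measure (Ed d)} (hm : MemP d 2 m) {f : Ed d → ℝ} {c : ℝ}
    (hf : Continuous f) (h : ∀ x, |f x| ≤ c * (1 + ‖x‖ ^ 2)) : Integrable f m :=
  (hm.integrable_quadratic c).mono' hf.aestronglyMeasurable (Eventually.of_forall h)

theorem norm_sub_sq_le_two_mul {E : Type*} [NormedAddCommGroup E] (x y : E) :
    ‖x - y‖ ^ 2 ≤ 2 * ‖x‖ ^ 2 + 2 * ‖y‖ ^ 2 := by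
  nlinarith [norm_sub_le x y, norm_nonneg (x - y), sq_nonneg (‖x‖ - ‖y‖), norm_nonneg x,
    norm_nonneg y]

theorem norm_add_sq_le_two_mul {E : Type*} [NormedAddCommGroup E] (x y : E) :
    ‖x + y‖ ^ 2 ≤ 2 * ‖x‖ ^ 2 + 2 * ‖y‖ ^ 2 := by
  simpa using norm_sub_sq_le_two_mul x (-y)

theorem pow_le_one_add_sq {k : ℕ} (hk : k = 1 ∨ k = 2) (a : ℝ) :
    a ^ k ≤ 1 + a ^ 2 := by
  rcases hk with rfl | rfl
  · nlinarith [sq_nonneg (a - 1)]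
  · linarith

theorem IsCoupling.integrable_comp_fst {γ : Measure (Ed d × Ed d)} {m m' : Measure (Ed d)}
    (h : IsCoupling d γ m m') {f : Ed d → ℝ} (hf : Integrable f m) :
    Integrable (fun q => f q.1) γ := by
  rw [← h.1] at hf
  exact hf.comp_measurable measurable_fst

theorem IsCoupling.integrable_comp_snd {γ : Measure (Ed d × Ed d)} {m m' : Measure (Ed d)}
    (h : IsCoupling d γ m m') {f : Ed d → ℝ} (hf : Integrable f m') :
    Integrable (fun q => f q.2) γ := by
  rw [← h.2] at hf
  exact hf.comp_measurable measurable_snd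

theorem IsCoupling.integral_comp_fst {γ : Measure (Ed d × Ed d)} {m m' : Measure (Ed d)}
    (h : IsCoupling d γ m m') {f : Ed d → ℝ} (hf : Continuous f) :
    ∫ q, f q.1 ∂γ = ∫ x, f x ∂m := by
  rw [← h.1, integral_map measurable_fst.aemeasurable hf.aestronglyMeasurable]

theorem IsCoupling.integral_comp_snd {γ : Measure (Ed d × Ed d)} {m m' : Measure (Ed d)}
    (h : IsCoupling d γ m m') {f : Ed d → ℝ} (hf : Continuous f) :
    ∫ q, f q.2 ∂γ = ∫ x, f x ∂m' := by
  rw [← h.2, integral_map measurable_snd.aemeasurable hf.aestronglyMeasurable]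

theorem IsCoupling.integrable_norm_sub_sq {γ : Measure (Ed d × Ed d)} {m m' : Measure (Ed d)}
    (h : IsCoupling d γ m m') (hm : MemP d 2 m) (hm' : MemP d 2 m') :
    Integrable (fun q => ‖q.1 - q.2‖ ^ 2) γ := by
  have h1 := (h.integrable_comp_fst (memP_two_iff.1 hm).2).const_mul 2
  have h2 := (h.integrable_comp_snd (memP_two_iff.1 hm').2).const_mul 2
  refine (h1.add h2).mono' (by fun_prop) (Eventually.of_forall fun q => ?_)
  rw [Real.norm_of_nonneg (by positivity)]
  exact norm_sub_sq_le_two_mul _ _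

theorem IsCoupling.integrable_norm_sub_pow {γ : Measure (Ed d × Ed d)} [IsProbabilityMeasure γ]
    {m m' : Measure (Ed d)} (h : IsCoupling d γ m m') (hm : MemP d 2 m) (hm' : MemP d 2 m')
    {k : ℕ} (hk : k = 1 ∨ k = 2) : Integrable (fun q => ‖q.1 - q.2‖ ^ k) γ := by
  refine ((integrable_const (1 : ℝ)).add (h.integrable_norm_sub_sq hm hm')).mono' (by fun_prop)
    (Eventually.of_forall fun q => ?_)
  rw [Real.norm_of_nonneg (by positivity)]
  exact pow_le_one_add_sq hk _

/-- Convergence of a sequence of measures along couplings with vanishing transport cost of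
order `k`. -/
def WConv (d k : ℕ) (mn : ℕ → Measure (Ed d)) (m : Measure (Ed d)) : Prop :=
  ∃ γ : ℕ → Measure (Ed d × Ed d), (∀ n, IsProbabilityMeasure (γ n)) ∧
    (∀ n, IsCoupling d (γ n) m (mn n)) ∧
    Tendsto (fun n => ∫ q, ‖q.1 - q.2‖ ^ k ∂γ n) atTop (𝓝 0)

theorem wdist_nonneg (p : ℝ) (m m' : Measure (Ed d)) : 0 ≤ wdist d p m m' := by
  refine Real.sInf_nonneg ?_
  rintro c ⟨γ, -, -, rfl⟩
  positivity

theorem wdist_le {k : ℕ} {γ : Measure (Ed d × Ed d)} [hγ : IsProbabilityMeasure γ]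
    {m m' : Measure (Ed d)} (h : IsCoupling d γ m m') :
    wdist d k m m' ≤ (∫ q, ‖q.1 - q.2‖ ^ k ∂γ) ^ (1 / (k : ℝ)) := by
  refine csInf_le ⟨0, ?_⟩ ⟨γ, hγ, h, by simp only [Real.rpow_natCast]⟩
  rintro c ⟨γ, -, -, rfl⟩
  positivity

theorem WConv.tendsto_wdist {k : ℕ} (hk : k ≠ 0) {mn : ℕ → Measure (Ed d)} {m : Measure (Ed d)}
    (h : WConv d k mn m) : Tendsto (fun n => wdist d k m (mn n)) atTop (𝓝 0) := by
  obtain ⟨γ, hp, hc, ht⟩ := h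
  have ht' := ht.rpow_const (p := 1 / (k : ℝ)) (Or.inr (by positivity))
  rw [Real.zero_rpow (by positivity)] at ht'
  exact squeeze_zero (fun n => wdist_nonneg _ _ _) (fun n => have := hp n; wdist_le (hc n)) ht'

theorem isCoupling_prod {m m' : Measure (Ed d)} [IsProbabilityMeasure m]
    [IsProbabilityMeasure m'] : IsCoupling d (m.prod m') m m' := by
  constructor
  · exact (measurePreserving_fst (μ := m) (ν := m')).map_eq
  · exact (measurePreserving_snd (μ := m) (ν := m')).map_eq

theorem WConv.of_tendsto_wdist {k : ℕ} (hk : k ≠ 0) {mn : ℕ → Measure (Ed d)}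
    {m : Measure (Ed d)} (hm : IsProbabilityMeasure m) (hmn : ∀ n, IsProbabilityMeasure (mn n))
    (h : Tendsto (fun n => wdist d k m (mn n)) atTop (𝓝 0)) : WConv d k mn m := by
  have hk' : (0 : ℝ) < k := by positivity
  have key : ∀ n : ℕ, ∃ γ : Measure (Ed d × Ed d), IsProbabilityMeasure γ ∧
      IsCoupling d γ m (mn n) ∧
      ∫ q, ‖q.1 - q.2‖ ^ k ∂γ ≤ (wdist d k m (mn n) + 1 / ((n : ℝ) + 1)) ^ (k : ℝ) := by
    intro n
    have := hmn n
    have hlt : wdist d k m (mn n) < wdist d k m (mn n) + 1 / ((n : ℝ) + 1) := by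
      have : 0 < 1 / ((n : ℝ) + 1) := by positivity
      linarith
    have hne : {c : ℝ | ∃ γ : Measure (Ed d × Ed d), IsProbabilityMeasure γ ∧
        IsCoupling d γ m (mn n) ∧
        c = (∫ q, ‖q.1 - q.2‖ ^ (k : ℝ) ∂γ) ^ (1 / (k : ℝ))}.Nonempty :=
      ⟨_, m.prod (mn n), inferInstance, isCoupling_prod, rfl⟩
    obtain ⟨c, ⟨γ, hγ, hc, rfl⟩, hcl⟩ := exists_lt_of_csInf_lt hne hlt
    refine ⟨γ, hγ, hc, ?_⟩
    simp only [Real.rpow_natCast] at hcl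
    have h0 : 0 ≤ ∫ q, ‖q.1 - q.2‖ ^ k ∂γ := by positivity
    calc ∫ q, ‖q.1 - q.2‖ ^ k ∂γ = ((∫ q, ‖q.1 - q.2‖ ^ k ∂γ) ^ (1 / (k : ℝ))) ^ (k : ℝ) := by
          rw [← Real.rpow_mul h0, one_div_mul_cancel hk'.ne', Real.rpow_one]
      _ ≤ _ := Real.rpow_le_rpow (by positivity) hcl.le hk'.le
  choose γ h1 h2 h3 using key
  refine ⟨γ, h1, h2, ?_⟩
  have ht := (h.add tendsto_one_div_add_atTop_nhds_zero_nat).rpow_const (p := (k : ℝ))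
    (Or.inr hk'.le)
  rw [add_zero, Real.zero_rpow hk'.ne'] at ht
  exact squeeze_zero (fun n => by positivity) h3 ht

theorem WConv.comp_tendsto {k : ℕ} {mn : ℕ → Measure (Ed d)} {m : Measure (Ed d)}
    (h : WConv d k mn m) {φ : ℕ → ℕ} (hφ : Tendsto φ atTop atTop) :
    WConv d k (fun n => mn (φ n)) m := by
  obtain ⟨γ, hp, hc, ht⟩ := h
  exact ⟨fun n => γ (φ n), fun n => hp _, fun n => hc _, ht.comp hφ⟩

theorem WConv.one_of_two {mn : ℕ → Measure (Ed d)} {m : Measure (Ed d)} (hm : MemP d 2 m)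
    (hmn : ∀ n, MemP d 2 (mn n)) (h : WConv d 2 mn m) : WConv d 1 mn m := by
  obtain ⟨γ, hp, hc, ht⟩ := h
  refine ⟨γ, hp, hc, ?_⟩
  have ht' := ht.sqrt
  rw [Real.sqrt_zero] at ht'
  refine squeeze_zero (fun n => by positivity) (fun n => ?_) ht'
  have := hp n
  have hi := (hc n).integrable_norm_sub_sq hm (hmn n)
  have hi1 := (hc n).integrable_norm_sub_pow hm (hmn n) (Or.inl rfl)
  refine Real.le_sqrt_of_sq_le ?_
  set a := ∫ q, ‖q.1 - q.2‖ ^ 1 ∂γ n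
  have h0 : 0 ≤ ∫ q, (‖q.1 - q.2‖ ^ 1 - a) ^ 2 ∂γ n := by positivity
  have e : ∀ q : Ed d × Ed d, (‖q.1 - q.2‖ ^ 1 - a) ^ 2
      = ‖q.1 - q.2‖ ^ 2 - (2 * a) * ‖q.1 - q.2‖ ^ 1 + a ^ 2 := fun q => by ring
  simp_rw [e] at h0
  have hi' : Integrable (fun q : Ed d × Ed d => ‖q.1 - q.2‖ ^ 2 - (2 * a) * ‖q.1 - q.2‖ ^ 1)
      (γ n) := hi.sub (hi1.const_mul _)
  rw [integral_add hi' (integrable_const _), integral_sub hi (hi1.const_mul _), integral_const_mul] at h0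
  simp only [integral_const, probReal_univ, smul_eq_mul, one_mul] at h0
  nlinarith

/-- Continuous convergence of integrands of at most quadratic growth passes to the limit along
`2`-Wasserstein convergence. -/
theorem WConv.tendsto_integral {mn : ℕ → Measure (Ed d)} {m : Measure (Ed d)} (hm : MemP d 2 m)
    (hmn : ∀ n, MemP d 2 (mn n)) (h : WConv d 2 mn m) {g : ℕ → Ed d → ℝ} {g₀ : Ed d → ℝ} {c : ℝ}
    (hg : ∀ n, Continuous (g n)) (hg₀ : Continuous g₀)
    (hb : ∀ n x, |g n x| ≤ c * (1 + ‖x‖ ^ 2))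
    (hconv : ∀ x, Tendsto (fun p : ℕ × Ed d => g p.1 p.2) (atTop ×ˢ 𝓝 x) (𝓝 (g₀ x))) :
    Tendsto (fun n => ∫ x, g n x ∂mn n) atTop (𝓝 (∫ x, g₀ x ∂m)) := by
  have hmp := hm.1
  obtain ⟨γ, hp, hc, ht⟩ := h
  have hc0 : 0 ≤ c := by
    have := (abs_nonneg _).trans (hb 0 0)
    simpa using this
  have hb₀ : ∀ x, |g₀ x| ≤ c * (1 + ‖x‖ ^ 2) := by
    intro x
    have h1 : Tendsto (fun n => g n x) atTop (𝓝 (g₀ x)) :=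
      (hconv x).comp (tendsto_id.prodMk tendsto_const_nhds)
    exact le_of_tendsto h1.abs (Eventually.of_forall fun n => hb n x)
  rw [Metric.tendsto_atTop]
  intro ε' hε'
  set ε := ε' / 4 with hεdef
  have hε : 0 < ε := by positivity
  let B : ℕ → Set (Ed d) := fun k => {x | ‖x‖ ≤ k + 1 ∧
    ∀ n ≥ k, ∀ y, ‖y - x‖ < 1 / ((k : ℝ) + 1) → |g n y - g₀ x| ≤ ε}
  have hBclosed : ∀ k, IsClosed (B k) := by
    intro k
    refine (isClosed_le continuous_norm continuous_const).inter ?_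
    refine isClosed_of_closure_subset fun x hx n hn y hy => ?_
    obtain ⟨xs, hxs, hlim⟩ := mem_closure_iff_seq_limit.1 hx
    have h1 : ∀ᶠ j in atTop, ‖y - xs j‖ < 1 / ((k : ℝ) + 1) :=
      ((tendsto_const_nhds.sub hlim).norm).eventually_lt_const hy
    have h2 : Tendsto (fun j => |g n y - g₀ (xs j)|) atTop (𝓝 |g n y - g₀ x|) :=
      (tendsto_const_nhds.sub ((hg₀.tendsto x).comp hlim)).abs
    exact le_of_tendsto h2 (h1.mono fun j hj => hxs j n hn y hj)
  have hBev : ∀ x, ∀ᶠ k in atTop, x ∈ B k := by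
    intro x
    have h1 := (hconv x).eventually (Metric.closedBall_mem_nhds (g₀ x) hε)
    obtain ⟨P, hP, Q, hQ, hPQ⟩ := eventually_prod_iff.1 h1
    obtain ⟨N, hN⟩ := eventually_atTop.1 hP
    obtain ⟨δ, hδ, hQδ⟩ := Metric.eventually_nhds_iff.1 hQ
    obtain ⟨K, hK⟩ := exists_nat_one_div_lt hδ
    obtain ⟨L, hL⟩ := exists_nat_ge ‖x‖
    filter_upwards [eventually_ge_atTop N, eventually_ge_atTop K, eventually_ge_atTop L]
      with k hkN hkK hkL
    refine ⟨by have : (L : ℝ) ≤ k := by exact_mod_cast hkL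
               linarith, fun n hn y hy => ?_⟩
    have h2 : 1 / ((k : ℝ) + 1) ≤ 1 / ((K : ℝ) + 1) := by gcongr
    exact hPQ (hN n (hkN.trans hn)) (hQδ (by rw [dist_eq_norm]; linarith))
  let w : Ed d → ℝ := fun x => c * (2 + 3 * ‖x‖ ^ 2)
  have hw0 : ∀ x, 0 ≤ w x := fun x => by positivity
  have hwi : Integrable w m :=
    ((integrable_const _).add ((memP_two_iff.1 hm).2.const_mul 3)).const_mul c
  have hE : Tendsto (fun k => ∫ x, (B k)ᶜ.indicator w x ∂m) atTop (𝓝 0) := by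
    have := tendsto_integral_of_dominated_convergence (F := fun k => (B k)ᶜ.indicator w)
      (f := fun _ => 0) (μ := m) w
      (fun k => (hwi.1.indicator (hBclosed k).measurableSet.compl)) hwi
      (fun k => Eventually.of_forall fun x => by
        rw [Real.norm_of_nonneg (indicator_nonneg (fun x _ => hw0 x) x)]
        exact indicator_le_self' (fun x _ => hw0 x) x)
      (Eventually.of_forall fun x => tendsto_const_nhds.congr' ((hBev x).mono fun k hk => by
        exact (indicator_of_notMem (by simpa using hk) w).symm))
    simpa using this
  obtain ⟨k, hk⟩ := (hE.eventually_lt_const hε).exists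
  set C := 2 * c + c * (2 + 3 * ((k : ℝ) + 1) ^ 2) * ((k : ℝ) + 1) ^ 2 with hC
  have hpt : ∀ n ≥ k, ∀ q : Ed d × Ed d, |g n q.2 - g₀ q.1| ≤
      ε + (B k)ᶜ.indicator w q.1 + C * ‖q.1 - q.2‖ ^ 2 := by
    intro n hn q
    have hbd : |g n q.2 - g₀ q.1| ≤ w q.1 + 2 * c * ‖q.1 - q.2‖ ^ 2 := by
      have h1 := norm_sub_sq_le_two_mul q.1 (q.1 - q.2)
      rw [sub_sub_cancel] at h1
      calc |g n q.2 - g₀ q.1| ≤ |g n q.2| + |g₀ q.1| := abs_sub _ _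
        _ ≤ c * (1 + ‖q.2‖ ^ 2) + c * (1 + ‖q.1‖ ^ 2) := add_le_add (hb _ _) (hb₀ _)
        _ ≤ c * (1 + (2 * ‖q.1‖ ^ 2 + 2 * ‖q.1 - q.2‖ ^ 2)) + c * (1 + ‖q.1‖ ^ 2) := by gcongr
        _ = _ := by simp only [w]; ring
    by_cases hq : q.1 ∈ B k
    · rw [indicator_of_notMem (by simpa using hq), add_zero]
      by_cases hd : ‖q.2 - q.1‖ < 1 / ((k : ℝ) + 1)
      · have := hq.2 n hn q.2 hd
        have h2 : 0 ≤ C * ‖q.1 - q.2‖ ^ 2 := by positivity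
        linarith
      · push Not at hd
        rw [norm_sub_rev] at hd
        have h3 : 1 ≤ ((k : ℝ) + 1) ^ 2 * ‖q.1 - q.2‖ ^ 2 := by
          rw [div_le_iff₀ (by positivity)] at hd
          rw [← mul_pow]
          exact one_le_pow₀ (by linarith)
        have h4 : w q.1 ≤ c * (2 + 3 * ((k : ℝ) + 1) ^ 2) := by
          simp only [w]
          gcongr
          exact hq.1
        have h5 : w q.1 * 1 ≤ c * (2 + 3 * ((k : ℝ) + 1) ^ 2) *
            (((k : ℝ) + 1) ^ 2 * ‖q.1 - q.2‖ ^ 2) := by gcongr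
        rw [hC]
        linarith
    · rw [indicator_of_mem (by simpa using hq)]
      have h2 : 0 ≤ c * (2 + 3 * ((k : ℝ) + 1) ^ 2) * ((k : ℝ) + 1) ^ 2 * ‖q.1 - q.2‖ ^ 2 := by
        positivity
      rw [hC]
      linarith
  have htC := ht.const_mul C
  rw [mul_zero] at htC
  obtain ⟨N, hN⟩ := eventually_atTop.1 (htC.eventually_lt_const hε)
  refine ⟨max N k, fun n hn => ?_⟩
  have := hp n
  rw [← (hc n).integral_comp_fst hg₀, ← (hc n).integral_comp_snd (hg n), dist_eq_norm,
    ← integral_sub ((hc n).integrable_comp_snd ((hmn n).integrable_of_le (hg n) (hb n)))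
      ((hc n).integrable_comp_fst (hm.integrable_of_le hg₀ hb₀))]
  have hI1 : Integrable (fun q : Ed d × Ed d => (B k)ᶜ.indicator w q.1) (γ n) :=
    (hc n).integrable_comp_fst (hwi.indicator (hBclosed k).measurableSet.compl)
  have hI2 := ((hc n).integrable_norm_sub_sq hm (hmn n)).const_mul C
  have hI1' : ∫ q, (B k)ᶜ.indicator w q.1 ∂γ n = ∫ x, (B k)ᶜ.indicator w x ∂m := by
    conv_rhs => rw [← (hc n).1]
    rw [integral_map measurable_fst.aemeasurable]
    exact ((by fun_prop : Continuous w).stronglyMeasurable.indicator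
      (hBclosed k).measurableSet.compl).aestronglyMeasurable
  have hle := norm_integral_le_of_norm_le (((integrable_const ε).add hI1).add hI2)
    (Eventually.of_forall fun q => (Real.norm_eq_abs _).trans_le
      (hpt n ((le_max_right _ _).trans hn) q))
  refine hle.trans_lt ?_
  have hI3 : Integrable (fun q : Ed d × Ed d => ε + (B k)ᶜ.indicator w q.1) (γ n) :=
    (integrable_const ε).add hI1
  have e1 : ∫ q : Ed d × Ed d, (ε + (B k)ᶜ.indicator w q.1 + C * ‖q.1 - q.2‖ ^ 2) ∂γ n
      = ε + ∫ x, (B k)ᶜ.indicator w x ∂m + C * ∫ q, ‖q.1 - q.2‖ ^ 2 ∂γ n := by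
    rw [integral_add hI3 hI2, integral_add (integrable_const ε) hI1, hI1', integral_const_mul]
    simp
  have h6 := hN n ((le_max_left _ _).trans hn)
  refine lt_of_eq_of_lt e1 ?_
  linarith

end Coupling

section Mixture

variable {d : ℕ}

/-- The convex combination `(1 - r) m + r m'`. -/
abbrev mix (r : ℝ) (m m' : Measure (Ed d)) : Measure (Ed d) :=
  (1 - ENNReal.ofReal r) • m + ENNReal.ofReal r • m'

theorem mix_eq {r : ℝ} (h0 : 0 ≤ r) (m m' : Measure (Ed d)) :
    mix r m m' = ENNReal.ofReal (1 - r) • m + ENNReal.ofReal r • m' := by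
  rw [mix, ENNReal.ofReal_sub 1 h0, ENNReal.ofReal_one]

theorem mix_zero (m m' : Measure (Ed d)) : mix 0 m m' = m := by simp [mix]

theorem mix_one (m m' : Measure (Ed d)) : mix 1 m m' = m' := by simp [mix]

theorem integrable_mix {r : ℝ} {m m' : Measure (Ed d)} {f : Ed d → ℝ} (h : Integrable f m)
    (h' : Integrable f m') : Integrable f (mix r m m') :=
  (h.smul_measure (by simp)).add_measure (h'.smul_measure (by simp))

theorem integral_mix {r : ℝ} (h0 : 0 ≤ r) (h1 : r ≤ 1) {m m' : Measure (Ed d)} {f : Ed d → ℝ}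
    (h : Integrable f m) (h' : Integrable f m') :
    ∫ x, f x ∂(mix r m m') = (1 - r) * ∫ x, f x ∂m + r * ∫ x, f x ∂m' := by
  rw [mix_eq h0, integral_add_measure (h.smul_measure (by simp)) (h'.smul_measure (by simp)),
    integral_smul_measure, integral_smul_measure, ENNReal.toReal_ofReal h0,
    ENNReal.toReal_ofReal (by linarith), smul_eq_mul, smul_eq_mul]

theorem isProbabilityMeasure_combo {α : Type*} [MeasurableSpace α] {r : ℝ} (h0 : 0 ≤ r)
    (h1 : r ≤ 1) (m m' : Measure α) [IsProbabilityMeasure m] [IsProbabilityMeasure m'] :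
    IsProbabilityMeasure (ENNReal.ofReal (1 - r) • m + ENNReal.ofReal r • m') := by
  constructor
  simp [← ENNReal.ofReal_add (sub_nonneg.2 h1) h0]

theorem memP_mix {r : ℝ} (h0 : 0 ≤ r) (h1 : r ≤ 1) {m m' : Measure (Ed d)} (hm : MemP d 2 m)
    (hm' : MemP d 2 m') : MemP d 2 (mix r m m') := by
  have := hm.1
  have := hm'.1
  exact ⟨by rw [mix_eq h0]; exact isProbabilityMeasure_combo h0 h1 m m',
    integrable_mix hm.2 hm'.2⟩

theorem mix_add_eq_mix_mix {r h : ℝ} (h0 : 0 ≤ r) (h1 : r < 1) (hh : 0 ≤ h) (hh1 : r + h ≤ 1)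
    (m m' : Measure (Ed d)) :
    mix (r + h) m m' = mix (h / (1 - r)) (mix r m m') m' := by
  have h2 : 0 < 1 - r := by linarith
  have h3 : 0 ≤ 1 - h / (1 - r) := by
    rw [sub_nonneg, div_le_one h2]; linarith
  rw [mix_eq (add_nonneg h0 hh), mix_eq (div_nonneg hh h2.le), mix_eq h0, smul_add, smul_smul,
    smul_smul, add_assoc, ← add_smul, ← ENNReal.ofReal_mul h3, ← ENNReal.ofReal_mul h3,
    ← ENNReal.ofReal_add (mul_nonneg h3 h0) (div_nonneg hh h2.le)]
  congr 3
  · field_simp; ring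
  · field_simp; ring

theorem isCoupling_diag (m : Measure (Ed d)) : IsCoupling d (m.map fun x => (x, x)) m m := by
  constructor
  · rw [Measure.map_map measurable_fst (by fun_prop)]
    exact Measure.map_id
  · rw [Measure.map_map measurable_snd (by fun_prop)]
    exact Measure.map_id

theorem integral_diag (k : ℕ) (hk : k ≠ 0) (m : Measure (Ed d)) :
    ∫ q, ‖q.1 - q.2‖ ^ k ∂(m.map fun x => (x, x)) = 0 := by
  rw [integral_map (by fun_prop) (by fun_prop)]
  simp [hk]

theorem integrable_diag (k : ℕ) (hk : k ≠ 0) (m : Measure (Ed d)) :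
    Integrable (fun q : Ed d × Ed d => ‖q.1 - q.2‖ ^ k) (m.map fun x => (x, x)) := by
  rw [integrable_map_measure (by fun_prop) (by fun_prop)]
  simp [Function.comp_def, hk]

theorem wconv_mix_param {m m' : Measure (Ed d)} (hm : MemP d 2 m) (hm' : MemP d 2 m') {r : ℝ}
    {rn : ℕ → ℝ} (hr : r ∈ Icc (0 : ℝ) 1) (hrn : ∀ n, rn n ∈ Icc (0 : ℝ) 1)
    (h : Tendsto rn atTop (𝓝 r)) : WConv d 2 (fun n => mix (rn n) m m') (mix r m m') := by
  have := hm.1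
  have := hm'.1
  let D : Measure (Ed d) → Measure (Ed d × Ed d) := fun m => m.map fun x => (x, x)
  let γ : ℕ → Measure (Ed d × Ed d) := fun n =>
    (ENNReal.ofReal (1 - max r (rn n)) • D m + ENNReal.ofReal (min r (rn n)) • D m') +
      (ENNReal.ofReal (rn n - r) • m.prod m' + ENNReal.ofReal (r - rn n) • m'.prod m)
  have hγ : ∀ n, IsCoupling d (γ n) (mix r m m') (mix (rn n) m m') := by
    intro n
    have e1 := max_le hr.2 (hrn n).2
    have e2 := le_min hr.1 (hrn n).1
    have c1 : (m.prod m').map Prod.fst = m := (isCoupling_prod (m := m) (m' := m')).1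
    have c2 : (m.prod m').map Prod.snd = m' := (isCoupling_prod (m := m) (m' := m')).2
    have c3 : (m'.prod m).map Prod.fst = m' := (isCoupling_prod (m := m') (m' := m)).1
    have c4 : (m'.prod m).map Prod.snd = m := (isCoupling_prod (m := m') (m' := m)).2
    constructor
    · simp only [γ, D]
      rw [mix_eq hr.1, Measure.map_add _ _ measurable_fst, Measure.map_add _ _ measurable_fst,
        Measure.map_add _ _ measurable_fst]
      simp only [Measure.map_smul, (isCoupling_diag m).1, (isCoupling_diag m').1]
      rw [c1, c3, add_add_add_comm, ← add_smul, ← add_smul]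
      rcases le_total r (rn n) with hle | hle
      · rw [max_eq_right hle, min_eq_left hle, ENNReal.ofReal_of_nonpos (sub_nonpos.2 hle),
          ← ENNReal.ofReal_add (by linarith [(hrn n).2]) (by linarith), add_zero]
        congr 3; ring
      · rw [max_eq_left hle, min_eq_right hle, ENNReal.ofReal_of_nonpos (sub_nonpos.2 hle),
          ← ENNReal.ofReal_add (hrn n).1 (by linarith), add_zero]
        congr 3; ring
    · simp only [γ, D]
      rw [mix_eq (hrn n).1, Measure.map_add _ _ measurable_snd, Measure.map_add _ _ measurable_snd,
        Measure.map_add _ _ measurable_snd]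
      simp only [Measure.map_smul, (isCoupling_diag m).2, (isCoupling_diag m').2]
      rw [c2, c4, add_comm (ENNReal.ofReal (rn n - r) • m'), add_add_add_comm, ← add_smul,
        ← add_smul]
      rcases le_total r (rn n) with hle | hle
      · rw [max_eq_right hle, min_eq_left hle, ENNReal.ofReal_of_nonpos (sub_nonpos.2 hle),
          ← ENNReal.ofReal_add hr.1 (by linarith), add_zero]
        congr 3; ring
      · rw [max_eq_left hle, min_eq_right hle, ENNReal.ofReal_of_nonpos (sub_nonpos.2 hle),
          ← ENNReal.ofReal_add (by linarith [hr.2]) (by linarith), add_zero]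
        congr 3; ring
  refine ⟨γ, fun n => ?_, hγ, ?_⟩
  · have := (memP_mix hr.1 hr.2 hm hm').1
    rw [← (hγ n).1] at this
    exact Measure.isProbabilityMeasure_of_map Prod.fst
  · have i1 := (isCoupling_prod (m := m) (m' := m')).integrable_norm_sub_sq hm hm'
    have i2 := (isCoupling_prod (m := m') (m' := m)).integrable_norm_sub_sq hm' hm
    have hval : ∀ n, ∫ q, ‖q.1 - q.2‖ ^ 2 ∂γ n =
        max (rn n - r) 0 * ∫ q, ‖q.1 - q.2‖ ^ 2 ∂(m.prod m') +
        max (r - rn n) 0 * ∫ q, ‖q.1 - q.2‖ ^ 2 ∂(m'.prod m) := by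
      intro n
      have d1 := (integrable_diag 2 two_ne_zero m).smul_measure
        (c := ENNReal.ofReal (1 - max r (rn n))) (by simp)
      have d2 := (integrable_diag 2 two_ne_zero m').smul_measure
        (c := ENNReal.ofReal (min r (rn n))) (by simp)
      have d3 := i1.smul_measure (c := ENNReal.ofReal (rn n - r)) (by simp)
      have d4 := i2.smul_measure (c := ENNReal.ofReal (r - rn n)) (by simp)
      simp only [γ, D]
      rw [integral_add_measure (d1.add_measure d2) (d3.add_measure d4),
        integral_add_measure d1 d2, integral_add_measure d3 d4]
      simp only [integral_smul_measure, integral_diag 2 two_ne_zero, mul_zero, zero_add,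
        smul_eq_mul]
      rfl
    simp only [hval]
    have t1 : Tendsto (fun n => max (rn n - r) 0) atTop (𝓝 0) := by
      simpa using (h.sub_const r).max (tendsto_const_nhds (x := (0 : ℝ)))
    have t2 : Tendsto (fun n => max (r - rn n) 0) atTop (𝓝 0) := by
      simpa using (h.const_sub r).max (tendsto_const_nhds (x := (0 : ℝ)))
    simpa using (t1.mul_const _).add (t2.mul_const _)

theorem WConv.mix {m : Measure (Ed d)} {mn : ℕ → Measure (Ed d)} (h : WConv d 2 mn m)
    (hm : MemP d 2 m) (hmn : ∀ n, MemP d 2 (mn n)) {rn : ℕ → ℝ}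
    (hrn : ∀ n, rn n ∈ Icc (0 : ℝ) 1) : WConv d 2 (fun n => mix (rn n) m (mn n)) m := by
  obtain ⟨γ, hp, hc, ht⟩ := h
  have := hm.1
  have hmix : ∀ n, _root_.mix (rn n) m m = m := fun n => by
    rw [mix_eq (hrn n).1, ← add_smul, ← ENNReal.ofReal_add (sub_nonneg.2 (hrn n).2) (hrn n).1]
    simp
  let D : Measure (Ed d × Ed d) := m.map fun x => (x, x)
  have hD : IsProbabilityMeasure D := Measure.isProbabilityMeasure_map (by fun_prop)
  refine ⟨fun n => ENNReal.ofReal (1 - rn n) • D + ENNReal.ofReal (rn n) • γ n, fun n => ?_,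
    fun n => ⟨?_, ?_⟩, ?_⟩
  · have := hp n
    exact isProbabilityMeasure_combo (hrn n).1 (hrn n).2 _ _
  · rw [Measure.map_add _ _ measurable_fst]
    simp only [Measure.map_smul]
    rw [(isCoupling_diag m).1, (hc n).1, ← mix_eq (hrn n).1, hmix]
  · rw [Measure.map_add _ _ measurable_snd]
    simp only [Measure.map_smul]
    rw [(isCoupling_diag m).2, (hc n).2, ← mix_eq (hrn n).1]
  · refine squeeze_zero (fun n => by positivity) (fun n => ?_) ht
    have d1 := (integrable_diag 2 two_ne_zero m).smul_measure
      (c := ENNReal.ofReal (1 - rn n)) (by simp)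
    have d2 := ((hc n).integrable_norm_sub_sq hm (hmn n)).smul_measure
      (c := ENNReal.ofReal (rn n)) (by simp)
    rw [integral_add_measure d1 d2]
    simp only [integral_smul_measure, integral_diag 2 two_ne_zero, mul_zero, zero_add,
      smul_eq_mul]
    rw [ENNReal.toReal_ofReal (hrn n).1]
    exact mul_le_of_le_one_left (integral_nonneg fun q => by positivity) (hrn n).2

end Mixture

section HeatLaw

variable {d : ℕ}

/-- The law of `X + √τ Z` with `X` of law `m` and `Z` an independent standard Gaussian; for
`τ ≤ 0` this is `m`. -/
def heatLaw (τ : ℝ) (m : Measure (Ed d)) : Measure (Ed d) :=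
  (m.prod (gaussMeasure d 1)).map fun q => q.1 + √τ • q.2

theorem heatLaw_of_nonpos {τ : ℝ} (hτ : τ ≤ 0) (m : Measure (Ed d)) [IsProbabilityMeasure m] :
    heatLaw τ m = m := by
  simp only [heatLaw, Real.sqrt_eq_zero_of_nonpos hτ, zero_smul, add_zero]
  exact (measurePreserving_fst (μ := m) (ν := gaussMeasure d 1)).map_eq

theorem heatLaw_max_zero (τ : ℝ) (m : Measure (Ed d)) : heatLaw (max τ 0) m = heatLaw τ m := by
  have : √(max τ 0) = √τ := by
    rcases le_total τ 0 with h | h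
    · rw [max_eq_right h, Real.sqrt_zero, Real.sqrt_eq_zero_of_nonpos h]
    · rw [max_eq_left h]
  rw [heatLaw, heatLaw, this]

theorem heatFlow_eq_heatLaw (t s : ℝ) (m : Measure (Ed d)) [IsProbabilityMeasure m] :
    heatFlow d t s m = heatLaw (s - t) m := by
  unfold heatFlow
  split_ifs with h
  · rw [heatLaw_of_nonpos (sub_nonpos.2 h)]
  · have hpos : 0 < s - t := by linarith [not_le.1 h]
    rw [gaussMeasure_eq_map hpos]
    have e : m.prod ((gaussMeasure d 1).map fun z => √(s - t) • z)
        = (m.prod (gaussMeasure d 1)).map (Prod.map id fun z => √(s - t) • z) := by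
      rw [← Measure.map_prod_map _ _ measurable_id (by fun_prop), Measure.map_id]
    rw [e, Measure.map_map (by fun_prop) (by fun_prop)]
    rfl

theorem integral_heatLaw (τ : ℝ) (m : Measure (Ed d)) {f : Ed d → ℝ} (hf : Continuous f) :
    ∫ x, f x ∂(heatLaw τ m) = ∫ q, f (q.1 + √τ • q.2) ∂(m.prod (gaussMeasure d 1)) := by
  rw [heatLaw, integral_map (by fun_prop) hf.aestronglyMeasurable]

theorem integrable_prod_gauss {m : Measure (Ed d)} (hm : MemP d 2 m) (a b : ℝ) :
    Integrable (fun q : Ed d × Ed d => a * ‖q.1‖ ^ 2 + b * ‖q.2‖ ^ 2)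
      (m.prod (gaussMeasure d 1)) := by
  have := hm.1
  have h1 : Integrable (fun q : Ed d × Ed d => ‖q.1‖ ^ 2) (m.prod (gaussMeasure d 1)) :=
    (memP_two_iff.1 hm).2.comp_fst _
  have h2 : Integrable (fun q : Ed d × Ed d => ‖q.2‖ ^ 2) (m.prod (gaussMeasure d 1)) :=
    (integrable_norm_pow_gaussMeasure 2).comp_snd _
  exact (h1.const_mul a).add (h2.const_mul b)

theorem norm_add_sqrt_smul_sq_le {τ : ℝ} (hτ : 0 ≤ τ) (x z : Ed d) :
    ‖x + √τ • z‖ ^ 2 ≤ 2 * ‖x‖ ^ 2 + 2 * τ * ‖z‖ ^ 2 := by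
  refine (norm_add_sq_le_two_mul _ _).trans_eq ?_
  rw [norm_smul, mul_pow, Real.norm_of_nonneg (Real.sqrt_nonneg _), Real.sq_sqrt hτ]
  ring

theorem memP_heatLaw (τ : ℝ) {m : Measure (Ed d)} (hm : MemP d 2 m) :
    MemP d 2 (heatLaw τ m) := by
  have := hm.1
  rw [← heatLaw_max_zero, memP_two_iff]
  refine ⟨Measure.isProbabilityMeasure_map (by fun_prop), ?_⟩
  rw [heatLaw, integrable_map_measure (by fun_prop) (by fun_prop)]
  refine (integrable_prod_gauss hm 2 (2 * max τ 0)).mono' (by fun_prop)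
    (Eventually.of_forall fun q => ?_)
  simp only [Function.comp_apply, norm_pow, norm_norm]
  exact norm_add_sqrt_smul_sq_le (le_max_right _ _) _ _

theorem integral_norm_sq_heatLaw_le {τ T : ℝ} (hτ : τ ≤ T) (hT : 0 ≤ T) {m : Measure (Ed d)}
    (hm : MemP d 2 m) :
    ∫ x, ‖x‖ ^ 2 ∂(heatLaw τ m) ≤
      2 * ∫ x, ‖x‖ ^ 2 ∂m + 2 * T * ∫ z : Ed d, ‖z‖ ^ 2 ∂(gaussMeasure d 1) := by
  have := hm.1
  rw [← heatLaw_max_zero, integral_heatLaw _ _ (by fun_prop)]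
  have h1 : Integrable (fun q : Ed d × Ed d => ‖q.1‖ ^ 2) (m.prod (gaussMeasure d 1)) :=
    (memP_two_iff.1 hm).2.comp_fst _
  have h2 : Integrable (fun q : Ed d × Ed d => ‖q.2‖ ^ 2) (m.prod (gaussMeasure d 1)) :=
    (integrable_norm_pow_gaussMeasure 2).comp_snd _
  calc ∫ q : Ed d × Ed d, ‖q.1 + √(max τ 0) • q.2‖ ^ 2 ∂(m.prod (gaussMeasure d 1))
      ≤ ∫ q : Ed d × Ed d, (2 * ‖q.1‖ ^ 2 + 2 * T * ‖q.2‖ ^ 2) ∂(m.prod (gaussMeasure d 1)) := by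
        refine integral_mono_of_nonneg (Eventually.of_forall fun q => by positivity)
          (integrable_prod_gauss hm 2 (2 * T)) (Eventually.of_forall fun q => ?_)
        refine (norm_add_sqrt_smul_sq_le (le_max_right _ _) _ _).trans ?_
        nlinarith [mul_le_mul_of_nonneg_right (max_le hτ hT) (sq_nonneg ‖q.2‖)]
    _ = _ := by
        rw [integral_add (h1.const_mul _) (h2.const_mul _), integral_const_mul,
          integral_const_mul, integral_fun_fst (fun x => ‖x‖ ^ 2),
          integral_fun_snd (fun x => ‖x‖ ^ 2)]
        simp

theorem heatLaw_mix {r : ℝ} (τ : ℝ) (m m' : Measure (Ed d)) [IsProbabilityMeasure m]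
    [IsProbabilityMeasure m'] :
    heatLaw τ (mix r m m') = mix r (heatLaw τ m) (heatLaw τ m') := by
  have hmeas : Measurable fun q : Ed d × Ed d => q.1 + √τ • q.2 := by fun_prop
  have : SFinite ((1 - ENNReal.ofReal r) • m) := inferInstance
  unfold heatLaw mix
  rw [Measure.add_prod, Measure.prod_smul_left, Measure.prod_smul_left, Measure.map_add _ _ hmeas,
    Measure.map_smul, Measure.map_smul]

theorem WConv.heatLaw {k : ℕ} (hk : k = 1 ∨ k = 2) {m : Measure (Ed d)}
    {mn : ℕ → Measure (Ed d)} (h : WConv d k mn m) (hm : MemP d 2 m) (hmn : ∀ n, MemP d 2 (mn n))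
    {τ : ℝ} {τn : ℕ → ℝ} (hτ : Tendsto τn atTop (𝓝 τ)) :
    WConv d k (fun n => heatLaw (τn n) (mn n)) (heatLaw τ m) := by
  obtain ⟨γ, hp, hc, ht⟩ := h
  have hk0 : k ≠ 0 := by rcases hk with rfl | rfl <;> simp
  let A : ℕ → (Ed d × Ed d) × Ed d → Ed d × Ed d :=
    fun n p => (p.1.1 + √τ • p.2, p.1.2 + √(τn n) • p.2)
  have hA : ∀ n, Measurable (A n) := fun n => by fun_prop
  have hcoup : ∀ n, IsCoupling d (((γ n).prod (gaussMeasure d 1)).map (A n)) (_root_.heatLaw τ m)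
      (_root_.heatLaw (τn n) (mn n)) := by
    intro n
    have := hp n
    constructor
    · rw [Measure.map_map measurable_fst (hA n), _root_.heatLaw, ← (hc n).1]
      have e : ((γ n).map Prod.fst).prod (gaussMeasure d 1)
          = ((γ n).prod (gaussMeasure d 1)).map (Prod.map Prod.fst id) := by
        rw [← Measure.map_prod_map _ _ measurable_fst measurable_id, Measure.map_id]
      rw [e, Measure.map_map (by fun_prop) (by fun_prop)]
      rfl
    · rw [Measure.map_map measurable_snd (hA n), _root_.heatLaw, ← (hc n).2]
      have e : ((γ n).map Prod.snd).prod (gaussMeasure d 1)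
          = ((γ n).prod (gaussMeasure d 1)).map (Prod.map Prod.snd id) := by
        rw [← Measure.map_prod_map _ _ measurable_snd measurable_id, Measure.map_id]
      rw [e, Measure.map_map (by fun_prop) (by fun_prop)]
      rfl
  refine ⟨_, fun n => have := hp n; Measure.isProbabilityMeasure_map (hA n).aemeasurable,
    hcoup, ?_⟩
  set K := ∫ z : Ed d, ‖z‖ ^ k ∂(gaussMeasure d 1)
  have hdiff : Tendsto (fun n => |√τ - √(τn n)| ^ k) atTop (𝓝 0) := by
    have h1 : Tendsto (fun n => √τ - √(τn n)) atTop (𝓝 (√τ - √τ)) :=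
      tendsto_const_nhds.sub hτ.sqrt
    simpa [hk0] using h1.abs.pow k
  have hlim : Tendsto (fun n => 2 * ∫ q, ‖q.1 - q.2‖ ^ k ∂γ n + 2 * (|√τ - √(τn n)| ^ k * K))
      atTop (𝓝 0) := by
    simpa using (ht.const_mul 2).add ((hdiff.mul_const K).const_mul 2)
  refine squeeze_zero (fun n => by positivity) (fun n => ?_) hlim
  have := hp n
  have h1 : Integrable (fun p : (Ed d × Ed d) × Ed d => ‖p.1.1 - p.1.2‖ ^ k)
      ((γ n).prod (gaussMeasure d 1)) :=
    ((hc n).integrable_norm_sub_pow hm (hmn n) hk).comp_fst (gaussMeasure d 1)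
  have h2 : Integrable (fun p : (Ed d × Ed d) × Ed d => ‖p.2‖ ^ k)
      ((γ n).prod (gaussMeasure d 1)) :=
    (integrable_norm_pow_gaussMeasure k).comp_snd (γ n)
  rw [integral_map (hA n).aemeasurable (by fun_prop)]
  calc ∫ p, ‖(A n p).1 - (A n p).2‖ ^ k ∂((γ n).prod (gaussMeasure d 1))
      ≤ ∫ p : (Ed d × Ed d) × Ed d, (2 * ‖p.1.1 - p.1.2‖ ^ k +
          2 * (|√τ - √(τn n)| ^ k * ‖p.2‖ ^ k)) ∂((γ n).prod (gaussMeasure d 1)) := by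
        refine integral_mono_of_nonneg (Eventually.of_forall fun q => by positivity)
          ((h1.const_mul 2).add ((h2.const_mul _).const_mul 2)) (Eventually.of_forall fun p => ?_)
        have e : (A n p).1 - (A n p).2 = (p.1.1 - p.1.2) + (√τ - √(τn n)) • p.2 := by
          simp only [A]; module
        have e2 : ‖(A n p).1 - (A n p).2‖ ≤ ‖p.1.1 - p.1.2‖ + |√τ - √(τn n)| * ‖p.2‖ := by
          rw [e, ← Real.norm_eq_abs, ← norm_smul]
          exact norm_add_le _ _
        have h0 : 0 ≤ |√τ - √(τn n)| * ‖p.2‖ := by positivity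
        simp only
        rw [← mul_pow]
        refine (pow_le_pow_left₀ (norm_nonneg _) e2 k).trans ?_
        rcases hk with rfl | rfl
        · simp only [pow_one]; linarith [norm_nonneg (p.1.1 - p.1.2)]
        · nlinarith [sq_nonneg (‖p.1.1 - p.1.2‖ - |√τ - √(τn n)| * ‖p.2‖)]
    _ = _ := by
        rw [integral_add (h1.const_mul _) ((h2.const_mul _).const_mul _), integral_const_mul,
          integral_const_mul, integral_const_mul,
          integral_fun_fst (fun q : Ed d × Ed d => ‖q.1 - q.2‖ ^ k),
          integral_fun_snd (fun z : Ed d => ‖z‖ ^ k)]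
        simp [K]

theorem wconv_const {k : ℕ} (hk : k ≠ 0) (m : Measure (Ed d)) [IsProbabilityMeasure m] :
    WConv d k (fun _ => m) m :=
  ⟨fun _ => m.map fun x => (x, x), fun _ => Measure.isProbabilityMeasure_map (by fun_prop),
    fun _ => isCoupling_diag m, by simp only [integral_diag k hk, tendsto_const_nhds]⟩

end HeatLaw

section Ito

variable {d : ℕ}

/-- A `C²` function which together with its first two derivatives is bounded by
`c (1 + ‖x‖²)`. -/
structure QuadC2 (c : ℝ) (f : Ed d → ℝ) : Prop where
  smooth : ContDiff ℝ 2 f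
  bound : ∀ x, |f x| ≤ c * (1 + ‖x‖ ^ 2)
  bound_fderiv : ∀ x, ‖fderiv ℝ f x‖ ≤ c * (1 + ‖x‖ ^ 2)
  bound_iteratedFDeriv : ∀ x, ‖iteratedFDeriv ℝ 2 f x‖ ≤ c * (1 + ‖x‖ ^ 2)

/-- The trace of a bilinear form. -/
def trace₂ (L : ContinuousMultilinearMap ℝ (fun _ : Fin 2 => Ed d) ℝ) : ℝ :=
  ∑ i : Fin d, L (fun _ => EuclideanSpace.single i (1 : ℝ))

theorem continuous_trace₂ : Continuous (trace₂ (d := d)) := by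
  unfold trace₂
  refine continuous_finsetSum _ fun i _ => ?_
  exact continuous_eval_const _

theorem abs_trace₂_le (L : ContinuousMultilinearMap ℝ (fun _ : Fin 2 => Ed d) ℝ) :
    |trace₂ L| ≤ d * ‖L‖ := by
  refine (Finset.abs_sum_le_sum_abs _ _).trans ?_
  have : ∀ i ∈ (Finset.univ : Finset (Fin d)),
      |L (fun _ => EuclideanSpace.single i (1 : ℝ))| ≤ ‖L‖ := fun i _ => by
    simpa using L.le_opNorm (fun _ => EuclideanSpace.single i (1 : ℝ))
  refine (Finset.sum_le_card_nsmul _ _ _ this).trans_eq ?_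
  simp

theorem lapl_eq_sum_fderiv (f : Ed d → ℝ) (x : Ed d) :
    lapl d f x = ∑ i : Fin d, fderiv ℝ (fderiv ℝ f) x (EuclideanSpace.single i (1 : ℝ))
      (EuclideanSpace.single i (1 : ℝ)) := by
  simp [lapl, iteratedFDeriv_two_apply]

theorem QuadC2.nonneg {c : ℝ} {f : Ed d → ℝ} (hf : QuadC2 c f) : 0 ≤ c := by
  simpa using (abs_nonneg _).trans (hf.bound 0)

theorem QuadC2.continuous_lapl {c : ℝ} {f : Ed d → ℝ} (hf : QuadC2 c f) :
    Continuous (lapl d f) :=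
  continuous_trace₂.comp (hf.smooth.continuous_iteratedFDeriv le_rfl)

theorem QuadC2.abs_lapl_le {c : ℝ} {f : Ed d → ℝ} (hf : QuadC2 c f) (x : Ed d) :
    |lapl d f x| ≤ d * c * (1 + ‖x‖ ^ 2) := by
  rw [mul_assoc]
  exact (abs_trace₂_le _).trans
    (mul_le_mul_of_nonneg_left (hf.bound_iteratedFDeriv x) (by positivity))

theorem norm_fderiv_fderiv (f : Ed d → ℝ) (x : Ed d) :
    ‖fderiv ℝ (fderiv ℝ f) x‖ = ‖iteratedFDeriv ℝ 2 f x‖ := by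
  rw [show (2 : ℕ) = 1 + 1 from rfl, ← norm_iteratedFDeriv_fderiv, ← norm_iteratedFDeriv_fderiv,
    norm_iteratedFDeriv_zero]

theorem QuadC2.integral_fderiv_gaussMeasure {c : ℝ} {f : Ed d → ℝ} (hf : QuadC2 c f)
    {τ : ℝ} (hτ : 0 ≤ τ) (x : Ed d) :
    ∫ z, fderiv ℝ f (x + √τ • z) z ∂(gaussMeasure d 1) =
      √τ * ∫ z, lapl d f (x + √τ • z) ∂(gaussMeasure d 1) := by
  have hc := hf.nonneg
  have hsm : ContDiff ℝ 1 (fderiv ℝ f) := hf.smooth.fderiv_right (by norm_num)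
  set C := (1 + √τ) * (c * (1 + 2 * ‖x‖ ^ 2 + 2 * τ)) with hC
  have hb : ∀ z : Ed d, c * (1 + ‖x + √τ • z‖ ^ 2) ≤
      c * (1 + 2 * ‖x‖ ^ 2 + 2 * τ) * (1 + ‖z‖ ^ 2) := fun z => by
    rw [mul_assoc]
    refine mul_le_mul_of_nonneg_left ?_ hc
    nlinarith [norm_add_sqrt_smul_sq_le hτ x z, mul_nonneg (sq_nonneg ‖x‖) (sq_nonneg ‖z‖)]
  have hB : 0 ≤ c * (1 + 2 * ‖x‖ ^ 2 + 2 * τ) := by positivity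
  have hs := Real.sqrt_nonneg τ
  let e : Fin d → Ed d := fun i => EuclideanSpace.single i (1 : ℝ)
  have he : ∀ i, ‖e i‖ = 1 := fun i => by simp [e]
  let g : Fin d → Ed d → ℝ := fun i z => fderiv ℝ f (x + √τ • z) (e i)
  have hg : ∀ i, ContDiff ℝ 1 (g i) := fun i =>
    (hsm.comp (by fun_prop : ContDiff ℝ 1 fun z : Ed d => x + √τ • z)).clm_apply contDiff_const
  have hg0 : ∀ i z, |g i z| ≤ C * (1 + ‖z‖ ^ 2) := fun i z => by
    have h1 : |g i z| ≤ ‖fderiv ℝ f (x + √τ • z)‖ := by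
      simpa [he] using (fderiv ℝ f (x + √τ • z)).le_opNorm (e i)
    refine h1.trans ((hf.bound_fderiv _).trans ((hb z).trans ?_))
    rw [hC, mul_assoc (1 + √τ)]
    have h2 : 0 ≤ c * (1 + 2 * ‖x‖ ^ 2 + 2 * τ) * (1 + ‖z‖ ^ 2) := by positivity
    nlinarith
  have hgd : ∀ i z v, fderiv ℝ (g i) z v =
      √τ * fderiv ℝ (fderiv ℝ f) (x + √τ • z) v (e i) := fun i z v => by
    have h1 : HasFDerivAt (fun z : Ed d => x + √τ • z)
        (√τ • ContinuousLinearMap.id ℝ (Ed d)) z :=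
      ((hasFDerivAt_id z).const_smul (√τ)).const_add x
    have h2 := ((hsm.differentiable one_ne_zero) (x + √τ • z)).hasFDerivAt
    have h3 := (h2.comp z h1).clm_apply (hasFDerivAt_const (e i) z)
    have h4 : HasFDerivAt (g i) _ z := h3
    rw [h4.fderiv]
    simp
  have hg1 : ∀ i z, ‖fderiv ℝ (g i) z‖ ≤ C * (1 + ‖z‖ ^ 2) := fun i z => by
    refine ContinuousLinearMap.opNorm_le_bound _ (by positivity) fun v => ?_
    rw [hgd, norm_mul, Real.norm_of_nonneg hs]
    have h1 := (fderiv ℝ (fderiv ℝ f) (x + √τ • z)).le_opNorm₂ v (e i)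
    rw [he, mul_one, norm_fderiv_fderiv] at h1
    have h2 := (hf.bound_iteratedFDeriv (x + √τ • z)).trans (hb z)
    calc √τ * ‖fderiv ℝ (fderiv ℝ f) (x + √τ • z) v (e i)‖
        ≤ (1 + √τ) * (c * (1 + 2 * ‖x‖ ^ 2 + 2 * τ) * (1 + ‖z‖ ^ 2) * ‖v‖) := by
          gcongr
          · linarith
          · exact h1.trans (by gcongr)
      _ = _ := by rw [hC]; ring
  have h_int : ∀ i, Integrable (fun z => inner ℝ z (e i) * g i z) (gaussMeasure d 1) := fun i => by
    have i1 := ((integrable_norm_pow_gaussMeasure (d := d) 1).add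
      (integrable_norm_pow_gaussMeasure (d := d) 3)).const_mul C
    refine i1.mono' ((by fun_prop : Continuous fun z : Ed d => inner ℝ z (e i)).mul
      (hg i).continuous).aestronglyMeasurable (Eventually.of_forall fun z => ?_)
    rw [norm_mul]
    have h1 := norm_inner_le_norm (𝕜 := ℝ) z (e i)
    rw [he, mul_one] at h1
    calc ‖inner ℝ z (e i)‖ * ‖g i z‖ ≤ ‖z‖ * (C * (1 + ‖z‖ ^ 2)) :=
          mul_le_mul h1 (hg0 i z) (norm_nonneg _) (norm_nonneg _)
      _ = _ := by simp only [Pi.add_apply]; ring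
  have hlapl : ∀ i, Integrable (fun z => fderiv ℝ (g i) z (e i)) (gaussMeasure d 1) := fun i => by
    have i1 := ((integrable_norm_pow_gaussMeasure (d := d) 0).add
      (integrable_norm_pow_gaussMeasure (d := d) 2)).const_mul C
    refine i1.mono' ((((hg i).continuous_fderiv one_ne_zero).clm_apply
      continuous_const).aestronglyMeasurable) (Eventually.of_forall fun z => ?_)
    have h1 := (fderiv ℝ (g i) z).le_opNorm (e i)
    rw [he, mul_one] at h1
    refine (h1.trans (hg1 i z)).trans_eq ?_
    simp
  calc ∫ z, fderiv ℝ f (x + √τ • z) z ∂(gaussMeasure d 1)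
      = ∫ z, ∑ i, inner ℝ z (e i) * g i z ∂(gaussMeasure d 1) := by
        congr with z
        have hz : z = ∑ i, (inner ℝ z (e i) : ℝ) • e i := by
          ext j
          simp [e, EuclideanSpace.inner_single_right, Finset.sum_apply, Pi.single_apply]
        conv_lhs => rw [hz]
        simp only [g, map_sum, map_smul, smul_eq_mul]
        rw [← hz]
    _ = ∑ i, ∫ z, inner ℝ z (e i) * g i z ∂(gaussMeasure d 1) :=
        integral_finsetSum _ fun i _ => h_int i
    _ = ∑ i, ∫ z, fderiv ℝ (g i) z (e i) ∂(gaussMeasure d 1) :=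
        Finset.sum_congr rfl fun i _ =>
          integral_inner_mul_gaussMeasure (hg i) (hg0 i) (hg1 i) (e i)
    _ = ∫ z, ∑ i, fderiv ℝ (g i) z (e i) ∂(gaussMeasure d 1) :=
        (integral_finsetSum _ fun i _ => hlapl i).symm
    _ = √τ * ∫ z, lapl d f (x + √τ • z) ∂(gaussMeasure d 1) := by
        rw [← integral_const_mul]
        simp only [hgd, lapl_eq_sum_fderiv, Finset.mul_sum, e]

theorem QuadC2.hasDerivAt_integral_heatLaw {c : ℝ} {f : Ed d → ℝ} (hf : QuadC2 c f)
    {m : Measure (Ed d)} (hm : MemP d 2 m) {τ : ℝ} (hτ : 0 < τ) :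
    HasDerivAt (fun τ => ∫ x, f x ∂(heatLaw τ m))
      (1 / 2 * ∫ x, lapl d f x ∂(heatLaw τ m)) τ := by
  have := hm.1
  have hc := hf.nonneg
  have hcf := hf.smooth.continuous
  have hcd : Continuous (fderiv ℝ f) := hf.smooth.continuous_fderiv two_ne_zero
  simp only [integral_heatLaw _ m hcf, integral_heatLaw _ m hf.continuous_lapl]
  have hball : ∀ s ∈ Ioo (τ / 2) (2 * τ), 0 < s ∧ s ≤ 2 * τ ∧ √(τ / 2) ≤ √s := fun s hs =>
    ⟨by linarith [hs.1], hs.2.le, Real.sqrt_le_sqrt hs.1.le⟩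
  have hq : 0 < √(τ / 2) := Real.sqrt_pos.2 (by linarith)
  let K := c / (2 * √(τ / 2))
  have hK : 0 ≤ K := by positivity
  let F' : ℝ → Ed d × Ed d → ℝ := fun s q => fderiv ℝ f (q.1 + √s • q.2) ((1 / (2 * √s)) • q.2)
  have key := hasDerivAt_integral_of_dominated_loc_of_deriv_le (μ := m.prod (gaussMeasure d 1))
    (F := fun s q => f (q.1 + √s • q.2)) (F' := F') (s := Ioo (τ / 2) (2 * τ)) (x₀ := τ)
    (bound := fun q => K * ((1 + 2 * ‖q.1‖ ^ 2) * ‖q.2‖ ^ 1 + 1 * (4 * τ * ‖q.2‖ ^ 3)))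
    (Ioo_mem_nhds (by linarith) (by linarith))
    (Eventually.of_forall fun s => (by fun_prop : Continuous _).aestronglyMeasurable)
    ?_ ?_ ?_ ?_ ?_
  · have hval : ∫ q, F' τ q ∂(m.prod (gaussMeasure d 1)) =
        1 / 2 * ∫ q : Ed d × Ed d, lapl d f (q.1 + √τ • q.2) ∂(m.prod (gaussMeasure d 1)) := by
      have hL : Integrable (fun q : Ed d × Ed d => lapl d f (q.1 + √τ • q.2))
          (m.prod (gaussMeasure d 1)) := by
        have h1 := (memP_heatLaw τ hm).integrable_of_le hf.continuous_lapl hf.abs_lapl_le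
        rw [heatLaw, integrable_map_measure hf.continuous_lapl.aestronglyMeasurable
          (by fun_prop)] at h1
        exact h1
      rw [integral_prod _ key.1, integral_prod _ hL, ← integral_const_mul]
      congr with x
      simp only [F', map_smul, smul_eq_mul]
      rw [integral_const_mul, hf.integral_fderiv_gaussMeasure hτ.le]
      have : √τ ≠ 0 := (Real.sqrt_pos.2 hτ).ne'
      field_simp
    rw [← hval]
    exact key.2
  · have h1 := (memP_heatLaw τ hm).integrable_of_le hcf hf.bound
    rw [heatLaw, integrable_map_measure hcf.aestronglyMeasurable (by fun_prop)] at h1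
    exact h1
  · exact (by fun_prop : Continuous (F' τ)).aestronglyMeasurable
  · refine Eventually.of_forall fun q s hs => ?_
    obtain ⟨h0, h2, h3⟩ := hball s hs
    have hs0 : 0 < √s := Real.sqrt_pos.2 h0
    have e1 := (fderiv ℝ f (q.1 + √s • q.2)).le_opNorm ((1 / (2 * √s)) • q.2)
    have e2 : ‖fderiv ℝ f (q.1 + √s • q.2)‖ ≤ c * (1 + 2 * ‖q.1‖ ^ 2 + 4 * τ * ‖q.2‖ ^ 2) := by
      refine (hf.bound_fderiv _).trans (mul_le_mul_of_nonneg_left ?_ hc)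
      nlinarith [norm_add_sqrt_smul_sq_le h0.le q.1 q.2,
        mul_le_mul_of_nonneg_right h2 (sq_nonneg ‖q.2‖)]
    have e3 : ‖(1 / (2 * √s)) • q.2‖ ≤ 1 / (2 * √(τ / 2)) * ‖q.2‖ := by
      rw [norm_smul, Real.norm_of_nonneg (by positivity)]
      gcongr
    refine e1.trans ((mul_le_mul e2 e3 (norm_nonneg _) (by positivity)).trans_eq ?_)
    simp only [K]
    ring
  · refine Integrable.const_mul (Integrable.add ?_ ?_) K
    · have h1 : Integrable (fun x : Ed d => 1 + 2 * ‖x‖ ^ 2) m :=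
        (integrable_const _).add ((memP_two_iff.1 hm).2.const_mul 2)
      exact h1.mul_prod (integrable_norm_pow_gaussMeasure 1)
    · exact (integrable_const (1 : ℝ)).mul_prod
        ((integrable_norm_pow_gaussMeasure 3).const_mul (4 * τ))
  · refine Eventually.of_forall fun q s hs => ?_
    obtain ⟨h0, -, -⟩ := hball s hs
    have h1 : HasDerivAt (fun s => q.1 + √s • q.2) ((1 / (2 * √s)) • q.2) s :=
      ((Real.hasDerivAt_sqrt h0.ne').smul_const q.2).const_add q.1
    exact ((hf.smooth.differentiable two_ne_zero) _).hasFDerivAt.comp_hasDerivAt s h1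

theorem QuadC2.continuous_integral_heatLaw {c : ℝ} {f : Ed d → ℝ} (hf : QuadC2 c f)
    {m : Measure (Ed d)} (hm : MemP d 2 m) : Continuous fun τ => ∫ x, f x ∂(heatLaw τ m) := by
  have := hm.1
  refine continuous_iff_seqContinuous.2 fun τn τ hτ => ?_
  refine WConv.tendsto_integral (memP_heatLaw τ hm) (fun n => memP_heatLaw (τn n) hm)
    (WConv.heatLaw (Or.inr rfl) (wconv_const two_ne_zero m) hm (fun _ => hm) hτ)
    (fun _ => hf.smooth.continuous) hf.smooth.continuous (fun _ => hf.bound) fun x => ?_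
  exact (hf.smooth.continuous.tendsto x).comp tendsto_snd

/-- Mean value form of Itô's formula. -/
theorem QuadC2.exists_integral_heatLaw_sub {c : ℝ} {f : Ed d → ℝ} (hf : QuadC2 c f)
    {m : Measure (Ed d)} (hm : MemP d 2 m) {a b : ℝ} (ha : 0 ≤ a) (hab : a < b) :
    ∃ s ∈ Ioo a b, ∫ x, f x ∂(heatLaw b m) - ∫ x, f x ∂(heatLaw a m) =
      (b - a) * (1 / 2 * ∫ x, lapl d f x ∂(heatLaw s m)) := by
  obtain ⟨s, hs, h⟩ := exists_hasDerivAt_eq_slope (fun τ => ∫ x, f x ∂(heatLaw τ m))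
    (fun τ => 1 / 2 * ∫ x, lapl d f x ∂(heatLaw τ m)) hab
    (hf.continuous_integral_heatLaw hm).continuousOn
    fun s hs => hf.hasDerivAt_integral_heatLaw hm (ha.trans_lt hs.1)
  refine ⟨s, hs, ?_⟩
  rw [h]
  field_simp [sub_ne_zero.2 hab.ne']

end Ito

section RegularFunctional

variable {d : ℕ}

/-- A functional `v` on `𝒫₂`, continuous along `d₂`-convergent sequences, whose linear functional
derivative `δv` is a `C²` function with quadratic growth of constant `c`. -/
structure RegFun (c : ℝ) (v : Measure (Ed d) → ℝ) (δv : Measure (Ed d) → Ed d → ℝ) : Prop where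
  cont : ∀ (m : Measure (Ed d)) (mn : ℕ → Measure (Ed d)), MemP d 2 m → (∀ n, MemP d 2 (mn n)) →
    WConv d 2 mn m → Tendsto (fun n => v (mn n)) atTop (𝓝 (v m))
  measDeriv : ∀ m m' : Measure (Ed d), MemP d 2 m → MemP d 2 m' →
    Tendsto (fun r : ℝ => (v (mix r m m') - v m) / r) (𝓝[>] 0) (𝓝 (∫ x, δv m x ∂m'))
  normalized : ∀ m : Measure (Ed d), MemP d 2 m → ∫ x, δv m x ∂m = 0
  quad : ∀ m : Measure (Ed d), MemP d 2 m → QuadC2 c (δv m)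

theorem QuadC2.integrable {c : ℝ} {f : Ed d → ℝ} (hf : QuadC2 c f) {m : Measure (Ed d)}
    (hm : MemP d 2 m) : Integrable f m :=
  hm.integrable_of_le hf.smooth.continuous hf.bound

theorem MemP.abs_integral_le {m : Measure (Ed d)} (hm : MemP d 2 m) {f : Ed d → ℝ} {c : ℝ}
    (h : ∀ x, |f x| ≤ c * (1 + ‖x‖ ^ 2)) : |∫ x, f x ∂m| ≤ c * (1 + ∫ x, ‖x‖ ^ 2 ∂m) := by
  have := hm.1
  have h1 := norm_integral_le_of_norm_le (f := f) (hm.integrable_quadratic c) (Eventually.of_forall h)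
  rwa [integral_const_mul, integral_add (integrable_const _) (memP_two_iff.1 hm).2,
    integral_const, probReal_univ, one_smul] at h1

theorem mix_comm {r : ℝ} (h0 : 0 ≤ r) (h1 : r ≤ 1) (m m' : Measure (Ed d)) :
    mix (1 - r) m' m = mix r m m' := by
  rw [mix_eq h0, mix_eq (sub_nonneg.2 h1), add_comm, sub_sub_cancel]

theorem tendsto_prod_nhds_of_seq {X Y : Type*} [TopologicalSpace X] [FirstCountableTopology X]
    [TopologicalSpace Y] {g : ℕ → X → Y} {x : X} {a : Y}
    (h : ∀ (φ : ℕ → ℕ) (xn : ℕ → X), Tendsto φ atTop atTop → Tendsto xn atTop (𝓝 x) →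
      Tendsto (fun n => g (φ n) (xn n)) atTop (𝓝 a)) :
    Tendsto (fun p : ℕ × X => g p.1 p.2) (atTop ×ˢ 𝓝 x) (𝓝 a) := by
  refine tendsto_of_seq_tendsto fun u hu => ?_
  exact h (fun n => (u n).1) (fun n => (u n).2) (tendsto_fst.comp hu) (tendsto_snd.comp hu)

variable {c : ℝ} {v : Measure (Ed d) → ℝ} {δv : Measure (Ed d) → Ed d → ℝ}

theorem RegFun.hasDerivWithinAt_mix (hv : RegFun c v δv) {m m' : Measure (Ed d)}
    (hm : MemP d 2 m) (hm' : MemP d 2 m') {r : ℝ} (hr : r ∈ Ico (0 : ℝ) 1) :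
    HasDerivWithinAt (fun r => v (mix r m m'))
      (∫ x, δv (mix r m m') x ∂m' - ∫ x, δv (mix r m m') x ∂m) (Ici r) r := by
  have h1 : 0 < 1 - r := by linarith [hr.2]
  have hμ := memP_mix hr.1 hr.2.le hm hm'
  have hq := hv.quad _ hμ
  have hnorm := hv.normalized _ hμ
  rw [integral_mix hr.1 hr.2.le (hq.integrable hm) (hq.integrable hm')] at hnorm
  set X := ∫ x, δv (mix r m m') x ∂m
  set X' := ∫ x, δv (mix r m m') x ∂m'
  have hX : X' - X = (1 - r)⁻¹ * X' := by
    field_simp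
    linarith
  rw [hX, ← hasDerivWithinAt_Ioi_iff_Ici, hasDerivWithinAt_iff_tendsto_slope' self_notMem_Ioi]
  have hk : Tendsto (fun y => (y - r) / (1 - r)) (𝓝[>] r) (𝓝[>] 0) := by
    refine tendsto_nhdsWithin_iff.2 ⟨?_, ?_⟩
    · have : Tendsto (fun y => (y - r) / (1 - r)) (𝓝 r) (𝓝 ((r - r) / (1 - r))) :=
        ((continuous_id.sub continuous_const).div_const _).tendsto r
      rw [sub_self, zero_div] at this
      exact this.mono_left nhdsWithin_le_nhds
    · filter_upwards [self_mem_nhdsWithin] with y hy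
      exact div_pos (sub_pos.2 hy) h1
  have hlim := ((hv.measDeriv _ _ hμ hm').comp hk).const_mul (1 - r)⁻¹
  refine hlim.congr' ?_
  filter_upwards [Ioo_mem_nhdsGT hr.2] with y hy
  have hy0 : 0 < y - r := sub_pos.2 hy.1
  have e := mix_add_eq_mix_mix hr.1 hr.2 hy0.le (by linarith [hy.2]) m m'
  rw [add_sub_cancel] at e
  simp only [Function.comp_apply, slope_def_field]
  rw [← e]
  field_simp

theorem RegFun.continuousOn_mix (hv : RegFun c v δv) {m m' : Measure (Ed d)}
    (hm : MemP d 2 m) (hm' : MemP d 2 m') :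
    ContinuousOn (fun r => v (mix r m m')) (Icc 0 1) := by
  rw [continuousOn_iff_continuous_domRestrict, continuous_iff_seqContinuous]
  intro rn r h
  exact hv.cont _ _ (memP_mix r.2.1 r.2.2 hm hm') (fun n => memP_mix (rn n).2.1 (rn n).2.2 hm hm')
    (wconv_mix_param hm hm' r.2 (fun n => (rn n).2) ((continuous_subtype_val.tendsto r).comp h))

/-- Mean value inequality on `𝒫₂`. -/
theorem RegFun.exists_abs_sub_sub_le (hv : RegFun c v δv) {m m' : Measure (Ed d)}
    (hm : MemP d 2 m) (hm' : MemP d 2 m') (K : ℝ) {ε : ℝ} (hε : 0 < ε) :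
    ∃ r ∈ Ico (0 : ℝ) 1, |v m' - v m - K| ≤
      |∫ x, δv (mix r m m') x ∂m' - ∫ x, δv (mix r m m') x ∂m - K| + ε := by
  by_contra! hcon
  have h := norm_image_sub_le_of_norm_deriv_right_le_segment
    (f := fun r => v (mix r m m') - r * K)
    (f' := fun r => ∫ x, δv (mix r m m') x ∂m' - ∫ x, δv (mix r m m') x ∂m - 1 * K)
    (C := |v m' - v m - K| - ε) (a := 0) (b := 1)
    ((hv.continuousOn_mix hm hm').sub (by fun_prop))
    (fun r hr => (hv.hasDerivWithinAt_mix hm hm' hr).sub ((hasDerivWithinAt_id r _).mul_const K))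
    (fun r hr => by
      have := hcon r hr
      rw [one_mul, Real.norm_eq_abs]
      linarith) 1 (by simp)
  simp only [mix_one, mix_zero, Real.norm_eq_abs, one_mul, zero_mul, sub_zero, mul_one] at h
  rw [sub_right_comm] at h
  linarith

theorem RegFun.abs_mix_sub_le (hv : RegFun c v δv) {m m' : Measure (Ed d)}
    (hm : MemP d 2 m) (hm' : MemP d 2 m') {r : ℝ} (h0 : 0 ≤ r) (h1 : r ≤ 1) :
    |v (mix r m m') - v m| ≤
      r * (c * (1 + ∫ x, ‖x‖ ^ 2 ∂m') + c * (1 + ∫ x, ‖x‖ ^ 2 ∂m)) := by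
  refine le_of_forall_pos_le_add fun ε hε => ?_
  have hr := memP_mix h0 h1 hm hm'
  obtain ⟨ρ, hρ, h⟩ := hv.exists_abs_sub_sub_le hm hr 0 hε
  have hq := hv.quad _ (memP_mix hρ.1 hρ.2.le hm hr)
  rw [sub_zero, sub_zero] at h
  refine h.trans (add_le_add_left ?_ ε)
  rw [integral_mix h0 h1 (hq.integrable hm) (hq.integrable hm')]
  set X := ∫ x, δv (mix ρ m (mix r m m')) x ∂m
  set X' := ∫ x, δv (mix ρ m (mix r m m')) x ∂m'
  rw [show (1 - r) * X + r * X' - X = r * (X' - X) by ring, abs_mul, abs_of_nonneg h0]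
  refine mul_le_mul_of_nonneg_left ?_ h0
  exact (abs_sub _ _).trans (add_le_add (hm'.abs_integral_le hq.bound) (hm.abs_integral_le hq.bound))

theorem RegFun.exists_abs_heatLaw_sub_le_of_lt (hv : RegFun c v δv) {m : Measure (Ed d)}
    (hm : MemP d 2 m) {a b : ℝ} (ha : 0 ≤ a) (hab : a < b) (K : ℝ) {ε : ℝ} (hε : 0 < ε) :
    ∃ r ∈ Icc (0 : ℝ) 1, ∃ s ∈ Ioo a b,
      |v (heatLaw b m) - v (heatLaw a m) - K * (b - a)| ≤ (b - a) *
        (|1 / 2 * ∫ x, lapl d (δv (mix r (heatLaw a m) (heatLaw b m))) x ∂(heatLaw s m) - K| + ε)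
        := by
  have hba : 0 < b - a := sub_pos.2 hab
  have hA := memP_heatLaw a hm
  have hB := memP_heatLaw b hm
  obtain ⟨r, hr, h⟩ := hv.exists_abs_sub_sub_le hA hB (K * (b - a)) (mul_pos hba hε)
  obtain ⟨s, hs, e⟩ := (hv.quad _ (memP_mix hr.1 hr.2.le hA hB)).exists_integral_heatLaw_sub
    hm ha hab
  refine ⟨r, ⟨hr.1, hr.2.le⟩, s, hs, h.trans_eq ?_⟩
  rw [e, mul_comm K, ← mul_sub, abs_mul, abs_of_pos hba]
  ring

theorem RegFun.exists_abs_heatLaw_sub_le (hv : RegFun c v δv) {m : Measure (Ed d)}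
    (hm : MemP d 2 m) {a b : ℝ} (ha : 0 ≤ a) (hb : 0 ≤ b) (hab : a ≠ b) (K : ℝ) {ε : ℝ}
    (hε : 0 < ε) :
    ∃ r ∈ Icc (0 : ℝ) 1, ∃ s, |s - a| ≤ |b - a| ∧
      |v (heatLaw b m) - v (heatLaw a m) - K * (b - a)| ≤ |b - a| *
        (|1 / 2 * ∫ x, lapl d (δv (mix r (heatLaw a m) (heatLaw b m))) x ∂(heatLaw s m) - K| + ε)
        := by
  rcases lt_or_gt_of_ne hab with h | h
  · obtain ⟨r, hr, s, hs, e⟩ := hv.exists_abs_heatLaw_sub_le_of_lt hm ha h K hε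
    refine ⟨r, hr, s, ?_, ?_⟩
    · rw [abs_of_pos (sub_pos.2 h), abs_of_pos (sub_pos.2 hs.1)]
      linarith [hs.2]
    · rwa [abs_of_pos (sub_pos.2 h)]
  · obtain ⟨r, hr, s, hs, e⟩ := hv.exists_abs_heatLaw_sub_le_of_lt hm hb h K hε
    refine ⟨1 - r, ⟨by linarith [hr.2], by linarith [hr.1]⟩, s, ?_, ?_⟩
    · rw [abs_of_neg (sub_neg.2 h), abs_of_neg (sub_neg.2 hs.2)]
      linarith [hs.1]
    · rw [abs_of_neg (sub_neg.2 h), neg_sub, mix_comm hr.1 hr.2]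
      refine le_of_eq_of_le ?_ e
      rw [← abs_neg]
      congr 1
      ring

theorem RegFun.abs_heatLaw_sub_le (hv : RegFun c v δv) {m : Measure (Ed d)}
    (hm : MemP d 2 m) {a b T : ℝ} (ha : 0 ≤ a) (haT : a ≤ T) (hb : 0 ≤ b) (hbT : b ≤ T) :
    |v (heatLaw b m) - v (heatLaw a m)| ≤ |b - a| * (1 / 2 * (d * c * (1 +
      (2 * ∫ x, ‖x‖ ^ 2 ∂m + 2 * T * ∫ z : Ed d, ‖z‖ ^ 2 ∂(gaussMeasure d 1))))) := by
  wlog hab : a < b generalizing a b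
  · rcases (not_lt.1 hab).eq_or_lt with rfl | h
    · simp
    · rw [abs_sub_comm, abs_sub_comm b a]
      exact this hb hbT ha haT h
  have hc : 0 ≤ c := (hv.quad _ hm).nonneg
  have hba : 0 < b - a := sub_pos.2 hab
  refine le_of_forall_pos_le_add fun ε hε => ?_
  obtain ⟨r, hr, s, hs, e⟩ := hv.exists_abs_heatLaw_sub_le_of_lt hm ha hab 0 (div_pos hε hba)
  have hq := hv.quad _ (memP_mix hr.1 hr.2 (memP_heatLaw a hm) (memP_heatLaw b hm))
  rw [zero_mul, sub_zero, sub_zero, mul_add, mul_div_cancel₀ _ hba.ne'] at e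
  rw [abs_of_pos hba]
  refine e.trans (add_le_add_left (mul_le_mul_of_nonneg_left ?_ hba.le) ε)
  rw [abs_mul, abs_of_pos (by norm_num : (0 : ℝ) < 1 / 2)]
  refine mul_le_mul_of_nonneg_left ?_ (by norm_num)
  refine ((memP_heatLaw s hm).abs_integral_le hq.abs_lapl_le).trans ?_
  have := integral_norm_sq_heatLaw_le (hs.2.le.trans hbT) (ha.trans haT) hm
  gcongr

/-- Differentiation along the heat flow, for a sequence of functionals. -/
theorem tendsto_heatLaw_slope {U : ℕ → Measure (Ed d) → ℝ} {δU : ℕ → Measure (Ed d) → Ed d → ℝ}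
    (hU : ∀ n, RegFun c (U n) (δU n)) {m : Measure (Ed d)} (hm : MemP d 2 m) {τ : ℝ} {τn : ℕ → ℝ}
    (hτ : 0 ≤ τ) (hτn : ∀ n, 0 ≤ τn n) (hne : ∀ n, τn n ≠ τ) (hlim : Tendsto τn atTop (𝓝 τ))
    {l : Ed d → ℝ} (hl : Continuous l)
    (hconv : ∀ μ : ℕ → Measure (Ed d), (∀ n, MemP d 2 (μ n)) → WConv d 2 μ (heatLaw τ m) →
      ∀ x, Tendsto (fun p : ℕ × Ed d => lapl d (δU p.1 (μ p.1)) p.2) (atTop ×ˢ 𝓝 x) (𝓝 (l x))) :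
    Tendsto (fun n => (U n (heatLaw (τn n) m) - U n (heatLaw τ m)) / (τn n - τ)) atTop
      (𝓝 (1 / 2 * ∫ x, l x ∂(heatLaw τ m))) := by
  have := hm.1
  set K := 1 / 2 * ∫ x, l x ∂(heatLaw τ m)
  choose r hr s hs h using fun n => (hU n).exists_abs_heatLaw_sub_le hm hτ (hτn n) (hne n).symm K
    (ε := 1 / ((n : ℝ) + 1)) (by positivity)
  have hsτ : Tendsto s atTop (𝓝 τ) := by
    refine tendsto_iff_norm_sub_tendsto_zero.2 (squeeze_zero (fun _ => norm_nonneg _) hs ?_)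
    simpa using (hlim.sub_const τ).abs
  have hw : ∀ σ : ℕ → ℝ, Tendsto σ atTop (𝓝 τ) →
      WConv d 2 (fun n => heatLaw (σ n) m) (heatLaw τ m) := fun σ hσ =>
    WConv.heatLaw (Or.inr rfl) (wconv_const two_ne_zero m) hm (fun _ => hm) hσ
  have hmn := fun n => memP_heatLaw (τn n) hm
  have hμ : WConv d 2 (fun n => mix (r n) (heatLaw τ m) (heatLaw (τn n) m)) (heatLaw τ m) :=
    (hw τn hlim).mix (memP_heatLaw τ hm) hmn hr
  have hμP := fun n => memP_mix (hr n).1 (hr n).2 (memP_heatLaw τ hm) (hmn n)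
  have hq := fun n => (hU n).quad _ (hμP n)
  have hcv := hconv _ hμP hμ
  have ht := WConv.tendsto_integral (memP_heatLaw τ hm) (fun n => memP_heatLaw (s n) hm) (hw s hsτ)
    (g := fun n => lapl d (δU n (mix (r n) (heatLaw τ m) (heatLaw (τn n) m)))) (g₀ := l)
    (c := d * c) (fun n => (hq n).continuous_lapl) hl (fun n => (hq n).abs_lapl_le) hcv
  have ht2 : Tendsto (fun n => |1 / 2 * ∫ x, lapl d (δU n (mix (r n) (heatLaw τ m)
      (heatLaw (τn n) m))) x ∂(heatLaw (s n) m) - K| + 1 / ((n : ℝ) + 1)) atTop (𝓝 0) := by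
    have := ((ht.const_mul (1 / 2)).sub_const K).abs.add
      (tendsto_one_div_add_atTop_nhds_zero_nat (𝕜 := ℝ))
    rwa [sub_self, abs_zero, add_zero] at this
  refine tendsto_iff_norm_sub_tendsto_zero.2
    (squeeze_zero (fun _ => norm_nonneg _) (fun n => ?_) ht2)
  have hpos : 0 < |τn n - τ| := abs_pos.2 (sub_ne_zero.2 (hne n))
  have h1 := h n
  rw [Real.norm_eq_abs, ← mul_le_mul_iff_right₀ hpos, ← abs_mul]
  refine le_of_eq_of_le ?_ h1
  congr 1
  field_simp [sub_ne_zero.2 (hne n)]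

end RegularFunctional

section IntegralC2

variable {d : ℕ}

theorem exists_linearIsometry_iteratedFDeriv_two :
    ∃ L : (Ed d →L[ℝ] Ed d →L[ℝ] ℝ) →ₗᵢ[ℝ] ContinuousMultilinearMap ℝ (fun _ : Fin 2 => Ed d) ℝ,
      ∀ (f : Ed d → ℝ) (x : Ed d), iteratedFDeriv ℝ 2 f x = L (fderiv ℝ (fderiv ℝ f) x) := by
  refine ⟨((continuousMultilinearCurryRightEquiv' ℝ 1 (Ed d) ℝ).symm.toLinearIsometry.comp
    (continuousMultilinearCurryRightEquiv' ℝ 0 (Ed d)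
      (Ed d →L[ℝ] ℝ)).symm.toLinearIsometry).comp
    (continuousMultilinearCurryFin0 ℝ (Ed d) (Ed d →L[ℝ] Ed d →L[ℝ] ℝ)).symm.toLinearIsometry,
    fun f x => ?_⟩
  rw [iteratedFDeriv_succ_eq_comp_right, Function.comp_apply, iteratedFDeriv_succ_eq_comp_right,
    Function.comp_apply, iteratedFDeriv_zero_eq_comp]
  rfl

theorem tendsto_iteratedFDeriv_two_iff {ι : Type*} {l : Filter ι} {f : ι → Ed d → ℝ}
    {x : ι → Ed d} {f₀ : Ed d → ℝ} {x₀ : Ed d} :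
    Tendsto (fun i => iteratedFDeriv ℝ 2 (f i) (x i)) l (𝓝 (iteratedFDeriv ℝ 2 f₀ x₀)) ↔
      Tendsto (fun i => fderiv ℝ (fderiv ℝ (f i)) (x i)) l (𝓝 (fderiv ℝ (fderiv ℝ f₀) x₀)) := by
  obtain ⟨L, hL⟩ := exists_linearIsometry_iteratedFDeriv_two (d := d)
  simp only [hL]
  exact L.isometry.isUniformInducing.isInducing.tendsto_nhds_iff.symm

theorem tendsto_lapl {ι : Type*} {l : Filter ι} {f : ι → Ed d → ℝ}
    {x : ι → Ed d} {f₀ : Ed d → ℝ} {x₀ : Ed d}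
    (h : Tendsto (fun i => fderiv ℝ (fderiv ℝ (f i)) (x i)) l (𝓝 (fderiv ℝ (fderiv ℝ f₀) x₀))) :
    Tendsto (fun i => lapl d (f i) (x i)) l (𝓝 (lapl d f₀ x₀)) :=
  (continuous_trace₂.tendsto _).comp (tendsto_iteratedFDeriv_two_iff.2 h)

variable {Ω : Type*} [MeasurableSpace Ω] {P : Measure Ω}

theorem hasFDerivAt_integral_quadratic {E : Type*} [NormedAddCommGroup E] [NormedSpace ℝ E]
    {k : Ω → Ed d → E} {b : Ω → ℝ} (hb : Integrable b P)
    (hk : ∀ ω, Differentiable ℝ (k ω))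
    (h0 : ∀ᵐ ω ∂P, ∀ x, ‖k ω x‖ ≤ b ω * (1 + ‖x‖ ^ 2))
    (h1 : ∀ᵐ ω ∂P, ∀ x, ‖fderiv ℝ (k ω) x‖ ≤ b ω * (1 + ‖x‖ ^ 2))
    (m0 : ∀ x, AEStronglyMeasurable (fun ω => k ω x) P)
    (m1 : ∀ x, AEStronglyMeasurable (fun ω => fderiv ℝ (k ω) x) P) (x : Ed d) :
    HasFDerivAt (fun x => ∫ ω, k ω x ∂P) (∫ ω, fderiv ℝ (k ω) x ∂P) x := by
  refine hasFDerivAt_integral_of_dominated_of_fderiv_le (s := Metric.ball x 1)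
    (F' := fun x ω => fderiv ℝ (k ω) x)
    (bound := fun ω => |b ω| * (1 + (‖x‖ + 1) ^ 2)) (Metric.ball_mem_nhds x one_pos)
    (Eventually.of_forall m0) ?_ (m1 x) ?_ (hb.abs.mul_const _)
    (Eventually.of_forall fun ω y _ => (hk ω y).hasFDerivAt)
  · exact (hb.mul_const _).mono' (m0 x) (h0.mono fun ω h => h x)
  · filter_upwards [h1] with ω h y hy
    have hy' : ‖y‖ ≤ ‖x‖ + 1 := by
      have := norm_le_norm_add_norm_sub' y x
      rw [Metric.mem_ball, dist_eq_norm] at hy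
      linarith
    refine (h y).trans ?_
    gcongr
    exact le_abs_self _

theorem norm_integral_le_quadratic {E : Type*} [NormedAddCommGroup E] [NormedSpace ℝ E]
    {k : Ω → E} {b : Ω → ℝ} (hb : Integrable b P) {C : ℝ}
    (h0 : ∀ᵐ ω ∂P, ‖k ω‖ ≤ b ω * C) : ‖∫ ω, k ω ∂P‖ ≤ (∫ ω, b ω ∂P) * C := by
  rw [← integral_mul_const]
  exact norm_integral_le_of_norm_le (hb.mul_const _) h0

/-- Differentiation twice under the integral sign. -/
theorem quadC2_integral {k : Ω → Ed d → ℝ} {b : Ω → ℝ} (hb : Integrable b P)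
    (hk : ∀ ω, ContDiff ℝ 2 (k ω))
    (h0 : ∀ᵐ ω ∂P, ∀ x, |k ω x| ≤ b ω * (1 + ‖x‖ ^ 2))
    (h1 : ∀ᵐ ω ∂P, ∀ x, ‖fderiv ℝ (k ω) x‖ ≤ b ω * (1 + ‖x‖ ^ 2))
    (h2 : ∀ᵐ ω ∂P, ∀ x, ‖fderiv ℝ (fderiv ℝ (k ω)) x‖ ≤ b ω * (1 + ‖x‖ ^ 2))
    (m0 : ∀ x, AEStronglyMeasurable (fun ω => k ω x) P)
    (m1 : ∀ x, AEStronglyMeasurable (fun ω => fderiv ℝ (k ω) x) P)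
    (m2 : ∀ x, AEStronglyMeasurable (fun ω => fderiv ℝ (fderiv ℝ (k ω)) x) P) :
    QuadC2 (∫ ω, b ω ∂P) (fun x => ∫ ω, k ω x ∂P) ∧
      (fderiv ℝ fun x => ∫ ω, k ω x ∂P) = (fun x => ∫ ω, fderiv ℝ (k ω) x ∂P) ∧
      (fderiv ℝ (fderiv ℝ fun x => ∫ ω, k ω x ∂P)) =
        fun x => ∫ ω, fderiv ℝ (fderiv ℝ (k ω)) x ∂P := by
  have hk1 : ∀ ω, ContDiff ℝ 1 (fderiv ℝ (k ω)) := fun ω => (hk ω).fderiv_right (by norm_num)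
  have d1 := hasFDerivAt_integral_quadratic hb (fun ω => (hk ω).differentiable two_ne_zero)
    h0 h1 m0 m1
  have d2 := hasFDerivAt_integral_quadratic hb (fun ω => (hk1 ω).differentiable one_ne_zero)
    h1 h2 m1 m2
  have e1 : (fderiv ℝ fun x => ∫ ω, k ω x ∂P) = (fun x => ∫ ω, fderiv ℝ (k ω) x ∂P) :=
    funext fun x => (d1 x).fderiv
  have e2 : (fderiv ℝ (fderiv ℝ fun x => ∫ ω, k ω x ∂P)) =
      fun x => ∫ ω, fderiv ℝ (fderiv ℝ (k ω)) x ∂P := by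
    rw [e1]
    exact funext fun x => (d2 x).fderiv
  have hcont : Continuous fun x => ∫ ω, fderiv ℝ (fderiv ℝ (k ω)) x ∂P := by
    refine continuous_iff_continuousAt.2 fun x => ?_
    refine continuousAt_of_dominated (bound := fun ω => |b ω| * (1 + (‖x‖ + 1) ^ 2))
      (Eventually.of_forall m2) ?_ (hb.abs.mul_const _)
      (Eventually.of_forall fun ω => ((hk1 ω).continuous_fderiv one_ne_zero).continuousAt)
    filter_upwards [Metric.ball_mem_nhds x one_pos] with y hy
    filter_upwards [h2] with ω h
    have hy' : ‖y‖ ≤ ‖x‖ + 1 := by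
      have := norm_le_norm_add_norm_sub' y x
      rw [Metric.mem_ball, dist_eq_norm] at hy
      linarith
    refine (h y).trans ?_
    gcongr
    exact le_abs_self _
  refine ⟨⟨?_, fun x => ?_, fun x => ?_, fun x => ?_⟩, e1, e2⟩
  · rw [show (2 : WithTop ℕ∞) = 1 + 1 by norm_num, contDiff_succ_iff_fderiv]
    refine ⟨fun x => (d1 x).differentiableAt, by simp, ?_⟩
    rw [contDiff_one_iff_fderiv, e2, e1]
    exact ⟨fun x => (d2 x).differentiableAt, hcont⟩
  · exact norm_integral_le_quadratic (k := fun ω => k ω x) hb (h0.mono fun ω h => h x)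
  · rw [e1]
    exact norm_integral_le_quadratic hb (h1.mono fun ω h => h x)
  · rw [← norm_fderiv_fderiv, e2]
    exact norm_integral_le_quadratic hb (h2.mono fun ω h => h x)

end IntegralC2

section Duhamel

variable {d : ℕ} {E : Type*} [NormedAddCommGroup E]

/-- Sequential continuity for `d₂` of a map `G(s, μ, x)`, separately for `s < t₁` and
`s ≥ t₁`. -/
def SeqCont (t₁ : ℝ) (G : ℝ → Measure (Ed d) → Ed d → E) : Prop :=
  ∀ (sn : ℕ → ℝ) (s : ℝ) (μn : ℕ → Measure (Ed d)) (μ : Measure (Ed d)) (xn : ℕ → Ed d) (x : Ed d),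
    (∀ n, sn n < t₁ ↔ s < t₁) → Tendsto sn atTop (𝓝 s) → (∀ n, MemP d 2 (μn n)) → MemP d 2 μ →
    WConv d 2 μn μ → Tendsto xn atTop (𝓝 x) →
    Tendsto (fun n => G (sn n) (μn n) (xn n)) atTop (𝓝 (G s μ x))

/-- Quadratic growth in `x`, uniform in the other variables. -/
def QuadBdd (c : ℝ) (G : ℝ → Measure (Ed d) → Ed d → E) : Prop :=
  ∀ s μ, MemP d 2 μ → ∀ x, ‖G s μ x‖ ≤ c * (1 + ‖x‖ ^ 2)

theorem QuadBdd.nonneg {c : ℝ} {G : ℝ → Measure (Ed d) → Ed d → E} (hG : QuadBdd c G)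
    {m : Measure (Ed d)} (hm : MemP d 2 m) : 0 ≤ c := by
  simpa using (norm_nonneg _).trans (hG 0 m hm 0)

theorem wconv_heatLaw {m : Measure (Ed d)} (hm : MemP d 2 m) {τn : ℕ → ℝ} {τ : ℝ}
    (h : Tendsto τn atTop (𝓝 τ)) : WConv d 2 (fun n => heatLaw (τn n) m) (heatLaw τ m) :=
  have := hm.1
  WConv.heatLaw (Or.inr rfl) (wconv_const two_ne_zero m) hm (fun _ => hm) h

theorem SeqCont.continuous {t₁ : ℝ} {G : ℝ → Measure (Ed d) → Ed d → E} (hG : SeqCont t₁ G)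
    (s : ℝ) {m : Measure (Ed d)} (hm : MemP d 2 m) : Continuous (G s m) := by
  have := hm.1
  refine continuous_iff_seqContinuous.2 fun xn x hx => ?_
  exact hG (fun _ => s) s (fun _ => m) m xn x (fun _ => Iff.rfl) tendsto_const_nhds (fun _ => hm)
    hm (wconv_const two_ne_zero m) hx

theorem SeqCont.aestronglyMeasurable {t₁ : ℝ} {G : ℝ → Measure (Ed d) → Ed d → E}
    (hG : SeqCont t₁ G) {m : Measure (Ed d)} (hm : MemP d 2 m) (t : ℝ) {Ω : Type*}
    [TopologicalSpace Ω] [SecondCountableTopology Ω] [MeasurableSpace Ω] [OpensMeasurableSpace Ω]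
    {σ : Ω → ℝ} {Y : Ω → Ed d} (hσ : Continuous σ) (hY : Continuous Y) (P : Measure Ω) :
    AEStronglyMeasurable (fun ω => G (σ ω) (heatLaw (σ ω - t) m) (Y ω)) P := by
  have key : ∀ S : Set Ω, (∀ a ∈ S, ∀ b ∈ S, (σ a < t₁ ↔ σ b < t₁)) →
      ContinuousOn (fun ω => G (σ ω) (heatLaw (σ ω - t) m) (Y ω)) S := fun S hS => by
    rw [continuousOn_iff_continuous_domRestrict, continuous_iff_seqContinuous]
    intro ωn ω hω
    have h1 : Tendsto (fun n => (ωn n : Ω)) atTop (𝓝 (ω : Ω)) :=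
      (continuous_subtype_val.tendsto ω).comp hω
    have h2 := (hσ.tendsto _).comp h1
    exact hG _ _ _ _ _ _ (fun n => hS _ (ωn n).2 _ ω.2) h2 (fun n => memP_heatLaw _ hm)
      (memP_heatLaw _ hm) (wconv_heatLaw hm (h2.sub_const t)) ((hY.tendsto _).comp h1)
  have hm1 : MeasurableSet {ω | σ ω < t₁} := (isOpen_lt hσ continuous_const).measurableSet
  have a1 := (key {ω | σ ω < t₁} fun a ha b hb => by
    simp only [mem_ofPred_eq] at ha hb; tauto).aestronglyMeasurable (μ := P) hm1
  have a2 := (key {ω | σ ω < t₁}ᶜ fun a ha b hb => by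
    simp only [mem_compl_iff, mem_ofPred_eq] at ha hb; tauto).aestronglyMeasurable (μ := P)
      hm1.compl
  have := aestronglyMeasurable_union_iff.2 ⟨a1, a2⟩
  rwa [union_compl_self, Measure.restrict_univ] at this

/-- Lebesgue measure on `(0, t₁)` plus a unit mass at `t₁`. -/
def timeMeasure (t₁ : ℝ) : Measure ℝ := volume.restrict (Ioo 0 t₁) + Measure.dirac t₁

instance (t₁ : ℝ) : IsFiniteMeasure (timeMeasure t₁) := by
  unfold timeMeasure
  infer_instance

theorem ae_timeMeasure_mem {t₁ : ℝ} (h : 0 ≤ t₁) : ∀ᵐ s ∂(timeMeasure t₁), s ∈ Icc 0 t₁ := by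
  rw [timeMeasure, ae_add_measure_iff]
  constructor
  · exact (ae_restrict_mem measurableSet_Ioo).mono fun s hs => ⟨hs.1.le, hs.2.le⟩
  · exact (ae_dirac_iff (p := fun s => s ∈ Icc 0 t₁) measurableSet_Icc).2 ⟨h, le_rfl⟩

theorem ae_timeMeasure_ne {t t₁ : ℝ} (h : t < t₁) : ∀ᵐ s ∂(timeMeasure t₁), s ≠ t := by
  rw [timeMeasure, ae_add_measure_iff]
  constructor
  · exact ae_restrict_of_ae (Measure.ae_ne volume t)
  · exact (ae_dirac_iff (p := fun s => s ≠ t) (measurableSet_singleton t).compl).2 h.ne'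

/-- The integrand of Duhamel's formula. -/
def duhamelKernel (G : ℝ → Measure (Ed d) → Ed d → E) (t : ℝ) (m : Measure (Ed d)) (x : Ed d) :
    ℝ × Ed d → E :=
  {p : ℝ × Ed d | t < p.1}.indicator fun p => G p.1 (heatLaw (p.1 - t) m) (x + √(p.1 - t) • p.2)

theorem duhamelKernel_of_lt (G : ℝ → Measure (Ed d) → Ed d → E) {t : ℝ} (m : Measure (Ed d))
    (x : Ed d) {p : ℝ × Ed d} (h : t < p.1) :
    duhamelKernel G t m x p = G p.1 (heatLaw (p.1 - t) m) (x + √(p.1 - t) • p.2) :=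
  indicator_of_mem (s := {p : ℝ × Ed d | t < p.1}) h _

theorem duhamelKernel_of_le (G : ℝ → Measure (Ed d) → Ed d → E) {t : ℝ} (m : Measure (Ed d))
    (x : Ed d) {p : ℝ × Ed d} (h : p.1 ≤ t) : duhamelKernel G t m x p = 0 :=
  indicator_of_notMem (s := {p : ℝ × Ed d | t < p.1}) (not_lt.2 h) _

theorem ae_norm_duhamelKernel_le {t₁ c : ℝ} (ht₁ : 0 ≤ t₁) {G : ℝ → Measure (Ed d) → Ed d → E}
    (hG : QuadBdd c G) :
    ∀ᵐ p ∂((timeMeasure t₁).prod (gaussMeasure d 1)), ∀ t, 0 ≤ t → ∀ m, MemP d 2 m → ∀ x,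
      ‖duhamelKernel G t m x p‖ ≤ c * (2 + 2 * t₁ * ‖p.2‖ ^ 2) * (1 + ‖x‖ ^ 2) := by
  filter_upwards [Measure.quasiMeasurePreserving_fst.ae (ae_timeMeasure_mem ht₁)]
    with p hp t ht m hm x
  have hc := hG.nonneg hm
  rcases lt_or_ge t p.1 with h | h
  · rw [duhamelKernel_of_lt G m x h]
    refine (hG _ _ (memP_heatLaw _ hm) _).trans ?_
    rw [mul_assoc]
    refine mul_le_mul_of_nonneg_left ?_ hc
    have h1 := norm_add_sqrt_smul_sq_le (sub_nonneg.2 h.le) x p.2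
    have h2 : (p.1 - t) * ‖p.2‖ ^ 2 ≤ t₁ * ‖p.2‖ ^ 2 :=
      mul_le_mul_of_nonneg_right (by linarith [hp.2]) (sq_nonneg _)
    have h3 : 0 ≤ t₁ * ‖p.2‖ ^ 2 * ‖x‖ ^ 2 := by positivity
    nlinarith
  · rw [duhamelKernel_of_le G m x h, norm_zero]
    positivity

theorem aestronglyMeasurable_duhamelKernel {t₁ : ℝ} {G : ℝ → Measure (Ed d) → Ed d → E}
    (hG : SeqCont t₁ G) {m : Measure (Ed d)} (hm : MemP d 2 m) (t : ℝ) {Ω : Type*}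
    [TopologicalSpace Ω] [SecondCountableTopology Ω] [MeasurableSpace Ω] [OpensMeasurableSpace Ω]
    {X : Ω → Ed d} {p : Ω → ℝ × Ed d} (hX : Continuous X) (hp : Continuous p) (P : Measure Ω) :
    AEStronglyMeasurable (fun ω => duhamelKernel G t m (X ω) (p ω)) P := by
  have h := (hG.aestronglyMeasurable hm t (σ := fun ω => (p ω).1)
    (Y := fun ω => X ω + √((p ω).1 - t) • (p ω).2) (by fun_prop) (by fun_prop) P).indicator
    (s := {ω | t < (p ω).1}) (isOpen_lt continuous_const (by fun_prop)).measurableSet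
  refine h.congr (Eventually.of_forall fun ω => ?_)
  beta_reduce
  rcases lt_or_ge t (p ω).1 with h | h
  · rw [duhamelKernel_of_lt G m _ h]
    exact indicator_of_mem (s := {ω | t < (p ω).1}) h _
  · rw [duhamelKernel_of_le G m _ h]
    exact indicator_of_notMem (s := {ω | t < (p ω).1}) (not_lt.2 h) _

theorem integrable_duhamel_bound (c t₁ : ℝ) :
    Integrable (fun p : ℝ × Ed d => c * (2 + 2 * t₁ * ‖p.2‖ ^ 2))
      ((timeMeasure t₁).prod (gaussMeasure d 1)) := by
  have h2 : Integrable (fun p : ℝ × Ed d => ‖p.2‖ ^ 2)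
      ((timeMeasure t₁).prod (gaussMeasure d 1)) :=
    (integrable_norm_pow_gaussMeasure 2).comp_snd _
  exact ((integrable_const _).add (h2.const_mul (2 * t₁))).const_mul c

variable [NormedSpace ℝ E]

/-- The Duhamel integral of `G`. -/
def duhamel (t₁ : ℝ) (G : ℝ → Measure (Ed d) → Ed d → E) (t : ℝ) (m : Measure (Ed d))
    (x : Ed d) : E :=
  ∫ p, duhamelKernel G t m x p ∂((timeMeasure t₁).prod (gaussMeasure d 1))

theorem tendsto_duhamel {t₁ c : ℝ} (ht₁ : 0 ≤ t₁) {G : ℝ → Measure (Ed d) → Ed d → E}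
    (hG : SeqCont t₁ G) (hGb : QuadBdd c G) {tn : ℕ → ℝ} {t : ℝ} (ht : t < t₁)
    (htn0 : ∀ n, 0 ≤ tn n) (htn : Tendsto tn atTop (𝓝 t)) {mn : ℕ → Measure (Ed d)}
    {m : Measure (Ed d)} (hm : MemP d 2 m) (hmn : ∀ n, MemP d 2 (mn n)) (hw : WConv d 2 mn m)
    {xn : ℕ → Ed d} {x : Ed d} (hx : Tendsto xn atTop (𝓝 x)) :
    Tendsto (fun n => duhamel t₁ G (tn n) (mn n) (xn n)) atTop (𝓝 (duhamel t₁ G t m x)) := by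
  obtain ⟨R, hR⟩ := hx.norm.bddAbove_range
  have hc := hGb.nonneg hm
  have hR' : ∀ n, ‖xn n‖ ≤ R := fun n => hR (mem_range_self n)
  refine tendsto_integral_of_dominated_convergence
    (fun p => c * (2 + 2 * t₁ * ‖p.2‖ ^ 2) * (1 + R ^ 2))
    (fun n => aestronglyMeasurable_duhamelKernel hG (hmn n) _ continuous_const continuous_id _)
    ((integrable_duhamel_bound c t₁).mul_const _) (fun n => ?_) ?_
  · filter_upwards [ae_norm_duhamelKernel_le ht₁ hGb] with p hp
    refine (hp _ (htn0 n) _ (hmn n) _).trans ?_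
    have := hR' n
    gcongr
  · filter_upwards [Measure.quasiMeasurePreserving_fst.ae (ae_timeMeasure_ne ht)] with p hp
    rcases lt_or_gt_of_ne hp with h | h
    · rw [duhamelKernel_of_le G m x h.le]
      refine tendsto_const_nhds.congr' ?_
      filter_upwards [htn.eventually (lt_mem_nhds h)] with n hn
      rw [duhamelKernel_of_le G _ _ hn.le]
    · rw [duhamelKernel_of_lt G m x h]
      have hsub : Tendsto (fun n => p.1 - tn n) atTop (𝓝 (p.1 - t)) := htn.const_sub p.1
      have := hG (fun _ => p.1) p.1 (fun n => heatLaw (p.1 - tn n) (mn n)) (heatLaw (p.1 - t) m)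
        (fun n => xn n + √(p.1 - tn n) • p.2) (x + √(p.1 - t) • p.2) (fun _ => Iff.rfl)
        tendsto_const_nhds (fun n => memP_heatLaw _ (hmn n)) (memP_heatLaw _ hm)
        (WConv.heatLaw (Or.inr rfl) hw hm hmn hsub) (hx.add (hsub.sqrt.smul_const p.2))
      refine this.congr' ?_
      filter_upwards [htn.eventually (gt_mem_nhds h)] with n hn
      rw [duhamelKernel_of_lt G _ _ hn]

theorem integral_duhamel {t₁ c : ℝ} (ht₁ : 0 ≤ t₁) {G : ℝ → Measure (Ed d) → Ed d → ℝ}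
    (hG : SeqCont t₁ G) (hGb : QuadBdd c G) {t : ℝ} (ht : 0 ≤ t) {m m' : Measure (Ed d)}
    (hm : MemP d 2 m) (hm' : MemP d 2 m') :
    ∫ x, duhamel t₁ G t m x ∂m' = ∫ s, (Ioi t).indicator
      (fun s => ∫ x, G s (heatLaw (s - t) m) x ∂(heatLaw (s - t) m')) s ∂(timeMeasure t₁) := by
  have := hm'.1
  have h_int : Integrable (fun q : Ed d × ℝ × Ed d => duhamelKernel G t m q.1 q.2)
      (m'.prod ((timeMeasure t₁).prod (gaussMeasure d 1))) := by
    have hb : Integrable (fun q : Ed d × ℝ × Ed d =>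
        (1 + ‖q.1‖ ^ 2) * (c * (2 + 2 * t₁ * ‖q.2.2‖ ^ 2)))
        (m'.prod ((timeMeasure t₁).prod (gaussMeasure d 1))) :=
      ((integrable_const (1 : ℝ)).add (memP_two_iff.1 hm').2).mul_prod
        (integrable_duhamel_bound c t₁)
    refine hb.mono' (aestronglyMeasurable_duhamelKernel hG hm t continuous_fst continuous_snd _) ?_
    filter_upwards [Measure.quasiMeasurePreserving_snd.ae (ae_norm_duhamelKernel_le ht₁ hGb)]
      with q hq
    refine (hq t ht m hm q.1).trans_eq ?_
    ring
  unfold duhamel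
  rw [integral_integral_swap h_int, integral_prod _ h_int.integral_prod_right]
  refine integral_congr_ae (Eventually.of_forall fun s => ?_)
  rcases lt_or_ge t s with h | h
  · have hP := memP_heatLaw (s - t) hm
    have hcs := hG.continuous s hP
    have hi : Integrable (fun q : Ed d × Ed d => G s (heatLaw (s - t) m) (q.1 + √(s - t) • q.2))
        (m'.prod (gaussMeasure d 1)) := by
      have h1 := (memP_heatLaw (s - t) hm').integrable_of_le hcs (hGb s _ hP)
      exact (integrable_map_measure (f := fun q : Ed d × Ed d => q.1 + √(s - t) • q.2)
        (g := G s (heatLaw (s - t) m)) hcs.aestronglyMeasurable (by fun_prop)).1 h1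
    simp only [indicator_of_mem (mem_Ioi.2 h)]
    rw [integral_heatLaw _ _ hcs, integral_prod_symm _ hi]
    simp only [duhamelKernel_of_lt G m _ (p := (s, _)) h]
  · simp only [indicator_of_notMem (notMem_Ioi.2 h), duhamelKernel_of_le G m _ (p := (s, _)) h,
      integral_zero]

theorem fderiv_duhamelKernel {G : ℝ → Measure (Ed d) → Ed d → E} (t : ℝ) (m : Measure (Ed d))
    (p : ℝ × Ed d) :
    (fderiv ℝ fun x => duhamelKernel G t m x p) =
      fun x => duhamelKernel (fun s μ => fderiv ℝ (G s μ)) t m x p := by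
  funext x
  rcases lt_or_ge t p.1 with h | h
  · rw [duhamelKernel_of_lt _ m x h]
    simp only [duhamelKernel_of_lt G m _ h]
    exact fderiv_comp_add_right _
  · rw [duhamelKernel_of_le _ m x h]
    simp only [duhamelKernel_of_le G m _ h]
    exact fderiv_const_apply _

theorem quadC2_duhamel {t₁ c : ℝ} (ht₁ : 0 ≤ t₁) {G : ℝ → Measure (Ed d) → Ed d → ℝ}
    (hG : ∀ s μ, MemP d 2 μ → QuadC2 c (G s μ)) (h0 : SeqCont t₁ G)
    (h1 : SeqCont t₁ fun s μ => fderiv ℝ (G s μ))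
    (h2 : SeqCont t₁ fun s μ => fderiv ℝ (fderiv ℝ (G s μ))) {t : ℝ} (ht : 0 ≤ t)
    {m : Measure (Ed d)} (hm : MemP d 2 m) :
    QuadC2 (∫ p : ℝ × Ed d, c * (2 + 2 * t₁ * ‖p.2‖ ^ 2)
        ∂((timeMeasure t₁).prod (gaussMeasure d 1))) (duhamel t₁ G t m) ∧
      fderiv ℝ (duhamel t₁ G t m) = duhamel t₁ (fun s μ => fderiv ℝ (G s μ)) t m ∧
      fderiv ℝ (fderiv ℝ (duhamel t₁ G t m)) =
        duhamel t₁ (fun s μ => fderiv ℝ (fderiv ℝ (G s μ))) t m := by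
  have b0 : QuadBdd c G := fun s μ hμ x => (hG s μ hμ).bound x
  have b1 : QuadBdd c fun s μ => fderiv ℝ (G s μ) := fun s μ hμ x => (hG s μ hμ).bound_fderiv x
  have b2 : QuadBdd c fun s μ => fderiv ℝ (fderiv ℝ (G s μ)) := fun s μ hμ x => by
    rw [norm_fderiv_fderiv]
    exact (hG s μ hμ).bound_iteratedFDeriv x
  have key := quadC2_integral (k := fun p x => duhamelKernel G t m x p)
    (integrable_duhamel_bound c t₁) (fun p => ?_) ?_ ?_ ?_
    (fun x => aestronglyMeasurable_duhamelKernel h0 hm t continuous_const continuous_id _)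
    (fun x => ?_) (fun x => ?_)
  · simp only [fderiv_duhamelKernel] at key
    exact key
  · rcases lt_or_ge t p.1 with h | h
    · simp only [duhamelKernel_of_lt G m _ h]
      exact (hG p.1 _ (memP_heatLaw _ hm)).smooth.comp (by fun_prop)
    · simp only [duhamelKernel_of_le G m _ h]
      exact contDiff_const
  · filter_upwards [ae_norm_duhamelKernel_le ht₁ b0] with p hp x
    exact hp t ht m hm x
  · filter_upwards [ae_norm_duhamelKernel_le ht₁ b1] with p hp x
    rw [fderiv_duhamelKernel]
    exact hp t ht m hm x
  · filter_upwards [ae_norm_duhamelKernel_le ht₁ b2] with p hp x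
    simp only [fderiv_duhamelKernel]
    exact hp t ht m hm x
  · simp only [fderiv_duhamelKernel]
    exact aestronglyMeasurable_duhamelKernel h1 hm t continuous_const continuous_id _
  · simp only [fderiv_duhamelKernel]
    exact aestronglyMeasurable_duhamelKernel h2 hm t continuous_const continuous_id _

end Duhamel

section Source

variable {d : ℕ}

theorem exists_delta_of_seq {k : ℕ} (hk : k ≠ 0) {S : Set ℝ} {P : ℝ → Measure (Ed d) → Ed d → Prop}
    {t : ℝ} {m : Measure (Ed d)} {x : Ed d} (hm : MemP d 2 m)
    (h : ∀ (tn : ℕ → ℝ) (mn : ℕ → Measure (Ed d)) (xn : ℕ → Ed d), (∀ n, tn n ∈ S) →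
      Tendsto tn atTop (𝓝 t) → (∀ n, MemP d 2 (mn n)) → WConv d k mn m →
      Tendsto xn atTop (𝓝 x) → ∀ᶠ n in atTop, P (tn n) (mn n) (xn n)) :
    ∃ η > (0 : ℝ), ∀ t' ∈ S, ∀ m' : Measure (Ed d), MemP d 2 m' → ∀ x' : Ed d,
      |t' - t| < η → wdist d k m m' < η → ‖x' - x‖ < η → P t' m' x' := by
  by_contra! H
  choose tn htn mn hmn xn h1 h2 h3 hP using fun n : ℕ => H (1 / ((n : ℝ) + 1)) (by positivity)
  have h0 : Tendsto (fun n : ℕ => 1 / ((n : ℝ) + 1)) atTop (𝓝 0) :=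
    tendsto_one_div_add_atTop_nhds_zero_nat
  have ht : Tendsto tn atTop (𝓝 t) := tendsto_iff_dist_tendsto_zero.2
    (squeeze_zero (fun _ => dist_nonneg) (fun n => (Real.dist_eq _ _).trans_le (h1 n).le) h0)
  have hx : Tendsto xn atTop (𝓝 x) := tendsto_iff_dist_tendsto_zero.2
    (squeeze_zero (fun _ => dist_nonneg) (fun n => (dist_eq_norm _ _).trans_le (h3 n).le) h0)
  have hw : WConv d k mn m := WConv.of_tendsto_wdist hk hm.1 (fun n => (hmn n).1)
    (squeeze_zero (fun _ => wdist_nonneg _ _ _) (fun n => (h2 n).le) h0)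
  obtain ⟨n, hn⟩ := (h tn mn xn htn ht hmn hw hx).exists
  exact hP n hn

/-- The running and terminal data of the equation, merged into a single family `u s`: the source
term `F₀ s` for `s < t₁` and the terminal condition for `s = t₁`. -/
structure Source (d : ℕ) (t₁ c : ℝ) (F₀ u : ℝ → Measure (Ed d) → ℝ)
    (du : ℝ → Measure (Ed d) → Ed d → ℝ) : Prop where
  nonneg : 0 ≤ t₁
  reg : ∀ s, RegFun c (u s) (du s)
  seqCont : SeqCont t₁ fun s μ _ => u s μ
  seqCont_deriv : SeqCont t₁ du
  seqCont_fderiv : SeqCont t₁ fun s μ => fderiv ℝ (du s μ)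
  seqCont_fderiv_fderiv : SeqCont t₁ fun s μ => fderiv ℝ (fderiv ℝ (du s μ))
  eq_of_lt : ∀ s < t₁, u s = F₀ s
  tendsto_source : ∀ (sn : ℕ → ℝ) (s : ℝ) (μn : ℕ → Measure (Ed d)) (μ : Measure (Ed d)),
    Tendsto sn atTop (𝓝 s) → (∀ n, MemP d 2 (μn n)) → MemP d 2 μ → WConv d 1 μn μ →
    Tendsto (fun n => F₀ (sn n) (μn n)) atTop (𝓝 (F₀ s μ))
  tendsto_terminal : ∀ (μn : ℕ → Measure (Ed d)) (μ : Measure (Ed d)),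
    (∀ n, MemP d 2 (μn n)) → MemP d 2 μ → WConv d 1 μn μ →
    Tendsto (fun n => u t₁ (μn n)) atTop (𝓝 (u t₁ μ))
  bdd : ∀ s μ, MemP d 2 μ → |F₀ s μ| ≤ c

/-- The candidate solution. -/
def duhamelSol (t₁ : ℝ) (F₀ u : ℝ → Measure (Ed d) → ℝ) (t : ℝ) (m : Measure (Ed d)) : ℝ :=
  u t₁ (heatLaw (t₁ - t) m) +
    ∫ s in Ioo 0 t₁, (Ioi t).indicator (fun s => F₀ s (heatLaw (s - t) m)) s

variable {t₁ c : ℝ} {F₀ u : ℝ → Measure (Ed d) → ℝ} {du : ℝ → Measure (Ed d) → Ed d → ℝ}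

theorem duhamelSol_eq_intervalIntegral {t : ℝ} (ht : t ∈ Icc 0 t₁) (m : Measure (Ed d)) :
    duhamelSol t₁ F₀ u t m =
      u t₁ (heatLaw (t₁ - t) m) + ∫ s in t..t₁, F₀ s (heatLaw (s - t) m) := by
  have : Ioo 0 t₁ ∩ Ioi t = Ioo t t₁ := by
    ext s
    simp only [mem_inter_iff, mem_Ioo, mem_Ioi]
    have := ht.1
    constructor
    · rintro ⟨⟨_, h⟩, h'⟩
      exact ⟨h', h⟩
    · rintro ⟨h, h'⟩
      exact ⟨⟨by linarith, h'⟩, h⟩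
  rw [duhamelSol, setIntegral_indicator measurableSet_Ioi, this,
    intervalIntegral.integral_of_le ht.2, integral_Ioc_eq_integral_Ioo]

theorem duhamelSol_terminal (m : Measure (Ed d)) [IsProbabilityMeasure m] (h : 0 ≤ t₁) :
    duhamelSol t₁ F₀ u t₁ m = u t₁ m := by
  rw [duhamelSol_eq_intervalIntegral ⟨h, le_rfl⟩, sub_self, heatLaw_of_nonpos le_rfl,
    intervalIntegral.integral_same, add_zero]

theorem ContinuousLinearMap.map_duhamel {E : Type*} [NormedAddCommGroup E] [NormedSpace ℝ E]
    [CompleteSpace E] (L : E →L[ℝ] ℝ) (ht₁ : 0 ≤ t₁) {G : ℝ → Measure (Ed d) → Ed d → E}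
    (hG : SeqCont t₁ G) (hGb : QuadBdd c G) {t : ℝ} (ht : 0 ≤ t) {m : Measure (Ed d)}
    (hm : MemP d 2 m) (x : Ed d) :
    L (duhamel t₁ G t m x) = duhamel t₁ (fun s μ y => L (G s μ y)) t m x := by
  have hi : Integrable (duhamelKernel G t m x) ((timeMeasure t₁).prod (gaussMeasure d 1)) := by
    refine ((integrable_duhamel_bound c t₁).mul_const (1 + ‖x‖ ^ 2)).mono'
      (aestronglyMeasurable_duhamelKernel hG hm t continuous_const continuous_id _) ?_
    filter_upwards [ae_norm_duhamelKernel_le ht₁ hGb] with p hp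
    exact hp t ht m hm x
  rw [duhamel, duhamel, ← L.integral_comp_comm hi]
  refine integral_congr_ae (Eventually.of_forall fun p => ?_)
  beta_reduce
  rcases lt_or_ge t p.1 with h | h
  · rw [duhamelKernel_of_lt _ m x h, duhamelKernel_of_lt _ m x h]
  · rw [duhamelKernel_of_le _ m x h, duhamelKernel_of_le _ m x h, map_zero]

namespace Source

variable (hS : Source d t₁ c F₀ u du)

theorem tendsto_source_heatLaw {s : ℝ} {tn : ℕ → ℝ} {t : ℝ} (htn : Tendsto tn atTop (𝓝 t))
    {mn : ℕ → Measure (Ed d)} {m : Measure (Ed d)} (hm : MemP d 2 m) (hmn : ∀ n, MemP d 2 (mn n))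
    (hw : WConv d 1 mn m) (hS : Source d t₁ c F₀ u du) :
    Tendsto (fun n => F₀ s (heatLaw (s - tn n) (mn n))) atTop (𝓝 (F₀ s (heatLaw (s - t) m))) :=
  hS.tendsto_source _ _ _ _ tendsto_const_nhds (fun n => memP_heatLaw _ (hmn n))
    (memP_heatLaw _ hm) (WConv.heatLaw (Or.inl rfl) hw hm hmn (htn.const_sub s))

include hS

theorem continuous_source_heatLaw (t : ℝ) {m : Measure (Ed d)} (hm : MemP d 2 m) :
    Continuous fun s => F₀ s (heatLaw (s - t) m) := by
  have := hm.1
  refine continuous_iff_seqContinuous.2 fun sn s hs => ?_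
  exact hS.tendsto_source _ _ _ _ hs (fun n => memP_heatLaw _ hm) (memP_heatLaw _ hm)
    (WConv.heatLaw (Or.inl rfl) (wconv_const one_ne_zero m) hm (fun _ => hm) (hs.sub_const t))

theorem continuous_source {m : Measure (Ed d)} (hm : MemP d 2 m) : Continuous fun s => F₀ s m := by
  have := hm.1
  refine continuous_iff_seqContinuous.2 fun sn s hs => ?_
  exact hS.tendsto_source _ _ _ _ hs (fun n => hm) hm (wconv_const one_ne_zero m)

theorem const_nonneg {m : Measure (Ed d)} (hm : MemP d 2 m) : 0 ≤ c :=
  (abs_nonneg _).trans (hS.bdd 0 m hm)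

theorem integrable_timeMeasure (t : ℝ) {m : Measure (Ed d)} (hm : MemP d 2 m) :
    Integrable (fun s => u s (heatLaw (s - t) m)) (timeMeasure t₁) := by
  have hmeas : ∀ P : Measure ℝ, AEStronglyMeasurable (fun s => u s (heatLaw (s - t) m)) P :=
    fun P => hS.seqCont.aestronglyMeasurable hm t continuous_id (continuous_const (y := 0)) P
  refine Integrable.add_measure ?_ ?_
  · refine Integrable.mono' (integrable_const c) (hmeas _) ?_
    filter_upwards [ae_restrict_mem measurableSet_Ioo] with s hs
    rw [hS.eq_of_lt s hs.2]
    exact hS.bdd _ _ (memP_heatLaw _ hm)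
  · exact integrable_dirac enorm_lt_top

theorem duhamelSol_eq {t : ℝ} (ht : t < t₁) {m : Measure (Ed d)} (hm : MemP d 2 m) :
    duhamelSol t₁ F₀ u t m =
      ∫ s, (Ioi t).indicator (fun s => u s (heatLaw (s - t) m)) s ∂(timeMeasure t₁) := by
  have hi := (hS.integrable_timeMeasure t hm).indicator (measurableSet_Ioi (a := t))
  rw [timeMeasure] at hi ⊢
  rw [integral_add_measure hi.left_of_add_measure hi.right_of_add_measure, integral_dirac,
    indicator_of_mem (mem_Ioi.2 ht), duhamelSol, add_comm]
  congr 1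
  refine setIntegral_congr_fun measurableSet_Ioo fun s hs => ?_
  simp only [indicator, hS.eq_of_lt s hs.2]

theorem duhamelSol_eq_sub {t : ℝ} (ht : t ∈ Icc 0 t₁) {m : Measure (Ed d)} (hm : MemP d 2 m) :
    duhamelSol t₁ F₀ u t m =
      ∫ s, u s (heatLaw (s - t) m) ∂(timeMeasure t₁) - ∫ s in (0)..t, F₀ s m := by
  have := hm.1
  have hi := hS.integrable_timeMeasure t hm
  have hc := hS.continuous_source_heatLaw t hm
  have h1 : ∫ s in Ioo 0 t₁, u s (heatLaw (s - t) m) =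
      ∫ s in (0)..t₁, F₀ s (heatLaw (s - t) m) := by
    rw [intervalIntegral.integral_of_le hS.nonneg, integral_Ioc_eq_integral_Ioo]
    refine setIntegral_congr_fun measurableSet_Ioo fun s hs => ?_
    simp only [hS.eq_of_lt s hs.2]
  have h2 : ∫ s in (0)..t, F₀ s (heatLaw (s - t) m) = ∫ s in (0)..t, F₀ s m := by
    refine intervalIntegral.integral_congr fun s hs => ?_
    rw [uIcc_of_le ht.1] at hs
    simp only [heatLaw_of_nonpos (sub_nonpos.2 hs.2)]
  have h3 := intervalIntegral.integral_add_adjacent_intervals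
    (hc.intervalIntegrable 0 t) (hc.intervalIntegrable t t₁) (μ := volume)
  rw [timeMeasure] at hi ⊢
  rw [integral_add_measure hi.left_of_add_measure hi.right_of_add_measure, integral_dirac,
    duhamelSol_eq_intervalIntegral ht, h1]
  linarith

theorem tendsto_duhamelSol {tn : ℕ → ℝ} {t : ℝ} (htn : Tendsto tn atTop (𝓝 t))
    {mn : ℕ → Measure (Ed d)} {m : Measure (Ed d)} (hm : MemP d 2 m) (hmn : ∀ n, MemP d 2 (mn n))
    (hw : WConv d 1 mn m) :
    Tendsto (fun n => duhamelSol t₁ F₀ u (tn n) (mn n)) atTop (𝓝 (duhamelSol t₁ F₀ u t m)) := by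
  refine Tendsto.add ?_ ?_
  · exact hS.tendsto_terminal _ _ (fun n => memP_heatLaw _ (hmn n)) (memP_heatLaw _ hm)
      (WConv.heatLaw (Or.inl rfl) hw hm hmn (htn.const_sub t₁))
  refine tendsto_integral_of_dominated_convergence (fun _ => c) (fun n => ?_) (integrable_const c)
    (fun n => ?_) ?_
  · exact (hS.continuous_source_heatLaw _ (hmn n)).aestronglyMeasurable.indicator measurableSet_Ioi
  · refine Eventually.of_forall fun s => ?_
    refine (norm_indicator_le_norm_self _ _).trans ?_
    exact hS.bdd _ _ (memP_heatLaw _ (hmn n))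
  · filter_upwards [ae_restrict_of_ae (Measure.ae_ne volume t)] with s hs
    rcases lt_or_gt_of_ne hs with h | h
    · rw [indicator_of_notMem (notMem_Ioi.2 h.le)]
      refine tendsto_const_nhds.congr' ?_
      filter_upwards [htn.eventually (lt_mem_nhds h)] with n hn
      rw [indicator_of_notMem (notMem_Ioi.2 hn.le)]
    · rw [indicator_of_mem (mem_Ioi.2 h)]
      refine (tendsto_source_heatLaw htn hm hmn hw hS).congr' ?_
      filter_upwards [htn.eventually (gt_mem_nhds h)] with n hn
      rw [indicator_of_mem (mem_Ioi.2 hn)]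

theorem quadBdd : QuadBdd c du := fun s μ hμ x => ((hS.reg s).quad μ hμ).bound x

theorem quadC2_duhamel {t : ℝ} (ht : 0 ≤ t) {m : Measure (Ed d)} (hm : MemP d 2 m) :
    QuadC2 (∫ p : ℝ × Ed d, c * (2 + 2 * t₁ * ‖p.2‖ ^ 2)
        ∂((timeMeasure t₁).prod (gaussMeasure d 1))) (duhamel t₁ du t m) ∧
      fderiv ℝ (duhamel t₁ du t m) = duhamel t₁ (fun s μ => fderiv ℝ (du s μ)) t m ∧
      fderiv ℝ (fderiv ℝ (duhamel t₁ du t m)) =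
        duhamel t₁ (fun s μ => fderiv ℝ (fderiv ℝ (du s μ))) t m :=
  _root_.quadC2_duhamel hS.nonneg (fun s μ hμ => (hS.reg s).quad μ hμ) hS.seqCont_deriv
    hS.seqCont_fderiv hS.seqCont_fderiv_fderiv ht hm

theorem seqCont_lapl : SeqCont t₁ fun s μ => lapl d (du s μ) :=
  fun sn s μn μ xn x h hs hμn hμ hw hx =>
    tendsto_lapl (hS.seqCont_fderiv_fderiv sn s μn μ xn x h hs hμn hμ hw hx)

theorem quadBdd_lapl : QuadBdd (d * c) fun s μ => lapl d (du s μ) :=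
  fun s μ hμ x => ((hS.reg s).quad μ hμ).abs_lapl_le x

theorem quadBdd_fderiv : QuadBdd c fun s μ => fderiv ℝ (du s μ) :=
  fun s μ hμ x => ((hS.reg s).quad μ hμ).bound_fderiv x

theorem quadBdd_fderiv_fderiv : QuadBdd c fun s μ => fderiv ℝ (fderiv ℝ (du s μ)) :=
  fun s μ hμ x => by
    rw [norm_fderiv_fderiv]
    exact ((hS.reg s).quad μ hμ).bound_iteratedFDeriv x

theorem lapl_duhamel {t : ℝ} (ht : 0 ≤ t) {m : Measure (Ed d)} (hm : MemP d 2 m) :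
    lapl d (duhamel t₁ du t m) = duhamel t₁ (fun s μ => lapl d (du s μ)) t m := by
  funext x
  let L : (Ed d →L[ℝ] Ed d →L[ℝ] ℝ) →L[ℝ] ℝ := ∑ i : Fin d,
    (ContinuousLinearMap.apply ℝ ℝ (EuclideanSpace.single i (1 : ℝ))).comp
      (ContinuousLinearMap.apply ℝ (Ed d →L[ℝ] ℝ) (EuclideanSpace.single i (1 : ℝ)))
  have hL : ∀ (f : Ed d → ℝ) (y : Ed d), lapl d f y = L (fderiv ℝ (fderiv ℝ f) y) := fun f y => by
    simp [lapl_eq_sum_fderiv, L]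
  rw [hL, (hS.quadC2_duhamel ht hm).2.2, ContinuousLinearMap.map_duhamel L hS.nonneg
    hS.seqCont_fderiv_fderiv hS.quadBdd_fderiv_fderiv ht hm]
  simp only [← hL]

theorem normalized {t : ℝ} (ht : 0 ≤ t) {m : Measure (Ed d)} (hm : MemP d 2 m) :
    ∫ x, duhamel t₁ du t m x ∂m = 0 := by
  rw [integral_duhamel hS.nonneg hS.seqCont_deriv hS.quadBdd ht hm hm]
  refine integral_eq_zero_of_ae (Eventually.of_forall fun s => ?_)
  exact indicator_apply_eq_zero.2 fun _ => (hS.reg s).normalized _ (memP_heatLaw _ hm)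

theorem measDeriv {t : ℝ} (ht : t ∈ Ico 0 t₁) {m m' : Measure (Ed d)} (hm : MemP d 2 m)
    (hm' : MemP d 2 m') :
    Tendsto (fun r : ℝ => (duhamelSol t₁ F₀ u t (mix r m m') - duhamelSol t₁ F₀ u t m) / r)
      (𝓝[>] 0) (𝓝 (∫ x, duhamel t₁ du t m x ∂m')) := by
  have := hm.1
  have := hm'.1
  have hc := hS.const_nonneg hm
  rw [integral_duhamel hS.nonneg hS.seqCont_deriv hS.quadBdd ht.1 hm hm']
  have hr01 : ∀ᶠ r : ℝ in 𝓝[>] 0, r ∈ Ioo (0 : ℝ) 1 := Ioo_mem_nhdsGT one_pos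
  let B : Measure (Ed d) → ℝ := fun μ =>
    2 * ∫ x, ‖x‖ ^ 2 ∂μ + 2 * t₁ * ∫ z : Ed d, ‖z‖ ^ 2 ∂(gaussMeasure d 1)
  have key : Tendsto (fun r : ℝ => ∫ s, (Ioi t).indicator (fun s =>
      (u s (mix r (heatLaw (s - t) m) (heatLaw (s - t) m')) - u s (heatLaw (s - t) m)) / r) s
        ∂(timeMeasure t₁)) (𝓝[>] 0) (𝓝 (∫ s, (Ioi t).indicator
      (fun s => ∫ x, du s (heatLaw (s - t) m) x ∂(heatLaw (s - t) m')) s ∂(timeMeasure t₁))) := by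
    refine tendsto_integral_filter_of_dominated_convergence
      (fun _ => c * (1 + B m') + c * (1 + B m)) ?_ ?_ (integrable_const _) ?_
    · filter_upwards [hr01] with r hr
      simp only [← heatLaw_mix]
      refine AEStronglyMeasurable.indicator ?_ measurableSet_Ioi
      exact (((hS.integrable_timeMeasure t (memP_mix hr.1.le hr.2.le hm hm')).sub
        (hS.integrable_timeMeasure t hm)).div_const r).aestronglyMeasurable
    · filter_upwards [hr01] with r hr
      filter_upwards [ae_timeMeasure_mem hS.nonneg] with s hs
      refine (norm_indicator_le_norm_self _ _).trans ?_
      rw [norm_div, div_le_iff₀ (norm_pos_iff.2 hr.1.ne'), Real.norm_eq_abs, Real.norm_eq_abs,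
        abs_of_pos hr.1]
      refine ((hS.reg s).abs_mix_sub_le (memP_heatLaw (s - t) hm) (memP_heatLaw (s - t) hm')
        hr.1.le hr.2.le).trans ?_
      have hst : s - t ≤ t₁ := by linarith [hs.2, ht.1]
      have h1 := integral_norm_sq_heatLaw_le hst hS.nonneg hm
      have h2 := integral_norm_sq_heatLaw_le hst hS.nonneg hm'
      rw [mul_comm]
      have := hr.1.le
      gcongr
    · refine Eventually.of_forall fun s => ?_
      by_cases hs : s ∈ Ioi t
      · simp only [indicator_of_mem hs]
        exact (hS.reg s).measDeriv _ _ (memP_heatLaw _ hm) (memP_heatLaw _ hm')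
      · simp only [indicator_of_notMem hs]
        exact tendsto_const_nhds
  refine key.congr' ?_
  filter_upwards [hr01] with r hr
  have hmm := memP_mix hr.1.le hr.2.le hm hm'
  rw [hS.duhamelSol_eq ht.2 hmm, hS.duhamelSol_eq ht.2 hm, ← integral_sub
    ((hS.integrable_timeMeasure t hmm).indicator measurableSet_Ioi)
    ((hS.integrable_timeMeasure t hm).indicator measurableSet_Ioi), ← integral_div]
  refine integral_congr_ae (Eventually.of_forall fun s => ?_)
  by_cases hs : s ∈ Ioi t
  · simp only [indicator_of_mem hs, heatLaw_mix]
  · simp only [indicator_of_notMem hs, sub_self, zero_div]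

omit hS in
theorem _root_.RegFun.hasDerivAt_heatLaw {v : Measure (Ed d) → ℝ} {δv : Measure (Ed d) → Ed d → ℝ}
    (hv : RegFun c v δv)
    (hlapl : ∀ (μn : ℕ → Measure (Ed d)) (μ : Measure (Ed d)) (xn : ℕ → Ed d) (x : Ed d),
      (∀ n, MemP d 2 (μn n)) → MemP d 2 μ → WConv d 2 μn μ → Tendsto xn atTop (𝓝 x) →
      Tendsto (fun n => lapl d (δv (μn n)) (xn n)) atTop (𝓝 (lapl d (δv μ) x)))
    {m : Measure (Ed d)} (hm : MemP d 2 m) {τ : ℝ} (hτ : 0 < τ) :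
    HasDerivAt (fun τ => v (heatLaw τ m))
      (1 / 2 * ∫ x, lapl d (δv (heatLaw τ m)) x ∂(heatLaw τ m)) τ := by
  rw [hasDerivAt_iff_tendsto_slope]
  refine tendsto_of_seq_tendsto fun τn hτn => ?_
  have h1 : Tendsto τn atTop (𝓝 τ) := hτn.mono_right nhdsWithin_le_nhds
  have h2 : ∀ᶠ n in atTop, τn n ≠ τ := hτn.eventually (eventually_mem_nhdsWithin)
  obtain ⟨N, hN⟩ := eventually_atTop.1 (h2.and (h1.eventually (lt_mem_nhds hτ)))
  rw [← tendsto_add_atTop_iff_nat N]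
  have hP := memP_heatLaw τ hm
  have := tendsto_heatLaw_slope (fun _ => hv) hm hτ.le (τn := fun n => τn (n + N))
    (fun n => (hN _ (Nat.le_add_left _ _)).2.le) (fun n => (hN _ (Nat.le_add_left _ _)).1)
    ((tendsto_add_atTop_iff_nat N).2 h1) ((hv.quad _ hP).continuous_lapl) (fun μ hμ hw x =>
      tendsto_prod_nhds_of_seq (g := fun n y => lapl d (δv (μ n)) y) fun φ xn hφ hx =>
        hlapl _ _ _ _ (fun n => hμ _) hP (hw.comp_tendsto hφ) hx)
  refine this.congr fun n => ?_
  simp only [Function.comp_apply, slope_def_field]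

theorem hasDerivAt_terminal_integral {t : ℝ} (ht : t ∈ Ico 0 t₁) {m : Measure (Ed d)}
    (hm : MemP d 2 m) :
    HasDerivAt (fun t => ∫ s, u s (heatLaw (s - t) m) ∂(timeMeasure t₁))
      (-(1 / 2 * ∫ x, lapl d (duhamel t₁ du t m) x ∂m)) t := by
  have := hm.1
  have hc := hS.const_nonneg hm
  have hmeas : ∀ P : Measure ℝ, AEStronglyMeasurable (fun s =>
      ∫ x, lapl d (du s (heatLaw (s - t) m)) x ∂(heatLaw (s - t) m)) P := by
    intro P
    have hG : SeqCont t₁ fun (s : ℝ) μ (_ : Ed d) => ∫ x, lapl d (du s μ) x ∂μ := by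
      intro sn s μn μ xn x h hs hμn hμ hw hx
      refine WConv.tendsto_integral hμ hμn hw (g := fun n => lapl d (du (sn n) (μn n)))
        (g₀ := lapl d (du s μ)) (c := d * c)
        (fun n => (((hS.reg _).quad _ (hμn n)).continuous_lapl))
        (((hS.reg _).quad _ hμ).continuous_lapl) (fun n => hS.quadBdd_lapl _ _ (hμn n))
        fun x => tendsto_prod_nhds_of_seq
          (g := fun n y => lapl d (du (sn n) (μn n)) y) fun φ xn hφ hx => ?_
      exact hS.seqCont_lapl _ _ _ _ _ _ (fun n => h (φ n)) (hs.comp hφ) (fun n => hμn _) hμ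
        (hw.comp_tendsto hφ) hx
    exact hG.aestronglyMeasurable hm t continuous_id (continuous_const (y := 0)) P
  rw [hS.lapl_duhamel ht.1 hm, integral_duhamel hS.nonneg hS.seqCont_lapl hS.quadBdd_lapl ht.1 hm hm,
    ← neg_mul, ← integral_const_mul]
  set K : ℝ := 1 / 2 * (d * c * (1 + (2 * ∫ x, ‖x‖ ^ 2 ∂m +
    2 * (t₁ + 1) * ∫ z : Ed d, ‖z‖ ^ 2 ∂(gaussMeasure d 1)))) with hK
  refine (hasDerivAt_integral_of_dominated_loc_of_lip (Metric.ball_mem_nhds t one_pos)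
    (F := fun t s => u s (heatLaw (s - t) m)) (bound := fun _ => K)
    (Eventually.of_forall fun a => (hS.integrable_timeMeasure a hm).aestronglyMeasurable)
    (hS.integrable_timeMeasure t hm) ?_ ?_ (integrable_const K) ?_).2
  · exact ((hmeas _).indicator measurableSet_Ioi).const_mul _
  · filter_upwards [ae_timeMeasure_mem hS.nonneg] with s hs
    refine LipschitzOnWith.of_dist_le_mul fun a ha b hb => ?_
    have hle : ∀ a ∈ Metric.ball t 1, max (s - a) 0 ≤ t₁ + 1 := fun a ha => by
      rw [Metric.mem_ball, Real.dist_eq, abs_lt] at ha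
      refine max_le ?_ ?_ <;> linarith [hs.1, hs.2, ht.1, ha.1, ha.2]
    rw [Real.dist_eq, ← heatLaw_max_zero (s - a), ← heatLaw_max_zero (s - b)]
    refine ((hS.reg s).abs_heatLaw_sub_le hm (le_max_right _ _) (hle b hb) (le_max_right _ _)
      (hle a ha)).trans ?_
    rw [← hK, mul_comm, Real.coe_nnabs]
    refine mul_le_mul (le_abs_self _) ?_ (abs_nonneg _) (abs_nonneg _)
    refine (abs_max_sub_max_le_abs _ _ _).trans_eq ?_
    rw [Real.dist_eq, ← abs_neg]
    congr 1
    ring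
  · filter_upwards [ae_timeMeasure_ne ht.2] with s hs
    rcases lt_or_gt_of_ne hs with h | h
    · rw [indicator_of_notMem (notMem_Ioi.2 h.le), mul_zero]
      refine (hasDerivAt_const t (u s m)).congr_of_eventuallyEq ?_
      filter_upwards [lt_mem_nhds h] with a ha
      rw [heatLaw_of_nonpos (sub_nonpos.2 ha.le)]
    · rw [indicator_of_mem (mem_Ioi.2 h)]
      have := ((hS.reg s).hasDerivAt_heatLaw (fun μn μ xn x hμn hμ hw hx =>
        hS.seqCont_lapl _ _ _ _ _ _ (fun _ => Iff.rfl) tendsto_const_nhds hμn hμ hw hx) hm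
        (sub_pos.2 h)).comp t ((hasDerivAt_id t).const_sub s)
      refine this.congr_deriv ?_
      ring

theorem timeDeriv {t : ℝ} (ht : t ∈ Ico 0 t₁) {m : Measure (Ed d)} (hm : MemP d 2 m) :
    HasDerivWithinAt (fun s => duhamelSol t₁ F₀ u s m)
      (-(1 / 2 * ∫ x, lapl d (duhamel t₁ du t m) x ∂m) - F₀ t m) (Icc 0 t₁) t := by
  have hF := hS.continuous_source hm
  have h := (hS.hasDerivAt_terminal_integral ht hm).sub
    (intervalIntegral.integral_hasDerivAt_right (hF.intervalIntegrable 0 t)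
      hF.aestronglyMeasurable.stronglyMeasurableAtFilter hF.continuousAt)
  refine h.hasDerivWithinAt.congr (fun a ha => hS.duhamelSol_eq_sub ha hm)
    (hS.duhamelSol_eq_sub ⟨ht.1, ht.2.le⟩ hm)

theorem tendsto_fderiv_fderiv {tn : ℕ → ℝ} {t : ℝ} (ht : t ∈ Ico 0 t₁) (htn0 : ∀ n, 0 ≤ tn n)
    (htn : Tendsto tn atTop (𝓝 t)) {mn : ℕ → Measure (Ed d)} {m : Measure (Ed d)}
    (hm : MemP d 2 m) (hmn : ∀ n, MemP d 2 (mn n)) (hw : WConv d 2 mn m) {xn : ℕ → Ed d} {x : Ed d}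
    (hx : Tendsto xn atTop (𝓝 x)) :
    Tendsto (fun n => fderiv ℝ (fderiv ℝ (duhamel t₁ du (tn n) (mn n))) (xn n)) atTop
      (𝓝 (fderiv ℝ (fderiv ℝ (duhamel t₁ du t m)) x)) := by
  simp only [(hS.quadC2_duhamel (htn0 _) (hmn _)).2.2, (hS.quadC2_duhamel ht.1 hm).2.2]
  exact tendsto_duhamel hS.nonneg hS.seqCont_fderiv_fderiv hS.quadBdd_fderiv_fderiv ht.2 htn0 htn
    hm hmn hw hx

theorem tendsto_fderiv {tn : ℕ → ℝ} {t : ℝ} (ht : t ∈ Ico 0 t₁) (htn0 : ∀ n, 0 ≤ tn n)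
    (htn : Tendsto tn atTop (𝓝 t)) {mn : ℕ → Measure (Ed d)} {m : Measure (Ed d)}
    (hm : MemP d 2 m) (hmn : ∀ n, MemP d 2 (mn n)) (hw : WConv d 2 mn m) {xn : ℕ → Ed d} {x : Ed d}
    (hx : Tendsto xn atTop (𝓝 x)) :
    Tendsto (fun n => fderiv ℝ (duhamel t₁ du (tn n) (mn n)) (xn n)) atTop
      (𝓝 (fderiv ℝ (duhamel t₁ du t m) x)) := by
  simp only [(hS.quadC2_duhamel (htn0 _) (hmn _)).2.1, (hS.quadC2_duhamel ht.1 hm).2.1]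
  exact tendsto_duhamel hS.nonneg hS.seqCont_fderiv hS.quadBdd_fderiv ht.2 htn0 htn hm hmn hw hx

theorem tendsto_integral_lapl {tn : ℕ → ℝ} {t : ℝ} (ht : t ∈ Ico 0 t₁) (htn0 : ∀ n, 0 ≤ tn n)
    (htn : Tendsto tn atTop (𝓝 t)) {mn : ℕ → Measure (Ed d)} {m : Measure (Ed d)}
    (hm : MemP d 2 m) (hmn : ∀ n, MemP d 2 (mn n)) (hw : WConv d 2 mn m) :
    Tendsto (fun n => ∫ x, lapl d (duhamel t₁ du (tn n) (mn n)) x ∂(mn n)) atTop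
      (𝓝 (∫ x, lapl d (duhamel t₁ du t m) x ∂m)) := by
  refine WConv.tendsto_integral hm hmn hw (g := fun n => lapl d (duhamel t₁ du (tn n) (mn n)))
    (g₀ := lapl d (duhamel t₁ du t m))
    (fun n => (hS.quadC2_duhamel (htn0 n) (hmn n)).1.continuous_lapl)
    (hS.quadC2_duhamel ht.1 hm).1.continuous_lapl
    (fun n => (hS.quadC2_duhamel (htn0 n) (hmn n)).1.abs_lapl_le)
    fun x => tendsto_prod_nhds_of_seq
      (g := fun n y => lapl d (duhamel t₁ du (tn n) (mn n)) y) fun φ xn hφ hx => ?_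
  exact tendsto_lapl (hS.tendsto_fderiv_fderiv ht (fun n => htn0 _) (htn.comp hφ) hm
    (fun n => hmn _) (hw.comp_tendsto hφ) hx)

end Source

end Source

section Data

variable {d : ℕ} {T : ℝ}

theorem WConv.eventually_wdist_lt {k : ℕ} (hk : k ≠ 0) {mn : ℕ → Measure (Ed d)}
    {m : Measure (Ed d)} (h : WConv d k mn m) {η : ℝ} (hη : 0 < η) :
    ∀ᶠ n in atTop, wdist d k m (mn n) < η :=
  (h.tendsto_wdist hk).eventually_lt_const hη

theorem WConv.eventually_wdist_one_lt {mn : ℕ → Measure (Ed d)}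
    {m : Measure (Ed d)} (h : WConv d 1 mn m) {η : ℝ} (hη : 0 < η) :
    ∀ᶠ n in atTop, wdist d 1 m (mn n) < η := by
  simpa using h.eventually_wdist_lt one_ne_zero hη

theorem WConv.eventually_wdist_two_lt {mn : ℕ → Measure (Ed d)}
    {m : Measure (Ed d)} (h : WConv d 2 mn m) {η : ℝ} (hη : 0 < η) :
    ∀ᶠ n in atTop, wdist d 2 m (mn n) < η := by
  simpa using h.eventually_wdist_lt two_ne_zero hη

theorem Filter.Tendsto.eventually_abs_sub_lt {tn : ℕ → ℝ} {t : ℝ} (h : Tendsto tn atTop (𝓝 t)) {η : ℝ}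
    (hη : 0 < η) : ∀ᶠ n in atTop, |tn n - t| < η := by
  simpa [Real.dist_eq] using h.eventually (Metric.ball_mem_nhds t hη)

theorem Filter.Tendsto.eventually_norm_sub_lt {xn : ℕ → Ed d} {x : Ed d} (h : Tendsto xn atTop (𝓝 x)) {η : ℝ}
    (hη : 0 < η) : ∀ᶠ n in atTop, ‖xn n - x‖ < η := by
  simpa [dist_eq_norm] using h.eventually (Metric.ball_mem_nhds x hη)

/-- Convergence in all the senses of a `C²` function. -/
def ConvC2 (f : ℕ → Ed d → ℝ) (xn : ℕ → Ed d) (g : Ed d → ℝ) (x : Ed d) : Prop :=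
  Tendsto (fun n => f n (xn n)) atTop (𝓝 (g x)) ∧
    Tendsto (fun n => fderiv ℝ (f n) (xn n)) atTop (𝓝 (fderiv ℝ g x)) ∧
    Tendsto (fun n => fderiv ℝ (fderiv ℝ (f n)) (xn n)) atTop (𝓝 (fderiv ℝ (fderiv ℝ g) x))

theorem convC2_of_forall_eventually {f : ℕ → Ed d → ℝ} {xn : ℕ → Ed d} {g : Ed d → ℝ} {x : Ed d}
    (h : ∀ ε > (0 : ℝ), ∀ᶠ n in atTop, |f n (xn n) - g x| < ε ∧
      ‖fderiv ℝ (f n) (xn n) - fderiv ℝ g x‖ < ε ∧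
      ‖iteratedFDeriv ℝ 2 (f n) (xn n) - iteratedFDeriv ℝ 2 g x‖ < ε) : ConvC2 f xn g x := by
  refine ⟨Metric.tendsto_nhds.2 fun ε hε => ?_, Metric.tendsto_nhds.2 fun ε hε => ?_,
    tendsto_iteratedFDeriv_two_iff.1 <| Metric.tendsto_nhds.2 fun ε hε => ?_⟩
  · exact (h ε hε).mono fun n hn => (Real.dist_eq _ _).trans_lt hn.1
  · exact (h ε hε).mono fun n hn => (dist_eq_norm _ _).trans_lt hn.2.1
  · exact (h ε hε).mono fun n hn => (dist_eq_norm _ _).trans_lt hn.2.2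

theorem ContD1.tendsto {U : ℝ → Measure (Ed d) → ℝ} (hU : ContD1 d T U) {sn : ℕ → ℝ} {s : ℝ}
    {μn : ℕ → Measure (Ed d)} {μ : Measure (Ed d)} (hsn : ∀ n, sn n ∈ Icc 0 T) (hs : s ∈ Icc 0 T)
    (h : Tendsto sn atTop (𝓝 s)) (hμn : ∀ n, MemP d 2 (μn n)) (hμ : MemP d 2 μ)
    (hw : WConv d 1 μn μ) : Tendsto (fun n => U (sn n) (μn n)) atTop (𝓝 (U s μ)) := by
  refine Metric.tendsto_nhds.2 fun ε hε => ?_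
  obtain ⟨η, hη, H⟩ := hU s hs μ hμ ε hε
  filter_upwards [Tendsto.eventually_abs_sub_lt h hη, hw.eventually_wdist_one_lt hη] with n h1 h2
  exact H _ (hsn n) _ (hμn n) h1 h2

theorem A1Data.convC2 (FD : A1Data d T) {sn : ℕ → ℝ} {s : ℝ}
    {μn : ℕ → Measure (Ed d)} {μ : Measure (Ed d)} (hsn : ∀ n, sn n ∈ Icc 0 T) (hs : s ∈ Icc 0 T)
    (h : Tendsto sn atTop (𝓝 s)) (hμn : ∀ n, MemP d 2 (μn n)) (hμ : MemP d 2 μ)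
    (hw : WConv d 1 μn μ) {xn : ℕ → Ed d} {x : Ed d} (hx : Tendsto xn atTop (𝓝 x)) :
    ConvC2 (fun n => FD.δF (sn n) (μn n)) xn (FD.δF s μ) x := by
  refine convC2_of_forall_eventually fun ε hε => ?_
  obtain ⟨η, hη, H⟩ := FD.contDeriv s hs μ hμ x ε hε
  filter_upwards [Tendsto.eventually_abs_sub_lt h hη, hw.eventually_wdist_one_lt hη,
    Tendsto.eventually_norm_sub_lt hx hη] with n h1 h2 h3
  exact H _ (hsn n) _ (hμn n) _ h1 h2 h3

theorem A2Data.convC2 (ΨD : A2Data d) {μn : ℕ → Measure (Ed d)} {μ : Measure (Ed d)}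
    (hμn : ∀ n, MemP d 2 (μn n)) (hμ : MemP d 2 μ)
    (hw : WConv d 1 μn μ) {xn : ℕ → Ed d} {x : Ed d} (hx : Tendsto xn atTop (𝓝 x)) :
    ConvC2 (fun n => ΨD.δψ (μn n)) xn (ΨD.δψ μ) x := by
  refine convC2_of_forall_eventually fun ε hε => ?_
  obtain ⟨η, hη, H⟩ := ΨD.contDeriv μ hμ x ε hε
  filter_upwards [hw.eventually_wdist_one_lt hη, Tendsto.eventually_norm_sub_lt hx hη] with n h2 h3
  exact H _ (hμn n) _ h2 h3

theorem A2Data.tendsto (ΨD : A2Data d) {μn : ℕ → Measure (Ed d)} {μ : Measure (Ed d)}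
    (hμn : ∀ n, MemP d 2 (μn n)) (hμ : MemP d 2 μ) (hw : WConv d 1 μn μ) :
    Tendsto (fun n => ΨD.ψ (μn n)) atTop (𝓝 (ΨD.ψ μ)) := by
  refine Metric.tendsto_nhds.2 fun ε hε => ?_
  obtain ⟨η, hη, H⟩ := ΨD.contψ μ hμ ε hε
  filter_upwards [hw.eventually_wdist_one_lt hη] with n h2
  exact H _ (hμn n) h2

/-- The source term, extended to all times by freezing it outside `[0, T]`. -/
def A1Data.extF (FD : A1Data d T) (hT : 0 ≤ T) (s : ℝ) : Measure (Ed d) → ℝ :=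
  FD.F (projIcc 0 T hT s)

theorem A1Data.extF_of_mem (FD : A1Data d T) (hT : 0 ≤ T) {s : ℝ} (hs : s ∈ Icc 0 T) :
    FD.extF hT s = FD.F s := by
  rw [A1Data.extF, projIcc_of_mem hT hs]

/-- The source term before time `t₁` and the terminal condition from time `t₁` on. -/
def mergedData (FD : A1Data d T) (ΨD : A2Data d) (hT : 0 ≤ T) (t₁ s : ℝ) : Measure (Ed d) → ℝ :=
  if s < t₁ then FD.extF hT s else ΨD.ψ

/-- The derivative of `mergedData` with respect to the measure. -/
def mergedDeriv (FD : A1Data d T) (ΨD : A2Data d) (hT : 0 ≤ T) (t₁ s : ℝ) :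
    Measure (Ed d) → Ed d → ℝ :=
  if s < t₁ then FD.δF (projIcc 0 T hT s) else ΨD.δψ

theorem convC2_mergedDeriv (FD : A1Data d T) (ΨD : A2Data d) (hT : 0 ≤ T) {t₁ : ℝ} {sn : ℕ → ℝ}
    {s : ℝ} {μn : ℕ → Measure (Ed d)} {μ : Measure (Ed d)} {xn : ℕ → Ed d} {x : Ed d}
    (h : ∀ n, sn n < t₁ ↔ s < t₁) (hs : Tendsto sn atTop (𝓝 s)) (hμn : ∀ n, MemP d 2 (μn n))
    (hμ : MemP d 2 μ) (hw : WConv d 2 μn μ) (hx : Tendsto xn atTop (𝓝 x)) :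
    ConvC2 (fun n => mergedDeriv FD ΨD hT t₁ (sn n) (μn n)) xn (mergedDeriv FD ΨD hT t₁ s μ) x := by
  have hw1 := hw.one_of_two hμ hμn
  by_cases hst : s < t₁
  · simp only [mergedDeriv, if_pos hst, if_pos ((h _).2 hst)]
    exact FD.convC2 (fun n => (projIcc 0 T hT _).2) (projIcc 0 T hT _).2
      (((continuous_subtype_val.comp continuous_projIcc).tendsto s).comp hs) hμn hμ hw1 hx
  · simp only [mergedDeriv, if_neg hst, if_neg (fun h' => hst ((h _).1 h'))]
    exact ΨD.convC2 hμn hμ hw1 hx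

theorem A1Data.tendsto_extF (FD : A1Data d T) (hT : 0 ≤ T) {sn : ℕ → ℝ}
    {s : ℝ} {μn : ℕ → Measure (Ed d)} {μ : Measure (Ed d)}
    (hs : Tendsto sn atTop (𝓝 s)) (hμn : ∀ n, MemP d 2 (μn n))
    (hμ : MemP d 2 μ) (hw : WConv d 1 μn μ) :
    Tendsto (fun n => FD.extF hT (sn n) (μn n)) atTop (𝓝 (FD.extF hT s μ)) :=
  FD.contF.tendsto (fun _ => (projIcc 0 T hT _).2) (projIcc 0 T hT _).2
    (((continuous_subtype_val.comp continuous_projIcc).tendsto s).comp hs) hμn hμ hw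

theorem tendsto_mergedData (FD : A1Data d T) (ΨD : A2Data d) (hT : 0 ≤ T) {t₁ : ℝ} {sn : ℕ → ℝ}
    {s : ℝ} {μn : ℕ → Measure (Ed d)} {μ : Measure (Ed d)}
    (h : ∀ n, sn n < t₁ ↔ s < t₁) (hs : Tendsto sn atTop (𝓝 s)) (hμn : ∀ n, MemP d 2 (μn n))
    (hμ : MemP d 2 μ) (hw : WConv d 2 μn μ) :
    Tendsto (fun n => mergedData FD ΨD hT t₁ (sn n) (μn n)) atTop
      (𝓝 (mergedData FD ΨD hT t₁ s μ)) := by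
  have hw1 := hw.one_of_two hμ hμn
  by_cases hst : s < t₁
  · simp only [mergedData, if_pos hst, if_pos ((h _).2 hst)]
    exact FD.tendsto_extF hT hs hμn hμ hw1
  · simp only [mergedData, if_neg hst, if_neg (fun h' => hst ((h _).1 h'))]
    exact ΨD.tendsto hμn hμ hw1

theorem exists_source_mergedData (FD : A1Data d T) (ΨD : A2Data d) (hT : 0 ≤ T) {t₁ : ℝ}
    (ht₁ : 0 ≤ t₁) :
    ∃ c, Source d t₁ c (FD.extF hT) (mergedData FD ΨD hT t₁) (mergedDeriv FD ΨD hT t₁) := by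
  obtain ⟨cF, hcF⟩ := FD.bddF
  obtain ⟨cD, hcD⟩ := FD.bddDeriv
  obtain ⟨cψ, hcψ⟩ := ΨD.derivGrowth
  have hc1 : ∀ (a : ℝ) (y : ℝ), a ≤ cD → a ≤ (|cF| + |cD| + 2 * |cψ|) * (1 + y ^ 2) :=
    fun a y h => by
      refine (h.trans (le_abs_self cD)).trans ?_
      have := abs_nonneg cF
      have := abs_nonneg cψ
      nlinarith [abs_nonneg cD, sq_nonneg y, mul_nonneg (abs_nonneg cD) (sq_nonneg y)]
  have hc2 : ∀ (a y : ℝ), 0 ≤ y → a ≤ cψ * (1 + y) → a ≤ (|cF| + |cD| + 2 * |cψ|) * (1 + y ^ 2) :=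
    fun a y hy h => by
      have h1 : cψ * (1 + y) ≤ |cψ| * (1 + y) :=
        mul_le_mul_of_nonneg_right (le_abs_self _) (by linarith)
      have h2 : |cψ| * (1 + y) ≤ |cψ| * (2 * (1 + y ^ 2)) :=
        mul_le_mul_of_nonneg_left (by nlinarith [sq_nonneg (y - 1)]) (abs_nonneg _)
      have h3 : 0 ≤ (|cF| + |cD|) * (1 + y ^ 2) := by positivity
      linarith
  refine ⟨|cF| + |cD| + 2 * |cψ|, ht₁, fun s => ⟨fun m mn hm hmn hw => ?_, fun m m' hm hm' => ?_,
    fun m hm => ?_, fun m hm => ?_⟩, ?_, ?_, ?_, ?_, ?_, ?_, ?_, ?_⟩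
  · exact tendsto_mergedData FD ΨD hT (fun _ => Iff.rfl) tendsto_const_nhds hmn hm hw
  · unfold mergedData mergedDeriv
    split_ifs
    · exact FD.measDeriv _ (projIcc 0 T hT s).2 m hm m' hm'
    · exact ΨD.measDeriv m hm m' hm'
  · unfold mergedDeriv
    split_ifs
    · exact FD.normalized _ (projIcc 0 T hT s).2 m hm
    · exact ΨD.normalized m hm
  · unfold mergedDeriv
    split_ifs
    · have hb := hcD _ (projIcc 0 T hT s).2 m hm
      exact ⟨FD.smoothX _ (projIcc 0 T hT s).2 m hm, fun x => hc1 _ _ (hb x).1,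
        fun x => hc1 _ _ (hb x).2.1, fun x => hc1 _ _ (hb x).2.2⟩
    · have hb := hcψ m hm
      exact ⟨ΨD.smoothX m hm, fun x => hc2 _ _ (norm_nonneg _) (hb x).1,
        fun x => hc2 _ _ (norm_nonneg _) (hb x).2.1, fun x => hc2 _ _ (norm_nonneg _) (hb x).2.2⟩
  · exact fun sn s μn μ xn x h hs hμn hμ hw _ => tendsto_mergedData FD ΨD hT h hs hμn hμ hw
  · exact fun sn s μn μ xn x h hs hμn hμ hw hx =>
      (convC2_mergedDeriv FD ΨD hT h hs hμn hμ hw hx).1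
  · exact fun sn s μn μ xn x h hs hμn hμ hw hx =>
      (convC2_mergedDeriv FD ΨD hT h hs hμn hμ hw hx).2.1
  · exact fun sn s μn μ xn x h hs hμn hμ hw hx =>
      (convC2_mergedDeriv FD ΨD hT h hs hμn hμ hw hx).2.2
  · exact fun s hs => if_pos hs
  · exact fun _ _ _ _ hs hμn hμ hw => FD.tendsto_extF hT hs hμn hμ hw
  · intro μn μ hμn hμ hw
    simp only [mergedData, lt_irrefl, if_false]
    exact ΨD.tendsto hμn hμ hw
  · intro s μ hμ
    refine (hcF _ (projIcc 0 T hT s).2 μ hμ).trans ?_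
    linarith [le_abs_self cF, abs_nonneg cD, abs_nonneg cψ]

end Data

section TestFunction

variable {d : ℕ} {t₁ c : ℝ} {F₀ u : ℝ → Measure (Ed d) → ℝ} {du : ℝ → Measure (Ed d) → Ed d → ℝ}

theorem Source.contD1 (hS : Source d t₁ c F₀ u du) : ContD1 d t₁ (duhamelSol t₁ F₀ u) := by
  intro t _ m hm ε hε
  obtain ⟨η, hη, H⟩ := exists_delta_of_seq (k := 1) one_ne_zero (S := Icc 0 t₁) (t := t) (m := m)
    (x := 0) (P := fun t' m' _ => |duhamelSol t₁ F₀ u t' m' - duhamelSol t₁ F₀ u t m| < ε) hm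
    fun tn mn xn _ htn hmn hw _ => Tendsto.eventually_abs_sub_lt (hS.tendsto_duhamelSol htn hm hmn hw) hε
  exact ⟨η, hη, fun t' ht' m' hm' h1 h2 =>
    H t' ht' m' hm' 0 h1 (by simpa using h2) (by simpa using hη)⟩

/-- The candidate solution as a test function. -/
def Source.testFn (hS : Source d t₁ c F₀ u du) : TestFn d t₁ where
  φ := duhamelSol t₁ F₀ u
  φt t m := -(1 / 2 * ∫ x, lapl d (duhamel t₁ du t m) x ∂m) - F₀ t m
  δφ := duhamel t₁ du
  lsc t ht m hm ε hε := by
    obtain ⟨η, hη, H⟩ := hS.contD1 t ht m hm ε hε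
    refine ⟨η, hη, fun t' ht' m' hm' h1 h2 => ?_⟩
    linarith [(abs_lt.1 (H t' ht' m' hm' h1 h2)).1]
  d2cont t _ m hm ε hε := by
    obtain ⟨η, hη, H⟩ := exists_delta_of_seq (k := 2) two_ne_zero (S := Icc 0 t₁) (t := t) (m := m)
      (x := 0) (P := fun t' m' _ => |duhamelSol t₁ F₀ u t' m' - duhamelSol t₁ F₀ u t m| < ε) hm
      fun tn mn xn _ htn hmn hw _ =>
        Tendsto.eventually_abs_sub_lt (hS.tendsto_duhamelSol htn hm hmn (hw.one_of_two hm hmn)) hε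
    exact ⟨η, hη, fun t' ht' m' hm' h1 h2 =>
      H t' ht' m' hm' 0 h1 (by simpa using h2) (by simpa using hη)⟩
  timeDeriv _ hm _ ht := hS.timeDeriv ht hm
  measDeriv _ ht _ hm _ hm' := hS.measDeriv ht hm hm'
  normalized _ ht _ hm := hS.normalized ht.1 hm
  smoothX _ ht _ hm := (hS.quadC2_duhamel ht.1 hm).1.smooth
  quadGrowth := ⟨_, fun _ ht _ hm x =>
    have h := (hS.quadC2_duhamel ht.1 hm).1
    ⟨h.bound x, h.bound_fderiv x, h.bound_iteratedFDeriv x⟩⟩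
  d2contDeriv t ht m hm x ε hε := by
    obtain ⟨η, hη, H⟩ := exists_delta_of_seq (k := 2) two_ne_zero (S := Ico 0 t₁) (t := t) (m := m)
      (x := x) (P := fun t' m' x' =>
        |(-(1 / 2 * ∫ x, lapl d (duhamel t₁ du t' m') x ∂m') - F₀ t' m') -
          (-(1 / 2 * ∫ x, lapl d (duhamel t₁ du t m) x ∂m) - F₀ t m)| < ε ∧
        |duhamel t₁ du t' m' x' - duhamel t₁ du t m x| < ε ∧
        ‖fderiv ℝ (duhamel t₁ du t' m') x' - fderiv ℝ (duhamel t₁ du t m) x‖ < ε ∧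
        ‖iteratedFDeriv ℝ 2 (duhamel t₁ du t' m') x' -
          iteratedFDeriv ℝ 2 (duhamel t₁ du t m) x‖ < ε) hm
      fun tn mn xn htnS htn hmn hw hx => by
        have htn0 : ∀ n, 0 ≤ tn n := fun n => (htnS n).1
        have e1 := ((hS.tendsto_integral_lapl ht htn0 htn hm hmn hw).const_mul (1 / 2)).neg.sub
          (hS.tendsto_source _ _ _ _ htn hmn hm (hw.one_of_two hm hmn))
        have e2 := tendsto_duhamel hS.nonneg hS.seqCont_deriv hS.quadBdd ht.2 htn0 htn hm hmn hw hx
        have e3 := hS.tendsto_fderiv ht htn0 htn hm hmn hw hx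
        have e4 := tendsto_iteratedFDeriv_two_iff.2
          (hS.tendsto_fderiv_fderiv ht htn0 htn hm hmn hw hx)
        filter_upwards [Tendsto.eventually_abs_sub_lt e1 hε, Tendsto.eventually_abs_sub_lt e2 hε,
          Metric.tendsto_nhds.1 e3 ε hε, Metric.tendsto_nhds.1 e4 ε hε] with n h1 h2 h3 h4
        rw [dist_eq_norm] at h3 h4
        exact ⟨h1, h2, h3, h4⟩
    exact ⟨η, hη, fun t' ht' m' hm' x' h1 h2 h3 => H t' ht' m' hm' x' h1 (by simpa using h2) h3⟩

end TestFunction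

section Uniqueness

variable {d : ℕ} {t₁ : ℝ} (Φ : TestFn d t₁)

theorem TestFn.convC2 {tn : ℕ → ℝ} {t : ℝ} {mn : ℕ → Measure (Ed d)} {m : Measure (Ed d)}
    (htn : ∀ n, tn n ∈ Ico 0 t₁) (ht : t ∈ Ico 0 t₁) (h : Tendsto tn atTop (𝓝 t))
    (hmn : ∀ n, MemP d 2 (mn n)) (hm : MemP d 2 m) (hw : WConv d 2 mn m) {xn : ℕ → Ed d} {x : Ed d}
    (hx : Tendsto xn atTop (𝓝 x)) : ConvC2 (fun n => Φ.δφ (tn n) (mn n)) xn (Φ.δφ t m) x := by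
  refine convC2_of_forall_eventually fun ε hε => ?_
  obtain ⟨η, hη, H⟩ := Φ.d2contDeriv t ht m hm x ε hε
  filter_upwards [Tendsto.eventually_abs_sub_lt h hη, hw.eventually_wdist_two_lt hη,
    Tendsto.eventually_norm_sub_lt hx hη] with n h1 h2 h3
  exact (H _ (htn n) _ (hmn n) _ h1 h2 h3).2

theorem TestFn.tendsto {tn : ℕ → ℝ} {t : ℝ} {mn : ℕ → Measure (Ed d)} {m : Measure (Ed d)}
    (htn : ∀ n, tn n ∈ Icc 0 t₁) (ht : t ∈ Icc 0 t₁) (h : Tendsto tn atTop (𝓝 t))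
    (hmn : ∀ n, MemP d 2 (mn n)) (hm : MemP d 2 m) (hw : WConv d 2 mn m) :
    Tendsto (fun n => Φ.φ (tn n) (mn n)) atTop (𝓝 (Φ.φ t m)) := by
  refine Metric.tendsto_nhds.2 fun ε hε => ?_
  obtain ⟨η, hη, H⟩ := Φ.d2cont t ht m hm ε hε
  filter_upwards [Tendsto.eventually_abs_sub_lt h hη, hw.eventually_wdist_two_lt hη] with n h1 h2
  exact H _ (htn n) _ (hmn n) h1 h2

theorem TestFn.exists_regFun : ∃ c, ∀ t ∈ Ico 0 t₁, RegFun c (Φ.φ t) (Φ.δφ t) := by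
  obtain ⟨c, hc⟩ := Φ.quadGrowth
  refine ⟨c, fun t ht => ⟨fun m mn hm hmn hw => ?_, fun m m' hm hm' => Φ.measDeriv t ht m hm m' hm',
    fun m hm => Φ.normalized t ht m hm, fun m hm => ⟨Φ.smoothX t ht m hm, fun x => (hc t ht m hm x).1,
      fun x => (hc t ht m hm x).2.1, fun x => (hc t ht m hm x).2.2⟩⟩⟩
  exact Φ.tendsto (fun _ => ⟨ht.1, ht.2.le⟩) ⟨ht.1, ht.2.le⟩ tendsto_const_nhds hmn hm hw

/-- The chain rule along the heat flow. -/
theorem TestFn.hasDerivAt_heatLaw {t s : ℝ} (ht : 0 ≤ t) (hts : t < s) (hs : s < t₁)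
    {m : Measure (Ed d)} (hm : MemP d 2 m) :
    HasDerivAt (fun s => Φ.φ s (heatLaw (s - t) m))
      (Φ.φt s (heatLaw (s - t) m) +
        1 / 2 * ∫ x, lapl d (Φ.δφ s (heatLaw (s - t) m)) x ∂(heatLaw (s - t) m)) s := by
  obtain ⟨c, hc⟩ := Φ.exists_regFun
  have hs0 : s ∈ Ico 0 t₁ := ⟨by linarith, hs⟩
  have hP := memP_heatLaw (s - t) hm
  have hd := (Φ.timeDeriv (heatLaw (s - t) m) hP s hs0).hasDerivAt
    (Icc_mem_nhds (by linarith) hs)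
  rw [hasDerivAt_iff_tendsto_slope] at hd ⊢
  refine tendsto_of_seq_tendsto fun sn hsn => ?_
  have h1 : Tendsto sn atTop (𝓝 s) := hsn.mono_right nhdsWithin_le_nhds
  have h2 : ∀ᶠ n in atTop, sn n ≠ s := hsn.eventually (eventually_mem_nhdsWithin)
  obtain ⟨N, hN⟩ := eventually_atTop.1 (h2.and (h1.eventually (Ioo_mem_nhds hts hs)))
  rw [← tendsto_add_atTop_iff_nat N]
  have hN' : ∀ n, sn (n + N) ≠ s ∧ sn (n + N) ∈ Ioo t t₁ := fun n => hN _ (Nat.le_add_left _ _)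
  have hsn' : ∀ n, sn (n + N) ∈ Ico 0 t₁ := fun n => ⟨by linarith [(hN' n).2.1], (hN' n).2.2⟩
  have h1' := (tendsto_add_atTop_iff_nat N).2 h1
  have key := tendsto_heatLaw_slope (U := fun n => Φ.φ (sn (n + N)))
    (δU := fun n => Φ.δφ (sn (n + N))) (fun n => hc _ (hsn' n)) hm (sub_nonneg.2 hts.le)
    (τn := fun n => sn (n + N) - t) (fun n => sub_nonneg.2 (hN' n).2.1.le)
    (fun n h => (hN' n).1 (sub_left_injective h)) (h1'.sub_const t)
    (((hc s hs0).quad _ hP).continuous_lapl) (fun μ hμ hw x =>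
      tendsto_prod_nhds_of_seq (g := fun n y => lapl d (Φ.δφ (sn (n + N)) (μ n)) y)
        fun φ xn hφ hx => tendsto_lapl (Φ.convC2 (fun n => hsn' (φ n)) hs0 (h1'.comp hφ)
          (fun n => hμ _) hP (hw.comp_tendsto hφ) hx).2.2)
  refine (((hd.comp hsn).comp (tendsto_add_atTop_nat N)).add key).congr fun n => ?_
  have hne : sn (n + N) - s ≠ 0 := sub_ne_zero.2 (hN' n).1
  simp only [Function.comp_apply, slope_def_field, sub_sub_sub_cancel_right]
  field_simp
  ring

theorem TestFn.eq_of_equation {F : ℝ → Measure (Ed d) → ℝ} {ψ : Measure (Ed d) → ℝ} {t : ℝ}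
    (heq : ∀ t ∈ Ico 0 t₁, ∀ m : Measure (Ed d), MemP d 2 m →
      Φ.φt t m + (1 / 2) * (∫ x, lapl d (Φ.δφ t m) x ∂m) + F t m = 0)
    (hψ : ∀ m : Measure (Ed d), MemP d 2 m → Φ.φ t₁ m = ψ m) (ht : t ∈ Icc 0 t₁)
    {m : Measure (Ed d)} (hm : MemP d 2 m)
    (hF : IntervalIntegrable (fun s => F s (heatLaw (s - t) m)) volume t t₁) :
    Φ.φ t m = ψ (heatLaw (t₁ - t) m) + ∫ s in t..t₁, F s (heatLaw (s - t) m) := by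
  have := hm.1
  have hcont : ContinuousOn (fun s => Φ.φ s (heatLaw (s - t) m)) (Icc t t₁) := by
    rw [continuousOn_iff_continuous_domRestrict, continuous_iff_seqContinuous]
    intro sn s hs
    have h1 : Tendsto (fun n => (sn n : ℝ)) atTop (𝓝 (s : ℝ)) :=
      (continuous_subtype_val.tendsto s).comp hs
    exact Φ.tendsto (fun n => ⟨ht.1.trans (sn n).2.1, (sn n).2.2⟩) ⟨ht.1.trans s.2.1, s.2.2⟩ h1
      (fun n => memP_heatLaw _ hm) (memP_heatLaw _ hm) (wconv_heatLaw hm (h1.sub_const t))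
  have h := intervalIntegral.integral_eq_sub_of_hasDerivAt_of_le ht.2 hcont
    (f' := fun s => -F s (heatLaw (s - t) m)) (fun s hs => ?_) hF.neg
  · rw [intervalIntegral.integral_neg, sub_self, heatLaw_of_nonpos le_rfl,
      hψ _ (memP_heatLaw _ hm)] at h
    linarith
  · refine (Φ.hasDerivAt_heatLaw ht.1 hs.1 hs.2 hm).congr_deriv ?_
    linarith [heq s ⟨ht.1.trans hs.1.le, hs.2⟩ _ (memP_heatLaw (s - t) hm)]

end Uniqueness

/-- Let `F` satisfy (A1), `ψ` satisfy (A2) and `t₁ ∈ [0,T]`. Then the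
terminal value problem
`∂_t φ + ½ ∫ div[D_m φ](t,m,x) dm(x) + F(t,m) = 0` on `[0,t₁) × 𝒫₂`, `φ(t₁,·) = ψ`,
admits as unique classical solution the map
`φ(t,m) = ψ(p^{t,m}_{t₁}) + ∫_t^{t₁} F(s, p^{t,m}_s) ds`, which is continuous and
satisfies (A3). -/
theorem classical_solution_heat_equation (d : ℕ) (T : ℝ) (hT : 0 ≤ T)
    (FD : A1Data d T) (ΨD : A2Data d) (t₁ : ℝ) (ht₁ : t₁ ∈ Set.Icc 0 T) :
    (∃ Φ : TestFn d t₁,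
      (∀ t ∈ Set.Icc 0 t₁, ∀ m : Measure (Ed d), MemP d 2 m →
        Φ.φ t m = ΨD.ψ (heatFlow d t t₁ m) + ∫ s in t..t₁, FD.F s (heatFlow d t s m)) ∧
      ContD1 d t₁ Φ.φ ∧
      (∀ t ∈ Set.Ico 0 t₁, ∀ m : Measure (Ed d), MemP d 2 m →
        Φ.φt t m + (1 / 2) * (∫ x, lapl d (Φ.δφ t m) x ∂m) + FD.F t m = 0) ∧
      (∀ m : Measure (Ed d), MemP d 2 m → Φ.φ t₁ m = ΨD.ψ m)) ∧
    (∀ Φ' : TestFn d t₁, ContD1 d t₁ Φ'.φ →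
      (∀ t ∈ Set.Ico 0 t₁, ∀ m : Measure (Ed d), MemP d 2 m →
        Φ'.φt t m + (1 / 2) * (∫ x, lapl d (Φ'.δφ t m) x ∂m) + FD.F t m = 0) →
      (∀ m : Measure (Ed d), MemP d 2 m → Φ'.φ t₁ m = ΨD.ψ m) →
      ∀ t ∈ Set.Icc 0 t₁, ∀ m : Measure (Ed d), MemP d 2 m →
        Φ'.φ t m = ΨD.ψ (heatFlow d t t₁ m) + ∫ s in t..t₁, FD.F s (heatFlow d t s m)) := by
  have hmem : ∀ s ∈ Icc 0 t₁, s ∈ Icc 0 T := fun s hs => ⟨hs.1, hs.2.trans ht₁.2⟩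
  obtain ⟨c, hS⟩ := exists_source_mergedData FD ΨD hT ht₁.1
  have hterm : mergedData FD ΨD hT t₁ t₁ = ΨD.ψ := if_neg (lt_irrefl t₁)
  have h_int : ∀ t ∈ Icc 0 t₁, ∀ m : Measure (Ed d), MemP d 2 m →
      EqOn (fun s => FD.extF hT s (heatLaw (s - t) m)) (fun s => FD.F s (heatLaw (s - t) m))
        (uIcc t t₁) := fun t ht m _ s hs => by
    rw [uIcc_of_le ht.2] at hs
    simp only [FD.extF_of_mem hT (hmem s ⟨ht.1.trans hs.1, hs.2⟩)]
  refine ⟨⟨hS.testFn, fun t ht m hm => ?_, hS.contD1, fun t ht m hm => ?_, fun m hm => ?_⟩,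
    fun Φ' _ heq hψ t ht m hm => ?_⟩
  · have := hm.1
    simp only [heatFlow_eq_heatLaw]
    rw [← intervalIntegral.integral_congr (h_int t ht m hm), ← hterm]
    exact duhamelSol_eq_intervalIntegral ht m
  · change -(1 / 2 * ∫ x, lapl d (duhamel t₁ (mergedDeriv FD ΨD hT t₁) t m) x ∂m) -
      FD.extF hT t m + 1 / 2 * (∫ x, lapl d (duhamel t₁ (mergedDeriv FD ΨD hT t₁) t m) x ∂m) +
      FD.F t m = 0
    rw [FD.extF_of_mem hT (hmem t ⟨ht.1, ht.2.le⟩)]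
    ring
  · have := hm.1
    rw [← hterm]
    exact duhamelSol_terminal m ht₁.1
  · have := hm.1
    simp only [heatFlow_eq_heatLaw]
    refine Φ'.eq_of_equation heq hψ ht hm ?_
    exact ((hS.continuous_source_heatLaw t hm).intervalIntegrable t t₁).congr fun s hs =>
      h_int t ht m hm (uIoc_subset_uIcc hs)

end
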